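/- arXiv:0810.4996 — 2 statements merged into one kernel-verified Lean document; each statement's English description precedes it below -/
import Mathlib

section
/- Let l, m be positive integers. There exists a unique map MF assigning to every (m+1)-tuple (Δ₀, …, Δ_m) of convex bodies in ℝ^l × ℝ^m a convex body MF(Δ₀, …, Δ_m) ⊂ ℝ^l such that: MF is symmetric in its arguments; MF is Minkowski-multilinear (MF(Δ + Δ', Δ₁, …, Δ_m) = MF(Δ, Δ₁, …, Δ_m) + MF(Δ', Δ₁, …, Δ_m), and likewise in every argument); and for every convex body Δ ⊂ ℝ^l × ℝ^m and every linear functional γ on ℝ^l, the support function of MF(Δ, …, Δ) at γ equals ∫_{v(Δ)} (sup_{x ∈ Δ_a} γ(x)) da, i.e. MF(Δ, …, Δ) is the Minkowski integral ∫Δ. (Existence and uniqueness of mixed fiber bodies.) -/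
open MeasureTheory

/-- The value at `γ` of the support function of the Minkowski integral `∫ Δ` of a convex body
`Δ ⊂ ℝ^l × ℝ^m`: the integral over the projection `v(Δ) ⊂ ℝ^m` of the support function of the
fiber `Δ_a` (Lebesgue measure on `ℝ^m`). -/
noncomputable def minkowskiIntegralSupport (l m : ℕ)
    (Δ : ConvexBody ((Fin l → ℝ) × (Fin m → ℝ))) (γ : (Fin l → ℝ) →ₗ[ℝ] ℝ) : ℝ :=
  ∫ a in Prod.snd '' (Δ : Set ((Fin l → ℝ) × (Fin m → ℝ))),
    sSup ((fun x => γ x) '' {x : Fin l → ℝ | (x, a) ∈ (Δ : Set ((Fin l → ℝ) × (Fin m → ℝ)))})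

/-- The alternating sum of `F` over the partial sums of the family `Δ`, that is, `F` polarized. -/
def polarization {ι M : Type*} [Fintype ι] [DecidableEq ι] [AddCommMonoid M] (F : M → ℝ)
    (Δ : ι → M) : ℝ :=
  ∑ S : Finset ι, (-1 : ℝ) ^ (Sᶜ).card * F (∑ i ∈ S, Δ i)

section Combinatorics

variable {ι : Type*} [Fintype ι] [DecidableEq ι]

theorem sum_finset_split {G : Type*} [AddCommMonoid G] (i : ι) (f : Finset ι → G) :
    ∑ S, f S = ∑ T ∈ (Finset.univ.erase i).powerset, (f T + f (insert i T)) := by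
  rw [Finset.sum_add_distrib, ← Finset.sum_powerset_insert (Finset.notMem_erase i _),
    Finset.insert_erase (Finset.mem_univ i), Finset.powerset_univ]

theorem sum_superset_neg_one_pow (T : Finset ι) :
    ∑ S : Finset ι, (if T ⊆ S then (-1 : ℝ) ^ (Sᶜ).card else 0)
      = if T = Finset.univ then 1 else 0 := by
  have h := Finset.sum_powerset_neg_one_pow_card (x := Tᶜ)
  have h' : ∑ R ∈ (Tᶜ).powerset, (-1 : ℝ) ^ R.card = if Tᶜ = ∅ then 1 else 0 := by
    exact_mod_cast congrArg (Int.cast : ℤ → ℝ) h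
  simp only [Finset.compl_eq_empty_iff] at h'
  rw [← h', ← Finset.sum_filter]
  refine Finset.sum_nbij' (fun S => Sᶜ) (fun S => Sᶜ) ?_ ?_ ?_ ?_ ?_
  · intro S hS
    simpa using hS
  · intro S hS
    rw [Finset.mem_powerset] at hS
    simpa using Finset.subset_compl_comm.mp hS
  all_goals simp

theorem sum_piFinset_alternating {n : Type*} [Fintype n] [DecidableEq n] (g : (n → ι) → ℝ) :
    ∑ S : Finset ι, (-1 : ℝ) ^ (Sᶜ).card * ∑ f ∈ Fintype.piFinset (fun _ : n => S), g f
      = ∑ f : n → ι, if Function.Surjective f then g f else 0 := by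
  have h : ∀ S : Finset ι, (-1 : ℝ) ^ (Sᶜ).card * ∑ f ∈ Fintype.piFinset (fun _ : n => S), g f
      = ∑ f : n → ι, (if Finset.univ.image f ⊆ S then (-1 : ℝ) ^ (Sᶜ).card else 0) * g f := by
    intro S
    rw [Finset.mul_sum, ← Finset.sum_subset (Finset.subset_univ (Fintype.piFinset fun _ : n => S))]
    · refine Finset.sum_congr rfl fun f hf => ?_
      rw [if_pos]
      intro i hi
      obtain ⟨j, -, rfl⟩ := Finset.mem_image.mp hi
      exact Fintype.mem_piFinset.mp hf j
    · intro f _ hf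
      rw [if_neg, zero_mul]
      intro hS
      exact hf (Fintype.mem_piFinset.mpr fun j => hS (Finset.mem_image_of_mem f (Finset.mem_univ j)))
  simp_rw [h]
  rw [Finset.sum_comm]
  refine Finset.sum_congr rfl fun f _ => ?_
  rw [← Finset.sum_mul, sum_superset_neg_one_pow]
  have : Finset.univ.image f = Finset.univ ↔ Function.Surjective f := by
    rw [← Finset.coe_eq_univ, Finset.coe_image, Finset.coe_univ, Set.image_univ,
      Set.range_eq_univ]
  simp [this]

theorem sum_surjective_eq_sum_perm (g : (ι → ι) → ℝ) :
    (∑ f : ι → ι, if Function.Surjective f then g f else 0) = ∑ σ : Equiv.Perm ι, g σ := by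
  rw [← Finset.sum_filter]
  symm
  refine Finset.sum_bij (fun σ _ => (σ : ι → ι)) ?_ ?_ ?_ ?_
  · intro σ _
    simpa using σ.surjective
  · intro σ _ τ _ h
    exact DFunLike.coe_injective h
  · intro f hf
    simp only [Finset.mem_filter, Finset.mem_univ, true_and] at hf
    exact ⟨Equiv.ofBijective f (Finite.injective_iff_bijective.mp
      (Finite.injective_iff_surjective.mpr hf)), Finset.mem_univ _, rfl⟩
  · intros
    rfl

theorem polarization_nat_pow :
    ∑ S : Finset ι, (-1 : ℝ) ^ (Sᶜ).card * (S.card : ℝ) ^ (Fintype.card ι)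
      = (Fintype.card ι).factorial := by
  have h1 := sum_piFinset_alternating (ι := ι) (n := ι) (fun _ => 1)
  rw [sum_surjective_eq_sum_perm (fun _ => (1 : ℝ))] at h1
  simpa [Fintype.card_piFinset, Fintype.card_perm] using h1

variable {M : Type*} [AddCommMonoid M]

theorem polarization_comp_equiv {κ : Type*} [Fintype κ] [DecidableEq κ] (F : M → ℝ) (Δ : ι → M)
    (σ : κ ≃ ι) : polarization F (Δ ∘ σ) = polarization F Δ := by
  unfold polarization
  refine Fintype.sum_equiv (Equiv.finsetCongr σ) _ _ fun S => ?_
  rw [Finset.card_compl, Finset.card_compl]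
  simp [Equiv.finsetCongr_apply, Fintype.card_congr σ]

theorem polarization_option (F : M → ℝ) (K : M) (Δ : ι → M) :
    polarization F (fun o : Option ι => o.elim K Δ)
      = ∑ S : Finset ι, (-1 : ℝ) ^ (Sᶜ).card * (F (K + ∑ i ∈ S, Δ i) - F (∑ i ∈ S, Δ i)) := by
  unfold polarization
  rw [sum_finset_split none]
  symm
  refine Finset.sum_bij (fun S _ => S.map Function.Embedding.some) ?_ ?_ ?_ ?_
  · intro S _
    rw [Finset.mem_powerset]
    intro o ho
    obtain ⟨i, -, rfl⟩ := Finset.mem_map.mp ho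
    simp
  · intro S _ T _ h
    exact Finset.map_injective _ h
  · intro T hT
    refine ⟨Finset.eraseNone T, Finset.mem_univ _, ?_⟩
    rw [Finset.map_some_eraseNone]
    refine Finset.erase_eq_of_notMem fun h => ?_
    simpa using Finset.mem_powerset.mp hT h
  · intro S _
    have hn : none ∉ S.map Function.Embedding.some := by simp
    have hle : S.card ≤ Fintype.card ι := Finset.card_le_univ S
    rw [Finset.sum_insert hn, Finset.card_compl, Finset.card_compl, Finset.card_compl,
      Finset.card_insert_of_notMem hn, Finset.sum_map, Finset.card_map, Fintype.card_option]
    have e1 : Fintype.card ι + 1 - S.card = (Fintype.card ι - S.card) + 1 := by omega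
    have e2 : Fintype.card ι + 1 - (S.card + 1) = Fintype.card ι - S.card := by omega
    rw [e1, e2, pow_succ]
    simp only [Function.Embedding.some_apply, Option.elim]
    ring

theorem polarization_update_add (F : M → ℝ)
    (h : ∀ Δ : Option ι → M, polarization F Δ = 0) (Δ : ι → M) (i : ι) (K K' : M) :
    polarization F (Function.update Δ i (K + K'))
      = polarization F (Function.update Δ i K) + polarization F (Function.update Δ i K') := by
  have h0 := h fun o => o.elim K' (Function.update Δ i K)
  rw [polarization_option, sum_finset_split i] at h0
  unfold polarization
  rw [sum_finset_split i, sum_finset_split i, sum_finset_split i]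
  rw [← add_zero (Finset.sum _ _ + Finset.sum _ _), ← h0, ← Finset.sum_add_distrib,
    ← Finset.sum_add_distrib]
  refine Finset.sum_congr rfl fun T hT => ?_
  have hi : i ∉ T := fun hi => by simpa using Finset.mem_powerset.mp hT hi
  have hs : ∀ L : M, ∑ j ∈ T, Function.update Δ i L j = ∑ j ∈ T, Δ j := fun L =>
    Finset.sum_congr rfl fun j hj => Function.update_of_ne (ne_of_mem_of_not_mem hj hi) _ _
  have hc : (Tᶜ).card = ((insert i T)ᶜ).card + 1 := by
    have := Finset.card_le_univ (insert i T)
    rw [Finset.card_compl, Finset.card_compl, Finset.card_insert_of_notMem hi] at *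
    omega
  simp only [Finset.sum_insert hi, hs, Function.update_self, hc, pow_succ]
  rw [show K' + (K + ∑ j ∈ T, Δ j) = K + K' + ∑ j ∈ T, Δ j by abel]
  ring

theorem polarization_diagonal (F : M → ℝ) (K : M) (n : ℕ) (hn : Fintype.card ι = n + 1)
    (h : ∀ k : ℕ, F (k • K) = (k : ℝ) ^ (n + 1) * F K) :
    polarization F (fun _ : ι => K) = (n + 1).factorial * F K := by
  unfold polarization
  simp only [Finset.sum_const, h]
  rw [← hn, ← polarization_nat_pow (ι := ι), Finset.sum_mul]
  exact Finset.sum_congr rfl fun S _ => by ring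

/-- A symmetric multi-additive function is determined by its diagonal. -/
theorem polarization_of_multiadditive (B : (ι → M) → ℝ)
    (hsymm : ∀ (Δ : ι → M) (σ : Equiv.Perm ι), B (Δ ∘ σ) = B Δ)
    (hadd : ∀ (Δ : ι → M) (i : ι) (K K' : M), B (Function.update Δ i (K + K'))
      = B (Function.update Δ i K) + B (Function.update Δ i K')) (Δ : ι → M) :
    polarization (fun K => B fun _ => K) Δ = (Fintype.card ι).factorial * B Δ := by
  have hz : ∀ (Δ : ι → M) (i : ι), B (Function.update Δ i 0) = 0 := by
    intro Δ i
    have := hadd Δ i 0 0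
    rw [add_zero] at this
    linarith
  have hsmul : ∀ (Δ : ι → M) (i : ι) (c : ℕ) (K : M),
      B (Function.update Δ i (c • K)) = c • B (Function.update Δ i K) := by
    intro Δ i c K
    induction c with
    | zero => rw [zero_nsmul, zero_nsmul, hz]
    | succ c ih => rw [succ_nsmul, succ_nsmul, hadd, ih]
  let f : MultilinearMap ℕ (fun _ : ι => M) ℝ :=
    { toFun := B
      map_update_add' := by
        intro inst Δ i K K'
        convert hadd Δ i K K'
      map_update_smul' := by
        intro inst Δ i c K
        convert hsmul Δ i c K }
  have hf : ∀ S : Finset ι, B (fun _ => ∑ i ∈ S, Δ i)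
      = ∑ r ∈ Fintype.piFinset (fun _ : ι => S), B (fun i => Δ (r i)) := fun S =>
    f.map_sum_finset (fun _ => Δ) fun _ => S
  unfold polarization
  simp only [hf]
  rw [sum_piFinset_alternating (fun r : ι → ι => B fun i => Δ (r i)),
    sum_surjective_eq_sum_perm (fun r => B fun i => Δ (r i))]
  rw [Finset.sum_congr rfl fun (σ : Equiv.Perm ι) _ => show (B fun i => Δ (σ i)) = B Δ from hsymm Δ σ]
  simp [Fintype.card_perm]

end Combinatorics

section Determinants

variable {ι n : Type*} [Fintype ι] [DecidableEq ι] [Fintype n] [DecidableEq n]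

theorem polarization_det (N : ι → Matrix n n ℝ) :
    polarization Matrix.det N
      = ∑ f : n → ι, if Function.Surjective f then Matrix.det (Matrix.of fun j => N (f j) j)
        else 0 := by
  rw [← sum_piFinset_alternating]
  unfold polarization
  refine Finset.sum_congr rfl fun S _ => ?_
  congr 1
  have h := (Matrix.detRowAlternating (n := n) (R := ℝ)).toMultilinearMap.map_sum_finset
    (fun j (i : ι) => N i j) fun _ => S
  refine Eq.trans ?_ h
  change _ = Matrix.det _
  congr 1
  ext j k
  simp [Matrix.sum_apply]

theorem polarization_det_eq_zero (h : Fintype.card n < Fintype.card ι) (N : ι → Matrix n n ℝ) :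
    polarization Matrix.det N = 0 := by
  rw [polarization_det]
  refine Finset.sum_eq_zero fun f _ => if_neg fun hf => ?_
  exact absurd (Fintype.card_le_of_surjective f hf) (not_le.mpr h)

theorem polarization_mul_det_eq_zero (h : Fintype.card n + 1 < Fintype.card ι)
    (N : ι → ℝ × Matrix n n ℝ) :
    polarization (fun P => P.1 * P.2.det) N = 0 := by
  have := polarization_det_eq_zero (n := Unit ⊕ n) (ι := ι) (by simpa [add_comm] using h)
    fun i => Matrix.fromBlocks (Matrix.of fun _ _ => (N i).1) 0 0 (N i).2
  rw [← this]
  unfold polarization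
  refine Finset.sum_congr rfl fun S _ => ?_
  congr 1
  have : ∑ i ∈ S, Matrix.fromBlocks (Matrix.of fun _ _ => (N i).1) 0 0 (N i).2
      = Matrix.fromBlocks (Matrix.of fun _ _ : Unit => (∑ i ∈ S, N i).1) 0 0 (∑ i ∈ S, N i).2 := by
    ext (a | a) (b | b) <;> simp [Matrix.sum_apply, Prod.fst_sum, Prod.snd_sum]
  rw [this, Matrix.det_fromBlocks_zero₂₁]
  simp

/-- Mixed discriminants of positive semidefinite matrices are nonnegative. -/
theorem polarization_det_nonneg (e : n ≃ ι) (N : ι → Matrix n n ℝ)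
    (hN : ∀ i, (N i).PosSemidef) : 0 ≤ polarization Matrix.det N := by
  rw [← polarization_comp_equiv _ _ e, polarization_det,
    sum_surjective_eq_sum_perm fun f => Matrix.det (Matrix.of fun j => (N ∘ e) (f j) j)]
  have hB : ∀ j, ∃ B : Matrix n n ℝ, (N ∘ e) j = B.transpose * B := by
    intro j
    open scoped MatrixOrder in
    obtain ⟨B, hB⟩ := CStarAlgebra.nonneg_iff_eq_star_mul_self.mp (hN (e j)).nonneg
    exact ⟨B, by simpa [Matrix.star_eq_conjTranspose] using hB⟩
  choose B hB using hB
  let W : (n → n) → Matrix n n ℝ := fun κ => Matrix.of fun i => B i (κ i)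
  have hdet : ∀ σ : Equiv.Perm n, Matrix.det (Matrix.of fun j => (N ∘ e) (σ j) j)
      = ∑ κ : n → n, ((Equiv.Perm.sign σ : ℤ) : ℝ) * (∏ j, W κ (σ j) j) * (W κ).det := by
    intro σ
    have h := (Matrix.detRowAlternating (n := n) (R := ℝ)).toMultilinearMap.map_sum
      (fun j (c : n) => B (σ j) c j • B (σ j) c)
    have h2 : Matrix.det (Matrix.of fun j => (N ∘ e) (σ j) j)
        = (Matrix.detRowAlternating (n := n) (R := ℝ)).toMultilinearMap
          (fun j => ∑ c, B (σ j) c j • B (σ j) c) := by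
      change _ = Matrix.det _
      congr 1
      ext j k
      rw [Matrix.of_apply, hB]
      simp [Matrix.mul_apply]
    rw [h2, h, ← (Equiv.arrowCongr σ.symm (Equiv.refl n)).sum_comp]
    refine Finset.sum_congr rfl fun κ _ => ?_
    have h3 : (W κ).det = (Equiv.Perm.sign σ : ℤ) * ((W κ).submatrix σ id).det := by
      rw [Matrix.det_permute, ← mul_assoc]
      simp [← Int.cast_mul]
    have h4 := (Matrix.detRowAlternating (n := n) (R := ℝ)).toMultilinearMap.map_smul_univ
      (fun j => W κ (σ j) j) (fun j => W κ (σ j))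
    refine Eq.trans h4 ?_
    rw [h3, smul_eq_mul, mul_comm ((Equiv.Perm.sign σ : ℤ) : ℝ), mul_assoc, ← mul_assoc _ _ (Matrix.det _)]
    simp only [← Int.cast_mul, Int.units_coe_mul_self, Int.cast_one, one_mul]
    rfl
  simp_rw [hdet]
  rw [Finset.sum_comm]
  refine Finset.sum_nonneg fun κ _ => ?_
  rw [← Finset.sum_mul, ← Matrix.det_apply']
  exact mul_self_nonneg _

end Determinants

section SupportFunctions

variable {l : ℕ}

theorem linearMap_exists_max {K : ConvexBody (Fin l → ℝ)} (γ : (Fin l → ℝ) →ₗ[ℝ] ℝ) :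
    IsGreatest ((fun x => γ x) '' (K : Set (Fin l → ℝ)))
      (sSup ((fun x => γ x) '' (K : Set (Fin l → ℝ)))) :=
  (K.isCompact.image γ.continuous_of_finiteDimensional).isGreatest_sSup (K.nonempty.image _)

theorem support_add (K L : ConvexBody (Fin l → ℝ)) (γ : (Fin l → ℝ) →ₗ[ℝ] ℝ) :
    sSup ((fun x => γ x) '' ((K + L : ConvexBody (Fin l → ℝ)) : Set (Fin l → ℝ)))
      = sSup ((fun x => γ x) '' (K : Set (Fin l → ℝ)))
        + sSup ((fun x => γ x) '' (L : Set (Fin l → ℝ))) := by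
  have hK := linearMap_exists_max (K := K) γ
  have hL := linearMap_exists_max (K := L) γ
  refine IsGreatest.csSup_eq ⟨?_, ?_⟩
  · obtain ⟨x, hx, hx'⟩ := hK.1
    obtain ⟨y, hy, hy'⟩ := hL.1
    refine ⟨x + y, ?_, ?_⟩
    · rw [ConvexBody.coe_add]
      exact Set.add_mem_add hx hy
    · rw [← hx', ← hy']
      exact map_add γ x y
  · rintro _ ⟨z, hz, rfl⟩
    rw [ConvexBody.coe_add] at hz
    obtain ⟨x, hx, y, hy, rfl⟩ := Set.mem_add.mp hz
    simp only [map_add]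
    exact add_le_add (hK.2 ⟨x, hx, rfl⟩) (hL.2 ⟨y, hy, rfl⟩)

theorem subset_of_support_le {K L : ConvexBody (Fin l → ℝ)}
    (h : ∀ γ : (Fin l → ℝ) →ₗ[ℝ] ℝ, sSup ((fun x => γ x) '' (K : Set (Fin l → ℝ)))
      ≤ sSup ((fun x => γ x) '' (L : Set (Fin l → ℝ)))) :
    (K : Set (Fin l → ℝ)) ⊆ L := by
  intro x hx
  by_contra hxL
  obtain ⟨f, u, hf, hu⟩ := geometric_hahn_banach_closed_point L.convex L.isClosed hxL
  have h1 := (linearMap_exists_max (K := K) (f : (Fin l → ℝ) →ₗ[ℝ] ℝ)).2 ⟨x, hx, rfl⟩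
  obtain ⟨y, hy, hy'⟩ := (linearMap_exists_max (K := L) (f : (Fin l → ℝ) →ₗ[ℝ] ℝ)).1
  have h2 := h (f : (Fin l → ℝ) →ₗ[ℝ] ℝ)
  rw [← hy'] at h2
  have := hf y hy
  simp only [ContinuousLinearMap.coe_coe] at *
  linarith

theorem eq_of_support_eq {K L : ConvexBody (Fin l → ℝ)}
    (h : ∀ γ : (Fin l → ℝ) →ₗ[ℝ] ℝ, sSup ((fun x => γ x) '' (K : Set (Fin l → ℝ)))
      = sSup ((fun x => γ x) '' (L : Set (Fin l → ℝ)))) : K = L :=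
  ConvexBody.ext ((subset_of_support_le fun γ => (h γ).le).antisymm
    (subset_of_support_le fun γ => (h γ).ge))

/-- A sublinear function is the support function of a convex body. -/
theorem exists_convexBody_of_sublinear (M : ((Fin l → ℝ) →ₗ[ℝ] ℝ) → ℝ)
    (hsmul : ∀ c : ℝ, 0 < c → ∀ γ, M (c • γ) = c * M γ)
    (hadd : ∀ γ γ', M (γ + γ') ≤ M γ + M γ') :
    ∃ K : ConvexBody (Fin l → ℝ), ∀ γ : (Fin l → ℝ) →ₗ[ℝ] ℝ,
      sSup ((fun x => γ x) '' (K : Set (Fin l → ℝ))) = M γ := by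
  have h0 : M 0 = 0 := by
    have := hsmul 2 two_pos 0
    rw [smul_zero] at this
    linarith
  let K : Set (Fin l → ℝ) := {x | ∀ γ : (Fin l → ℝ) →ₗ[ℝ] ℝ, γ x ≤ M γ}
  have hex : ∀ γ : (Fin l → ℝ) →ₗ[ℝ] ℝ, ∃ x ∈ K, γ x = M γ := by
    intro γ
    have key : ∃ g : Module.Dual ℝ (Fin l → ℝ) →ₗ[ℝ] ℝ, g γ = M γ ∧ ∀ γ', g γ' ≤ M γ' := by
      have hnonneg : ∀ γ, 0 ≤ M γ + M (-γ) := fun γ => by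
        have := hadd γ (-γ)
        rwa [add_neg_cancel, h0] at this
      by_cases hγ : γ = 0
      · subst hγ
        obtain ⟨g, -, hg⟩ := exists_extension_of_le_sublinear
          (⊥ : Module.Dual ℝ (Fin l → ℝ) →ₗ.[ℝ] ℝ) M hsmul hadd (by
            rintro ⟨x, hx⟩
            obtain rfl : x = 0 := (Submodule.mem_bot ℝ).mp hx
            exact (LinearPMap.map_zero ⊥).trans_le h0.ge)
        exact ⟨g, by rw [map_zero, h0], hg⟩
      · obtain ⟨g, hg1, hg⟩ := exists_extension_of_le_sublinear
          (LinearPMap.mkSpanSingleton γ (M γ) hγ) M hsmul hadd (by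
            rintro ⟨x, hx⟩
            obtain ⟨c, rfl⟩ := Submodule.mem_span_singleton.mp hx
            have happ : LinearPMap.mkSpanSingleton γ (M γ) hγ ⟨c • γ, hx⟩ = c • M γ :=
              LinearPMap.mkSpanSingleton'_apply _ _ _ _ _
            refine happ.trans_le ?_
            rcases lt_trichotomy c 0 with hc | rfl | hc
            · have := hsmul (-c) (neg_pos.mpr hc) (-γ)
              rw [neg_smul_neg] at this
              rw [this, smul_eq_mul]
              nlinarith [hnonneg γ]
            · simp [h0]
            · rw [hsmul c hc, smul_eq_mul])
        refine ⟨g, ?_, hg⟩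
        exact (hg1 ⟨γ, Submodule.mem_span_singleton_self γ⟩).trans
          (LinearPMap.mkSpanSingleton'_apply_self _ _ _ _)
    obtain ⟨g, hg, hg'⟩ := key
    refine ⟨(Module.evalEquiv ℝ (Fin l → ℝ)).symm g, fun γ' => ?_, ?_⟩
    · rw [Module.apply_evalEquiv_symm_apply]
      exact hg' γ'
    · rw [Module.apply_evalEquiv_symm_apply, hg]
  have hclosed : IsClosed K := by
    have : K = ⋂ γ : (Fin l → ℝ) →ₗ[ℝ] ℝ, {x | γ x ≤ M γ} := by
      ext x
      simp [K]
    rw [this]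
    exact isClosed_iInter fun γ =>
      isClosed_le γ.continuous_of_finiteDimensional continuous_const
  have hcompact : IsCompact K := by
    refine (isCompact_univ_pi fun i => isCompact_Icc (a := -M (-LinearMap.proj i))
      (b := M (LinearMap.proj i))).of_isClosed_subset hclosed fun x hx i _ => ⟨?_, ?_⟩
    · have := hx (-LinearMap.proj i)
      simp only [LinearMap.neg_apply, LinearMap.proj_apply] at this
      linarith
    · exact hx (LinearMap.proj i)
  refine ⟨⟨K, ?_, hcompact, ?_⟩, fun γ => ?_⟩
  · intro x hx y hy a b ha hb hab γ
    rw [map_add, map_smul, map_smul, smul_eq_mul, smul_eq_mul]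
    have h : a * M γ + b * M γ = M γ := by rw [← add_mul, hab, one_mul]
    linarith [mul_le_mul_of_nonneg_left (hx γ) ha, mul_le_mul_of_nonneg_left (hy γ) hb]
  · obtain ⟨x, hx, -⟩ := hex 0
    exact ⟨x, hx⟩
  · refine IsGreatest.csSup_eq ⟨?_, ?_⟩
    · obtain ⟨x, hx, hx'⟩ := hex γ
      exact ⟨x, hx, hx'⟩
    · rintro _ ⟨x, hx, rfl⟩
      exact hx γ

end SupportFunctions

section Fibers

variable {l m : ℕ}

/-- The support function at `γ` of the fiber of `K` over `a`. -/
noncomputable def fiberSup (K : Set ((Fin l → ℝ) × (Fin m → ℝ))) (γ : (Fin l → ℝ) →ₗ[ℝ] ℝ)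
    (a : Fin m → ℝ) : ℝ :=
  sSup ((fun x => γ x) '' {x : Fin l → ℝ | (x, a) ∈ K})

variable {K : Set ((Fin l → ℝ) × (Fin m → ℝ))} (hK : IsCompact K)
include hK

theorem fiberSup_isGreatest (γ : (Fin l → ℝ) →ₗ[ℝ] ℝ) {a : Fin m → ℝ} (ha : a ∈ Prod.snd '' K) :
    IsGreatest ((fun x => γ x) '' {x : Fin l → ℝ | (x, a) ∈ K}) (fiberSup K γ a) := by
  have hc : IsCompact {x : Fin l → ℝ | (x, a) ∈ K} := by
    have : {x : Fin l → ℝ | (x, a) ∈ K} = Prod.fst '' (K ∩ {z | z.2 = a}) := by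
      ext x
      simp
    rw [this]
    exact (hK.inter_right (isClosed_eq continuous_snd continuous_const)).image continuous_fst
  obtain ⟨⟨x, b⟩, hx, rfl⟩ := ha
  exact (hc.image γ.continuous_of_finiteDimensional).isGreatest_sSup ⟨_, x, hx, rfl⟩

theorem le_fiberSup (γ : (Fin l → ℝ) →ₗ[ℝ] ℝ) {x : Fin l → ℝ} {a : Fin m → ℝ} (h : (x, a) ∈ K) :
    γ x ≤ fiberSup K γ a :=
  (fiberSup_isGreatest hK γ ⟨_, h, rfl⟩).2 ⟨x, h, rfl⟩

theorem exists_eq_fiberSup (γ : (Fin l → ℝ) →ₗ[ℝ] ℝ) {a : Fin m → ℝ} (ha : a ∈ Prod.snd '' K) :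
    ∃ x, (x, a) ∈ K ∧ γ x = fiberSup K γ a :=
  (fiberSup_isGreatest hK γ ha).1

theorem exists_bound_fiberSup (γ : (Fin l → ℝ) →ₗ[ℝ] ℝ) :
    ∃ R : ℝ, 0 ≤ R ∧ ∀ z ∈ K, |γ z.1| ≤ R := by
  obtain ⟨R, hR⟩ := hK.exists_bound_of_continuousOn
    (γ.continuous_of_finiteDimensional.comp continuous_fst).continuousOn
  exact ⟨max R 0, le_max_right _ _, fun z hz => (hR z hz).trans (le_max_left _ _)⟩

theorem aestronglyMeasurable_fiberSup (γ : (Fin l → ℝ) →ₗ[ℝ] ℝ) :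
    AEStronglyMeasurable (fiberSup K γ) (volume.restrict (Prod.snd '' K)) := by
  classical
  obtain ⟨R, hR0, hR⟩ := exists_bound_fiberSup hK γ
  have hS : MeasurableSet (Prod.snd '' K) := (hK.image continuous_snd).measurableSet
  let G : (Fin m → ℝ) → ℝ := fun a => if a ∈ Prod.snd '' K then fiberSup K γ a else -R - 1
  have hlow : ∀ a ∈ Prod.snd '' K, -R ≤ fiberSup K γ a := by
    intro a ha
    obtain ⟨x, hx, hx'⟩ := exists_eq_fiberSup hK γ ha
    rw [← hx']
    exact (abs_le.mp (hR _ hx)).1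
  have hG : Measurable G := by
    refine measurable_of_Ici fun c => ?_
    by_cases hc : c ≤ -R - 1
    · convert MeasurableSet.univ
      refine Set.eq_univ_of_forall fun a => ?_
      simp only [Set.mem_preimage, Set.mem_Ici, G]
      split_ifs with ha
      · linarith [hlow a ha]
      · exact hc
    · have : G ⁻¹' Set.Ici c = Prod.snd '' (K ∩ {z | c ≤ γ z.1}) := by
        ext a
        simp only [Set.mem_preimage, Set.mem_Ici, G]
        split_ifs with ha
        · constructor
          · intro h
            obtain ⟨x, hx, hx'⟩ := exists_eq_fiberSup hK γ ha
            exact ⟨(x, a), ⟨hx, by simpa [hx'] using h⟩, rfl⟩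
          · rintro ⟨⟨x, b⟩, ⟨hx, h⟩, rfl⟩
            exact le_trans h (le_fiberSup hK γ hx)
        · constructor
          · intro h
            exact absurd h hc
          · rintro ⟨z, ⟨hz, -⟩, rfl⟩
            exact absurd ⟨z, hz, rfl⟩ ha
      rw [this]
      exact ((hK.inter_right (isClosed_le continuous_const
        (γ.continuous_of_finiteDimensional.comp continuous_fst))).image
        continuous_snd).measurableSet
  refine hG.aestronglyMeasurable.congr ?_
  filter_upwards [ae_restrict_mem hS] with a ha
  simp only [G, if_pos ha]

theorem abs_fiberSup_le (γ : (Fin l → ℝ) →ₗ[ℝ] ℝ) {R : ℝ} (hR : ∀ z ∈ K, |γ z.1| ≤ R)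
    {a : Fin m → ℝ} (ha : a ∈ Prod.snd '' K) : |fiberSup K γ a| ≤ R := by
  obtain ⟨x, hx, hx'⟩ := exists_eq_fiberSup hK γ ha
  rw [← hx']
  exact hR _ hx

theorem integrableOn_fiberSup (γ : (Fin l → ℝ) →ₗ[ℝ] ℝ) :
    IntegrableOn (fiberSup K γ) (Prod.snd '' K) := by
  obtain ⟨R, hR0, hR⟩ := exists_bound_fiberSup hK γ
  have hc := hK.image (f := Prod.snd) continuous_snd
  have : IsFiniteMeasure (volume.restrict (Prod.snd '' K)) := ⟨by
    rw [Measure.restrict_apply_univ]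
    exact hc.measure_lt_top⟩
  refine Integrable.of_bound (aestronglyMeasurable_fiberSup hK γ) R ?_
  filter_upwards [ae_restrict_mem hc.measurableSet] with a ha
  exact abs_fiberSup_le hK γ hR ha

open Filter Topology in
/-- The integral of the fiberwise support function is continuous along outer approximations. -/
theorem tendsto_integral_fiberSup (γ : (Fin l → ℝ) →ₗ[ℝ] ℝ)
    {L : ℕ → Set ((Fin l → ℝ) × (Fin m → ℝ))} (hL : ∀ n, IsCompact (L n)) (hKL : ∀ n, K ⊆ L n)
    {r : ℕ → ℝ} (hr : Tendsto r atTop (𝓝 0))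
    (hLK : ∀ n, ∀ z ∈ L n, ∃ z' ∈ K, dist z z' ≤ r n) :
    Tendsto (fun n => ∫ a in Prod.snd '' L n, fiberSup (L n) γ a) atTop
      (𝓝 (∫ a in Prod.snd '' K, fiberSup K γ a)) := by
  obtain ⟨R₀, hR₀⟩ := hr.bddAbove_range
  have hR₀' : ∀ n, r n ≤ R₀ := fun n => hR₀ ⟨n, rfl⟩
  have hK' : IsCompact (Metric.cthickening R₀ K) := hK.cthickening
  have hLK' : ∀ n, L n ⊆ Metric.cthickening R₀ K := fun n z hz => by
    obtain ⟨z', hz', hd⟩ := hLK n z hz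
    exact Metric.mem_cthickening_of_dist_le z z' R₀ K hz' (hd.trans (hR₀' n))
  obtain ⟨R, hR0, hR⟩ := exists_bound_fiberSup hK' γ
  have hms : ∀ n, MeasurableSet (Prod.snd '' L n) := fun n =>
    ((hL n).image continuous_snd).measurableSet
  have hcs := hK'.image (f := Prod.snd) continuous_snd
  simp_rw [← integral_indicator (hms _)]
  rw [← integral_indicator (hK.image continuous_snd).measurableSet]
  refine tendsto_integral_of_dominated_convergence
    ((Prod.snd '' Metric.cthickening R₀ K).indicator fun _ => R) ?_ ?_ ?_ ?_
  · exact fun n => (aestronglyMeasurable_indicator_iff (hms n)).mpr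
      (aestronglyMeasurable_fiberSup (hL n) γ)
  · rw [integrable_indicator_iff hcs.measurableSet]
    exact integrableOn_const hcs.measure_lt_top.ne
  · refine fun n => Eventually.of_forall fun a => ?_
    by_cases ha : a ∈ Prod.snd '' L n
    · rw [Set.indicator_of_mem ha, Set.indicator_of_mem (Set.image_mono (hLK' n) ha)]
      exact abs_fiberSup_le (hL n) γ (fun z hz => hR z (hLK' n hz)) ha
    · rw [Set.indicator_of_notMem ha, norm_zero]
      exact Set.indicator_nonneg (fun _ _ => hR0) _
  · refine Eventually.of_forall fun a => ?_
    by_cases ha : a ∈ Prod.snd '' K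
    · rw [Set.indicator_of_mem ha]
      have hmem : ∀ n, a ∈ Prod.snd '' L n := fun n => Set.image_mono (hKL n) ha
      simp_rw [fun n => Set.indicator_of_mem (hmem n) (fiberSup (L n) γ)]
      rw [Metric.tendsto_atTop]
      intro ε hε
      let Z := Metric.cthickening R₀ K ∩ {z | z.2 = a ∧ fiberSup K γ a + ε ≤ γ z.1}
      have hZ : IsCompact Z := hK'.inter_right
        ((isClosed_eq continuous_snd continuous_const).inter (isClosed_le continuous_const
          (γ.continuous_of_finiteDimensional.comp continuous_fst)))
      have hdisj : Disjoint Z K := by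
        rw [Set.disjoint_left]
        rintro ⟨x, b⟩ ⟨-, rfl, h⟩ hx
        have := le_fiberSup hK γ hx
        simp only at h
        linarith
      obtain ⟨δ, hδ, hd⟩ := hdisj.exists_thickenings hZ hK.isClosed
      obtain ⟨N, hN⟩ := eventually_atTop.mp (hr.eventually (gt_mem_nhds hδ))
      refine ⟨N, fun n hn => ?_⟩
      rw [Real.dist_eq, abs_lt]
      obtain ⟨x, hx, hx'⟩ := exists_eq_fiberSup hK γ ha
      obtain ⟨y, hy, hy'⟩ := exists_eq_fiberSup (hL n) γ (hmem n)
      have h1 := le_fiberSup (hL n) γ (hKL n hx)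
      refine ⟨by linarith, ?_⟩
      by_contra hcon
      have hyZ : (y, a) ∈ Z := ⟨hLK' n hy, rfl, by simp only; linarith⟩
      obtain ⟨z', hz', hdz⟩ := hLK n _ hy
      have hz'Z : z' ∈ Metric.thickening δ Z := by
        rw [Metric.mem_thickening_iff]
        exact ⟨_, hyZ, by rw [dist_comm]; exact hdz.trans_lt (hN n hn)⟩
      exact Set.disjoint_left.mp hd hz'Z (Metric.self_subset_thickening hδ K hz')
    · rw [Set.indicator_of_notMem ha]
      have hopen : (Prod.snd '' K)ᶜ ∈ 𝓝 a :=
        (hK.image continuous_snd).isClosed.isOpen_compl.mem_nhds ha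
      obtain ⟨δ, hδ, hball⟩ := Metric.mem_nhds_iff.mp hopen
      refine tendsto_const_nhds.congr' ?_
      filter_upwards [hr.eventually (gt_mem_nhds hδ)] with n hn
      rw [Set.indicator_of_notMem]
      rintro ⟨z, hz, rfl⟩
      obtain ⟨z', hz', hdz⟩ := hLK n z hz
      have hz'b : z'.2 ∈ Metric.ball z.2 δ := by
        rw [Metric.mem_ball, dist_comm]
        exact ((le_max_right _ _).trans hdz).trans_lt hn
      exact hball hz'b ⟨z', hz', rfl⟩

end Fibers

section Homogeneity

variable {l m : ℕ}

open scoped Pointwise in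
theorem minkowskiIntegralSupport_nsmul (hm : 0 < m)
    (Δ : ConvexBody ((Fin l → ℝ) × (Fin m → ℝ))) (γ : (Fin l → ℝ) →ₗ[ℝ] ℝ) (k : ℕ) :
    minkowskiIntegralSupport l m (k • Δ) γ
      = (k : ℝ) ^ (m + 1) * minkowskiIntegralSupport l m Δ γ := by
  have : Nonempty (Fin m) := ⟨⟨0, hm⟩⟩
  rcases Nat.eq_zero_or_pos k with rfl | hk
  · have h0 : (0 : ℕ) • Δ = 0 := zero_nsmul Δ
    rw [h0]
    unfold minkowskiIntegralSupport
    rw [setIntegral_measure_zero]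
    · simp
    · rw [ConvexBody.coe_zero, ← Set.singleton_zero, Set.image_singleton]
      exact measure_singleton _
  have hk' : (0 : ℝ) < k := Nat.cast_pos.mpr hk
  have hset : ((k • Δ : ConvexBody _) : Set ((Fin l → ℝ) × (Fin m → ℝ)))
      = (k : ℝ) • (Δ : Set ((Fin l → ℝ) × (Fin m → ℝ))) := by
    rw [← ConvexBody.coe_smul]
    congr 1
    have := Nat.cast_smul_eq_nsmul NNReal k Δ
    rw [← this]
    rfl
  have himg : Prod.snd '' ((k : ℝ) • (Δ : Set ((Fin l → ℝ) × (Fin m → ℝ))))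
      = (k : ℝ) • (Prod.snd '' (Δ : Set ((Fin l → ℝ) × (Fin m → ℝ)))) := by
    rw [← Set.image_smul, ← Set.image_smul, Set.image_image, Set.image_image]
    rfl
  have hfib : ∀ a, fiberSup ((k : ℝ) • (Δ : Set ((Fin l → ℝ) × (Fin m → ℝ)))) γ ((k : ℝ) • a)
      = k * fiberSup (Δ : Set ((Fin l → ℝ) × (Fin m → ℝ))) γ a := by
    intro a
    unfold fiberSup
    rw [← smul_eq_mul, ← Real.sSup_smul_of_nonneg hk'.le]
    congr 1
    ext y
    simp only [Set.mem_image, Set.mem_ofPred_eq, Set.mem_smul_set, Prod.exists]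
    constructor
    · rintro ⟨x, ⟨x', a', h, h'⟩, rfl⟩
      obtain ⟨h1, h2⟩ := Prod.mk.inj h'
      obtain rfl := smul_right_injective _ hk'.ne' h2
      exact ⟨γ x', ⟨x', h, rfl⟩, by rw [← h1, map_smul]⟩
    · rintro ⟨_, ⟨x, h, rfl⟩, rfl⟩
      exact ⟨(k : ℝ) • x, ⟨x, a, h, rfl⟩, map_smul _ _ _⟩
  change ∫ a in Prod.snd '' _, fiberSup _ γ a = _ * ∫ a in Prod.snd '' _, fiberSup _ γ a
  rw [hset, himg]
  have h := Measure.setIntegral_comp_smul (volume : Measure (Fin m → ℝ))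
    (fiberSup ((k : ℝ) • (Δ : Set ((Fin l → ℝ) × (Fin m → ℝ)))) γ)
    (Prod.snd '' (Δ : Set ((Fin l → ℝ) × (Fin m → ℝ)))) hk'.ne'
  simp_rw [hfib, integral_const_mul] at h
  rw [Module.finrank_fin_fun, abs_of_pos (by positivity), smul_eq_mul] at h
  rw [pow_succ, mul_assoc, h, ← mul_assoc, mul_inv_cancel₀ (by positivity), one_mul]

theorem minkowskiIntegralSupport_smul (Δ : ConvexBody ((Fin l → ℝ) × (Fin m → ℝ)))
    (γ : (Fin l → ℝ) →ₗ[ℝ] ℝ) {c : ℝ} (hc : 0 < c) :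
    minkowskiIntegralSupport l m Δ (c • γ) = c * minkowskiIntegralSupport l m Δ γ := by
  unfold minkowskiIntegralSupport
  rw [← integral_const_mul]
  refine integral_congr_ae (Filter.Eventually.of_forall fun a => ?_)
  simp only [LinearMap.smul_apply]
  rw [← smul_eq_mul c (sSup _), ← Real.sSup_smul_of_nonneg hc.le, ← Set.image_smul, Set.image_image]

end Homogeneity

section SmoothPotentials

open Matrix

variable {l m : ℕ}

/-- The linear functional on `ℝ × ℝ^m` with the given coordinates. -/
noncomputable def pair (v : Unit ⊕ Fin m → ℝ) : (ℝ × (Fin m → ℝ)) →L[ℝ] ℝ :=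
  LinearMap.toContinuousLinearMap
    { toFun := fun y => v (Sum.inl ()) * y.1 + ∑ j, v (Sum.inr j) * y.2 j
      map_add' := fun y y' => by
        simp only [Prod.fst_add, Prod.snd_add, Pi.add_apply, mul_add, Finset.sum_add_distrib]
        ring
      map_smul' := fun c y => by
        simp only [Prod.smul_fst, Prod.smul_snd, Pi.smul_apply, smul_eq_mul, RingHom.id_apply,
          mul_add, Finset.mul_sum]
        congr 1
        · ring
        · exact Finset.sum_congr rfl fun j _ => by ring }

theorem pair_apply (v : Unit ⊕ Fin m → ℝ) (y : ℝ × (Fin m → ℝ)) :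
    pair v y = v (Sum.inl ()) * y.1 + ∑ j, v (Sum.inr j) * y.2 j := rfl

theorem pair_add (v w : Unit ⊕ Fin m → ℝ) : pair (v + w) = pair v + pair w := by
  refine ContinuousLinearMap.ext fun y => ?_
  simp only [pair_apply, _root_.add_apply, Pi.add_apply, add_mul,
    Finset.sum_add_distrib]
  ring

theorem pair_sub (v w : Unit ⊕ Fin m → ℝ) : pair (v - w) = pair v - pair w := by
  rw [eq_sub_iff_add_eq, ← pair_add, sub_add_cancel]

theorem pair_smul (c : ℝ) (v : Unit ⊕ Fin m → ℝ) : pair (c • v) = c • pair v := by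
  refine ContinuousLinearMap.ext fun y => ?_
  simp only [pair_apply, _root_.smul_apply, Pi.smul_apply, smul_eq_mul, mul_add,
    Finset.mul_sum, mul_assoc]

theorem pair_sum {κ : Type*} (s : Finset κ) (v : κ → Unit ⊕ Fin m → ℝ) :
    pair (∑ k ∈ s, v k) = ∑ k ∈ s, pair (v k) := by
  classical
  induction s using Finset.induction_on with
  | empty =>
    exact ContinuousLinearMap.ext fun y => by simp [pair_apply]
  | insert k s hk ih => rw [Finset.sum_insert hk, Finset.sum_insert hk, pair_add, ih]

/-- `H` is a smooth convex function on `ℝ × ℝ^m` with gradient `G` and Hessian `N`, approximating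
up to `δ` the support function `(t, p) ↦ sup {α x + t β x + p ⬝ᵥ a | (x, a) ∈ K}` of `K`. -/
structure IsSmoothPotential (K : Set ((Fin l → ℝ) × (Fin m → ℝ))) (α β : (Fin l → ℝ) →ₗ[ℝ] ℝ)
    (δ : ℝ) (H : ℝ × (Fin m → ℝ) → ℝ) (G : ℝ × (Fin m → ℝ) → Unit ⊕ Fin m → ℝ)
    (N : ℝ × (Fin m → ℝ) → Matrix (Unit ⊕ Fin m) (Unit ⊕ Fin m) ℝ) : Prop where
  hasFDerivAt_potential : ∀ y, HasFDerivAt H (pair (G y)) y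
  hasStrictFDerivAt_gradient : ∀ y i, HasStrictFDerivAt (fun y => G y i) (pair (N y i)) y
  continuous_hessian : Continuous N
  posSemidef : ∀ y, (N y).PosSemidef
  posDef : ∀ y, ((N y).toBlocks₂₂).PosDef
  le_potential : ∀ z ∈ K, ∀ t p, α z.1 + t * β z.1 + p ⬝ᵥ z.2 ≤ H (t, p)
  exists_potential_le : ∀ t p, ∃ x, (x, fun j => G (t, p) (Sum.inr j)) ∈ K ∧
    H (t, p) - p ⬝ᵥ (fun j => G (t, p) (Sum.inr j)) - δ ≤ α x + t * β x

open scoped Pointwise in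
theorem IsSmoothPotential.add {K K' : Set ((Fin l → ℝ) × (Fin m → ℝ))}
    {α β : (Fin l → ℝ) →ₗ[ℝ] ℝ} {δ δ' : ℝ} {H H' : ℝ × (Fin m → ℝ) → ℝ}
    {G G' : ℝ × (Fin m → ℝ) → Unit ⊕ Fin m → ℝ}
    {N N' : ℝ × (Fin m → ℝ) → Matrix (Unit ⊕ Fin m) (Unit ⊕ Fin m) ℝ}
    (h : IsSmoothPotential K α β δ H G N) (h' : IsSmoothPotential K' α β δ' H' G' N') :
    IsSmoothPotential (K + K') α β (δ + δ') (H + H') (G + G') (N + N') where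
  hasFDerivAt_potential y := by
    rw [Pi.add_apply, pair_add]
    exact (h.hasFDerivAt_potential y).add (h'.hasFDerivAt_potential y)
  hasStrictFDerivAt_gradient y i := by
    have : pair ((N + N') y i) = pair (N y i) + pair (N' y i) := pair_add _ _
    rw [this]
    exact (h.hasStrictFDerivAt_gradient y i).add (h'.hasStrictFDerivAt_gradient y i)
  continuous_hessian := h.continuous_hessian.add h'.continuous_hessian
  posSemidef y := (h.posSemidef y).add (h'.posSemidef y)
  posDef y := (h.posDef y).add (h'.posDef y)
  le_potential := by
    rintro _ ⟨z, hz, z', hz', rfl⟩ t p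
    have h1 := h.le_potential z hz t p
    have h2 := h'.le_potential z' hz' t p
    simp only [Prod.fst_add, Prod.snd_add, map_add, dotProduct_add, Pi.add_apply]
    linarith
  exists_potential_le t p := by
    obtain ⟨x, hx, hx'⟩ := h.exists_potential_le t p
    obtain ⟨y, hy, hy'⟩ := h'.exists_potential_le t p
    refine ⟨x + y, Set.add_mem_add hx hy, ?_⟩
    have : p ⬝ᵥ (fun j => (G + G') (t, p) (Sum.inr j))
        = p ⬝ᵥ (fun j => G (t, p) (Sum.inr j)) + p ⬝ᵥ (fun j => G' (t, p) (Sum.inr j)) :=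
      dotProduct_add _ _ _
    rw [this]
    simp only [map_add, Pi.add_apply]
    linarith

theorem IsSmoothPotential.sum {ι : Type*} {K : ι → ConvexBody ((Fin l → ℝ) × (Fin m → ℝ))}
    {α β : (Fin l → ℝ) →ₗ[ℝ] ℝ} {δ : ι → ℝ} {H : ι → ℝ × (Fin m → ℝ) → ℝ}
    {G : ι → ℝ × (Fin m → ℝ) → Unit ⊕ Fin m → ℝ}
    {N : ι → ℝ × (Fin m → ℝ) → Matrix (Unit ⊕ Fin m) (Unit ⊕ Fin m) ℝ}
    (h : ∀ i, IsSmoothPotential (K i : Set _) α β (δ i) (H i) (G i) (N i))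
    {S : Finset ι} (hS : S.Nonempty) :
    IsSmoothPotential ((∑ i ∈ S, K i : ConvexBody _) : Set _) α β (∑ i ∈ S, δ i) (∑ i ∈ S, H i)
      (∑ i ∈ S, G i) (∑ i ∈ S, N i) := by
  induction hS using Finset.Nonempty.cons_induction with
  | singleton i => simpa using h i
  | cons i S hi hS ih =>
    rw [Finset.sum_cons, Finset.sum_cons, Finset.sum_cons, Finset.sum_cons, Finset.sum_cons,
      ConvexBody.coe_add]
    exact (h i).add ih

theorem exists_isSmoothPotential {κ : Type*} [Fintype κ] [Nonempty κ]
    (z : κ → (Fin l → ℝ) × (Fin m → ℝ)) (hz : (interior (convexHull ℝ (Set.range z))).Nonempty)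
    (α β : (Fin l → ℝ) →ₗ[ℝ] ℝ) {δ : ℝ} (hδ : 0 < δ) :
    ∃ H G N, IsSmoothPotential (convexHull ℝ (Set.range z)) α β δ H G N := by
  set ε : ℝ := δ / Fintype.card κ with hε_def
  have hκ : (0 : ℝ) < Fintype.card κ := Nat.cast_pos.mpr Fintype.card_pos
  have hε : 0 < ε := div_pos hδ hκ
  let c : κ → Unit ⊕ Fin m → ℝ := fun k => Sum.elim (fun _ => β (z k).1) (z k).2
  let f : κ → ℝ × (Fin m → ℝ) → ℝ := fun k y => ε⁻¹ * (α (z k).1 + pair (c k) y)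
  let Z : ℝ × (Fin m → ℝ) → ℝ := fun y => ∑ k, Real.exp (f k y)
  let w : κ → ℝ × (Fin m → ℝ) → ℝ := fun k y => Real.exp (f k y - Real.log (Z y))
  have hZ : ∀ y, 0 < Z y := fun y => Finset.sum_pos (fun k _ => Real.exp_pos _)
    Finset.univ_nonempty
  have hw : ∀ k y, 0 < w k y := fun k y => Real.exp_pos _
  have hwZ : ∀ k y, w k y * Z y = Real.exp (f k y) := fun k y => by
    simp only [w]
    rw [Real.exp_sub, Real.exp_log (hZ y), div_mul_cancel₀ _ (hZ y).ne']
  have hw1 : ∀ y, ∑ k, w k y = 1 := fun y => by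
    refine mul_right_cancel₀ (hZ y).ne' ?_
    rw [Finset.sum_mul, one_mul]
    exact Finset.sum_congr rfl fun k _ => hwZ k y
  let G : ℝ × (Fin m → ℝ) → Unit ⊕ Fin m → ℝ := fun y => ∑ k, w k y • c k
  let N : ℝ × (Fin m → ℝ) → Matrix (Unit ⊕ Fin m) (Unit ⊕ Fin m) ℝ := fun y =>
    ∑ k, (ε⁻¹ * w k y) • vecMulVec (c k - G y) (c k - G y)
  have hlin : ∀ k t p, ε * f k (t, p) = α (z k).1 + t * β (z k).1 + p ⬝ᵥ (z k).2 := fun k t p => by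
    simp only [f]
    rw [mul_inv_cancel_left₀ hε.ne']
    simp only [pair_apply, c, Sum.elim_inl, Sum.elim_inr, dotProduct]
    rw [mul_comm t, add_assoc]
    simp_rw [mul_comm]
  have hdf : ∀ k y, HasStrictFDerivAt (f k) (ε⁻¹ • pair (c k)) y := fun k y =>
    (((pair (c k)).hasStrictFDerivAt (x := y)).const_add (α (z k).1)).const_mul ε⁻¹
  have hdL : ∀ y, HasStrictFDerivAt (fun y => Real.log (Z y)) (ε⁻¹ • pair (G y)) y := fun y => by
    have h := (HasStrictFDerivAt.fun_sum (u := Finset.univ) fun k _ => (hdf k y).exp).log (hZ y).ne'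
    refine h.congr_fderiv ?_
    simp only [G]
    rw [pair_sum, Finset.smul_sum, Finset.smul_sum]
    refine Finset.sum_congr rfl fun k _ => ?_
    rw [pair_smul, smul_smul, smul_smul, smul_smul, ← hwZ k y]
    congr 1
    have : (∑ k, Real.exp (f k y))⁻¹ * Z y = 1 := inv_mul_cancel₀ (hZ y).ne'
    linear_combination (ε⁻¹ * w k y) * this
  have hdw : ∀ k y, HasStrictFDerivAt (w k) ((ε⁻¹ * w k y) • pair (c k - G y)) y := fun k y => by
    have h := ((hdf k y).sub (hdL y)).exp
    refine h.congr_fderiv ?_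
    rw [pair_sub, ← smul_sub, smul_smul, mul_comm]
    rfl
  have hcw : ∀ k, Continuous (w k) := fun k =>
    continuous_iff_continuousAt.mpr fun y => (hdw k y).continuousAt
  have hGc : Continuous G := continuous_finsetSum _ fun k _ => (hcw k).smul continuous_const
  have hcen : ∀ y i, ∑ k, w k y * (c k i - G y i) = 0 := fun y i => by
    simp_rw [mul_sub, Finset.sum_sub_distrib, ← Finset.sum_mul]
    rw [hw1, one_mul]
    simp [G, Finset.sum_apply]
  have hpsd : ∀ y, (N y).PosSemidef := by
    intro y
    refine posSemidef_sum _ fun k _ => PosSemidef.smul ?_ (mul_pos (inv_pos.mpr hε) (hw k y)).le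
    have := posSemidef_vecMulVec_self_star (c k - G y)
    rwa [star_trivial] at this
  refine ⟨fun y => ε * Real.log (Z y), G, N, ?_, ?_, ?_, ?_, ?_, ?_, ?_⟩
  · intro y
    have h := (hdL y).hasFDerivAt.const_mul ε
    rwa [smul_smul, mul_inv_cancel₀ hε.ne', one_smul] at h
  · intro y i
    have h := HasStrictFDerivAt.fun_sum (u := Finset.univ) fun k _ => (hdw k y).mul_const (c k i)
    have hGi : (fun y => G y i) = fun y => ∑ k, w k y * c k i := by
      funext y
      simp [G, Finset.sum_apply]
    rw [hGi]
    refine h.congr_fderiv ?_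
    · simp_rw [smul_smul, ← pair_smul, ← pair_sum]
      congr 1
      ext j
      simp only [N, Matrix.sum_apply, Finset.sum_apply, Matrix.smul_apply, vecMulVec_apply,
        Pi.sub_apply, Pi.smul_apply, smul_eq_mul]
      have h0 := hcen y j
      rw [← sub_eq_zero, ← Finset.sum_sub_distrib]
      calc _ = (ε⁻¹ * G y i) * ∑ k, w k y * (c k j - G y j) := by
            rw [Finset.mul_sum]
            exact Finset.sum_congr rfl fun k _ => by ring
        _ = 0 := by rw [h0, mul_zero]
  · refine continuous_finsetSum _ fun k _ => (continuous_const.mul (hcw k)).smul ?_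
    have : Continuous fun y => c k - G y := continuous_const.sub hGc
    exact this.matrix_vecMulVec this
  · exact hpsd
  · intro y
    have hN : (N y).PosSemidef := hpsd y
    refine posDef_iff_dotProduct_mulVec.mpr ⟨hN.isHermitian.submatrix Sum.inr, fun q hq => ?_⟩
    let a : κ → Fin m → ℝ := fun k => (z k).2
    let g : Fin m → ℝ := fun j => G y (Sum.inr j)
    have hblock : (N y).toBlocks₂₂
        = ∑ k, (ε⁻¹ * w k y) • vecMulVec (a k - g) (a k - g) := by
      ext i j
      simp [toBlocks₂₂, N, Matrix.sum_apply, vecMulVec_apply, a, g, c]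
    rw [star_trivial, hblock, sum_mulVec, dotProduct_sum]
    have hterm : ∀ k, q ⬝ᵥ ((ε⁻¹ * w k y) • vecMulVec (a k - g) (a k - g)) *ᵥ q
        = (ε⁻¹ * w k y) * (q ⬝ᵥ (a k - g)) ^ 2 := fun k => by
      rw [smul_mulVec, dotProduct_smul, vecMulVec_mulVec, smul_eq_mul]
      simp [dotProduct_comm _ q]
      exact Or.inl (by ring)
    simp_rw [hterm]
    obtain ⟨k, hk⟩ : ∃ k, q ⬝ᵥ (a k - g) ≠ 0 := by
      by_contra! hcon
      have hconv : Convex ℝ {x : (Fin l → ℝ) × (Fin m → ℝ) | q ⬝ᵥ x.2 = q ⬝ᵥ g} := by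
        intro x hx y hy r s hr hs hrs
        rw [Set.mem_ofPred_eq] at hx hy
        change q ⬝ᵥ (r • x.2 + s • y.2) = q ⬝ᵥ g
        rw [dotProduct_add, dotProduct_smul, dotProduct_smul, smul_eq_mul, smul_eq_mul, hx, hy,
          ← add_mul, hrs, one_mul]
      have hsub := convexHull_min (s := Set.range z) (by
        rintro _ ⟨k, rfl⟩
        have := hcon k
        rwa [dotProduct_sub, sub_eq_zero] at this) hconv
      obtain ⟨x, hx⟩ := hz
      have hcont : Filter.Tendsto (fun s : ℝ => x + s • ((0 : Fin l → ℝ), q)) (nhdsWithin 0 {0}ᶜ)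
          (nhds x) := by
        have : Continuous fun s : ℝ => x + s • ((0 : Fin l → ℝ), q) := by fun_prop
        have := this.tendsto 0
        rw [zero_smul, add_zero] at this
        exact this.mono_left nhdsWithin_le_nhds
      obtain ⟨s, hs, hs0⟩ := ((hcont.eventually (mem_interior_iff_mem_nhds.mp hx)).and
        self_mem_nhdsWithin).exists
      have h1 := hsub hs
      have h2 := hsub (interior_subset hx)
      simp only [Set.mem_ofPred_eq, Prod.snd_add, Prod.smul_snd, dotProduct_add,
        dotProduct_smul, smul_eq_mul] at h1 h2
      have h3 : s * (q ⬝ᵥ q) = 0 := by linarith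
      rcases mul_eq_zero.mp h3 with h3 | h3
      · exact hs0 h3
      · exact hq (dotProduct_self_eq_zero.mp h3)
    refine Finset.sum_pos' (fun k _ => ?_) ⟨k, Finset.mem_univ k, ?_⟩
    · exact mul_nonneg (mul_pos (inv_pos.mpr hε) (hw k y)).le (sq_nonneg _)
    · exact mul_pos (mul_pos (inv_pos.mpr hε) (hw k y)) (by positivity)
  · rintro x hx t p
    have hconv : Convex ℝ {x : (Fin l → ℝ) × (Fin m → ℝ) |
        (α + t • β) x.1 + p ⬝ᵥ x.2 ≤ ε * Real.log (Z (t, p))} := by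
      intro x hx y hy a b ha hb hab
      simp only [Set.mem_ofPred_eq, Prod.fst_add, Prod.snd_add, Prod.smul_fst, Prod.smul_snd,
        map_add, map_smul, dotProduct_add, dotProduct_smul, smul_eq_mul] at *
      have h : ∀ r : ℝ, a * r + b * r = r := fun r => by rw [← add_mul, hab, one_mul]
      have := h (ε * Real.log (Z (t, p)))
      linarith [mul_le_mul_of_nonneg_left hx ha, mul_le_mul_of_nonneg_left hy hb]
    have hsub := convexHull_min (s := Set.range z) (by
      rintro _ ⟨k, rfl⟩
      simp only [Set.mem_ofPred_eq, LinearMap.add_apply, LinearMap.smul_apply, smul_eq_mul]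
      rw [← hlin]
      refine mul_le_mul_of_nonneg_left ?_ hε.le
      rw [Real.le_log_iff_exp_le (hZ _)]
      exact Finset.single_le_sum (f := fun k => Real.exp (f k (t, p)))
        (fun k _ => (Real.exp_pos _).le) (Finset.mem_univ k)) hconv
    exact hsub hx
  · intro t p
    refine ⟨∑ k, w k (t, p) • (z k).1, ?_, ?_⟩
    · have : (∑ k, w k (t, p) • (z k).1, fun j => G (t, p) (Sum.inr j))
          = ∑ k, w k (t, p) • z k := by
        refine Prod.ext ?_ ?_
        · simp [Prod.fst_sum]
        · ext j
          simp [Prod.snd_sum, G, c, Finset.sum_apply]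
      rw [this]
      exact (convex_convexHull ℝ _).sum_mem (fun k _ => (hw k _).le) (hw1 _)
        fun k _ => subset_convexHull ℝ _ ⟨k, rfl⟩
    · have h1 : p ⬝ᵥ (fun j => G (t, p) (Sum.inr j)) = ∑ k, w k (t, p) * p ⬝ᵥ (z k).2 := by
        have : (fun j => G (t, p) (Sum.inr j)) = ∑ k, w k (t, p) • (z k).2 := by
          ext j
          simp [G, c, Finset.sum_apply]
        rw [this, dotProduct_sum]
        simp_rw [dotProduct_smul, smul_eq_mul]
      have h2 : ∑ k, w k (t, p) * (ε * f k (t, p)) = α (∑ k, w k (t, p) • (z k).1)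
          + t * β (∑ k, w k (t, p) • (z k).1) + p ⬝ᵥ (fun j => G (t, p) (Sum.inr j)) := by
        rw [h1]
        simp_rw [hlin, map_sum, map_smul, smul_eq_mul, Finset.mul_sum, ← Finset.sum_add_distrib]
        exact Finset.sum_congr rfl fun k _ => by ring
      have h3 : ∑ k, w k (t, p) * (Real.log (Z (t, p)) - f k (t, p)) ≤ Fintype.card κ := by
        rw [← nsmul_one, ← Finset.card_univ, ← Finset.sum_const]
        refine Finset.sum_le_sum fun k _ => ?_
        have hlog : Real.log (w k (t, p)) = f k (t, p) - Real.log (Z (t, p)) := Real.log_exp _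
        have := Real.one_sub_inv_le_log_of_pos (hw k (t, p))
        have h4 := mul_le_mul_of_nonneg_left this (hw k (t, p)).le
        rw [mul_sub, mul_inv_cancel₀ (hw k _).ne', hlog] at h4
        nlinarith [hw k (t, p)]
      have h5 : ε * ∑ k, w k (t, p) * (Real.log (Z (t, p)) - f k (t, p))
          = ε * Real.log (Z (t, p)) - ∑ k, w k (t, p) * (ε * f k (t, p)) := by
        simp_rw [mul_sub, Finset.sum_sub_distrib, ← Finset.sum_mul]
        rw [hw1, one_mul, mul_sub, Finset.mul_sum]
        congr 1
        exact Finset.sum_congr rfl fun k _ => by ring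
      have h6 : ε * Fintype.card κ = δ := div_mul_cancel₀ _ hκ.ne'
      have h7 := mul_le_mul_of_nonneg_left h3 hε.le
      linarith

end SmoothPotentials

section OuterApproximation

/-- A convex body is contained in arbitrarily close polytopes with nonempty interior. -/
theorem exists_polytope_approximation {V : Type*} [NormedAddCommGroup V] [NormedSpace ℝ V]
    [FiniteDimensional ℝ V] (Δ : ConvexBody V) {ε : ℝ} (hε : 0 < ε) :
    ∃ A : Set V, A.Finite ∧ (Δ : Set V) ⊆ convexHull ℝ A ∧ (interior (convexHull ℝ A)).Nonempty ∧
      ∀ z ∈ convexHull ℝ A, ∃ z' ∈ Δ, dist z z' ≤ ε := by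
  choose b hb hbs using fun x : V => exists_mem_interior_convexHull_affineBasis
    (Metric.ball_mem_nhds x hε)
  obtain ⟨t, htΔ, ht⟩ := Δ.isCompact.elim_nhds_subcover
    (fun x => interior (convexHull ℝ (Set.range (b x))))
    (fun x _ => isOpen_interior.mem_nhds (hb x))
  have hmono : ∀ x ∈ t, convexHull ℝ (Set.range (b x))
      ⊆ convexHull ℝ (⋃ x ∈ t, Set.range (b x)) := fun x hx =>
    convexHull_mono (Set.subset_biUnion_of_mem (u := fun x => Set.range (b x)) hx)
  refine ⟨⋃ x ∈ t, Set.range (b x), t.finite_toSet.biUnion fun x _ => Set.finite_range _,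
    fun x hx => ?_, ?_, fun z hz => ?_⟩
  · obtain ⟨y, hy, hxy⟩ := Set.mem_iUnion₂.mp (ht hx)
    exact hmono y hy (interior_subset hxy)
  · obtain ⟨x, hx⟩ := Δ.nonempty
    obtain ⟨y, hy, hxy⟩ := Set.mem_iUnion₂.mp (ht hx)
    exact ⟨x, interior_mono (hmono y hy) hxy⟩
  · have hsub : convexHull ℝ (⋃ x ∈ t, Set.range (b x)) ⊆ Metric.cthickening ε (Δ : Set V) := by
      refine convexHull_min (Set.iUnion₂_subset fun x hx => ?_) (Δ.convex.cthickening ε)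
      refine ((subset_convexHull ℝ _).trans (hbs x)).trans fun y hy => ?_
      exact Metric.mem_cthickening_of_dist_le y x ε _ (htΔ x hx) (Metric.mem_ball.mp hy).le
    have h := hsub hz
    rw [Δ.isCompact.cthickening_eq_biUnion_closedBall hε.le] at h
    obtain ⟨z', hz', hd⟩ := Set.mem_iUnion₂.mp h
    exact ⟨z', hz', hd⟩

/-- A convex body with a smooth potential containing `Δ` and close to it. -/
theorem exists_isSmoothPotential_approximation {l m : ℕ}
    (Δ : ConvexBody ((Fin l → ℝ) × (Fin m → ℝ))) (α β : (Fin l → ℝ) →ₗ[ℝ] ℝ) {ε : ℝ}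
    (hε : 0 < ε) :
    ∃ (K : ConvexBody ((Fin l → ℝ) × (Fin m → ℝ))) (H : _) (G : _) (N : _),
      (Δ : Set ((Fin l → ℝ) × (Fin m → ℝ))) ⊆ K ∧ (∀ z ∈ K, ∃ z' ∈ Δ, dist z z' ≤ ε) ∧
      IsSmoothPotential (K : Set ((Fin l → ℝ) × (Fin m → ℝ))) α β ε H G N := by
  obtain ⟨A, hA, hΔA, hintegral, hAΔ⟩ := exists_polytope_approximation Δ hε
  have hne : A.Nonempty := by
    rw [← convexHull_nonempty_iff (𝕜 := ℝ)]
    exact hintegral.mono interior_subset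
  have := hA.fintype
  have := hne.to_subtype
  have hr : Set.range (Subtype.val : A → _) = A := Subtype.range_val
  obtain ⟨H, G, N, h⟩ := exists_isSmoothPotential (Subtype.val : A → _) (by rwa [hr]) α β hε
  rw [hr] at h
  exact ⟨⟨convexHull ℝ A, convex_convexHull ℝ A, hA.isCompact_convexHull (𝕜 := ℝ),
    hintegral.mono interior_subset⟩, H, G, N, hΔA, hAΔ, h⟩

end OuterApproximation

section GradientMap

open Matrix Topology

variable {l m : ℕ}

/-- The part of the gradient in the direction of `ℝ^m`. -/
def spatialGradient (G : ℝ × (Fin m → ℝ) → Unit ⊕ Fin m → ℝ) (y : ℝ × (Fin m → ℝ)) : Fin m → ℝ :=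
  fun j => G y (Sum.inr j)

variable {K : ConvexBody ((Fin l → ℝ) × (Fin m → ℝ))} {α β : (Fin l → ℝ) →ₗ[ℝ] ℝ} {δ : ℝ}
  {H : ℝ × (Fin m → ℝ) → ℝ} {G : ℝ × (Fin m → ℝ) → Unit ⊕ Fin m → ℝ}
  {N : ℝ × (Fin m → ℝ) → Matrix (Unit ⊕ Fin m) (Unit ⊕ Fin m) ℝ}

namespace IsSmoothPotential

variable (h : IsSmoothPotential (K : Set ((Fin l → ℝ) × (Fin m → ℝ))) α β δ H G N)
include h

theorem hasStrictFDerivAt_spatialGradient (y : ℝ × (Fin m → ℝ)) :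
    HasStrictFDerivAt (spatialGradient G)
      (ContinuousLinearMap.pi fun j => pair (N y (Sum.inr j))) y :=
  hasStrictFDerivAt_pi.mpr fun j => h.hasStrictFDerivAt_gradient y (Sum.inr j)

theorem hasStrictFDerivAt_spatialGradient_slice (t : ℝ) (p : Fin m → ℝ) :
    HasStrictFDerivAt (fun p => spatialGradient G (t, p))
      (LinearMap.toContinuousLinearMap (Matrix.toLin' (N (t, p)).toBlocks₂₂)) p := by
  have h1 := (h.hasStrictFDerivAt_spatialGradient (t, p)).comp p
    ((hasStrictFDerivAt_const t p).prodMk (hasStrictFDerivAt_id p))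
  refine h1.congr_fderiv (ContinuousLinearMap.ext fun q => ?_)
  ext j
  simp [pair_apply, toBlocks₂₂, mulVec, dotProduct]

theorem det_toBlocks₂₂_pos (y : ℝ × (Fin m → ℝ)) : 0 < (N y).toBlocks₂₂.det := (h.posDef y).det_pos

theorem continuous_potential : Continuous H :=
  continuous_iff_continuousAt.mpr fun y => (h.hasFDerivAt_potential y).continuousAt

theorem injective_spatialGradient (t : ℝ) :
    Function.Injective fun p => spatialGradient G (t, p) := by
  intro p p' hpp
  by_contra hne
  have hq : p' - p ≠ 0 := sub_ne_zero.mpr (Ne.symm hne)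
  let φ : ℝ → ℝ := fun s => (p' - p) ⬝ᵥ spatialGradient G (t, p + s • (p' - p))
  have hd : ∀ s, HasDerivAt φ ((p' - p) ⬝ᵥ ((N (t, p + s • (p' - p))).toBlocks₂₂ *ᵥ (p' - p))) s := by
    intro s
    have h1 : HasDerivAt (fun s : ℝ => p + s • (p' - p)) (p' - p) s := by
      simpa using ((hasDerivAt_id s).smul_const (p' - p)).const_add p
    have h2 := (h.hasStrictFDerivAt_spatialGradient_slice t _).hasFDerivAt.comp_hasDerivAt s h1
    have h3 := hasDerivAt_pi.mp h2
    have h4 := HasDerivAt.fun_sum (u := Finset.univ) fun j _ => (h3 j).const_mul ((p' - p) j)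
    exact h4
  have hmono : StrictMono φ := strictMono_of_deriv_pos fun s => by
    rw [(hd s).deriv]
    have := (posDef_iff_dotProduct_mulVec.mp (h.posDef (t, p + s • (p' - p)))).2 hq
    rwa [star_trivial] at this
  have h01 := hmono zero_lt_one
  simp only [φ, zero_smul, add_zero, one_smul, add_sub_cancel] at h01
  simp only at hpp
  rw [hpp] at h01
  exact lt_irrefl _ h01

theorem spatialGradient_mem (y : ℝ × (Fin m → ℝ)) :
    spatialGradient G y ∈ Prod.snd '' (K : Set ((Fin l → ℝ) × (Fin m → ℝ))) := by
  obtain ⟨x, hx, -⟩ := h.exists_potential_le y.1 y.2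
  exact ⟨_, hx, rfl⟩

theorem range_spatialGradient (t : ℝ) :
    Set.range (fun p => spatialGradient G (t, p))
      = interior (Prod.snd '' (K : Set ((Fin l → ℝ) × (Fin m → ℝ)))) := by
  refine subset_antisymm (interior_maximal ?_ ?_) fun a ha => ?_
  · rintro _ ⟨p, rfl⟩
    exact h.spatialGradient_mem (t, p)
  · have hinj : ∀ p, Function.Injective (Matrix.toLin' (N (t, p)).toBlocks₂₂) := fun p => by
      rw [← LinearMap.ker_eq_bot]
      refine Matrix.ker_toLin'_eq_bot_iff.mpr fun v hv => ?_
      exact Matrix.eq_zero_of_mulVec_eq_zero (h.det_toBlocks₂₂_pos _).ne' hv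
    let e : (p : Fin m → ℝ) → ((Fin m → ℝ) ≃L[ℝ] (Fin m → ℝ)) := fun p =>
      (LinearEquiv.ofInjectiveEndo _ (hinj p)).toContinuousLinearEquiv
    have hopen := isOpenMap_of_hasStrictFDerivAt_equiv (f' := e) fun p =>
      (h.hasStrictFDerivAt_spatialGradient_slice t p).congr_fderiv (by
        refine ContinuousLinearMap.ext fun q => ?_
        rfl)
    exact hopen.isOpen_range
  · obtain ⟨ε, hε, hball⟩ := Metric.nhds_basis_closedBall.mem_iff.mp
      (mem_interior_iff_mem_nhds.mp ha)
    obtain ⟨R, hR0, hR⟩ := exists_bound_fiberSup K.isCompact (α + t • β)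
    let φ : (Fin m → ℝ) → ℝ := fun p => H (t, p) - p ⬝ᵥ a
    have hbound : ∀ p, ε * ‖p‖ - R ≤ φ p := by
      intro p
      have hmem : a + ε • (fun j => (SignType.sign (p j) : ℝ)) ∈ Metric.closedBall a ε := by
        rw [Metric.mem_closedBall, dist_eq_norm, add_sub_cancel_left, norm_smul,
          Real.norm_of_nonneg hε.le]
        refine mul_le_of_le_one_right hε.le ((pi_norm_le_iff_of_nonneg zero_le_one).mpr fun j => ?_)
        rcases lt_trichotomy (p j) 0 with hj | hj | hj <;> simp [hj]
      obtain ⟨⟨x, b⟩, hx, hb⟩ := hball hmem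
      simp only at hb
      subst hb
      have h1 := h.le_potential _ hx t p
      have h2 := (abs_le.mp (hR _ hx)).1
      have h3 : ‖p‖ ≤ p ⬝ᵥ (fun j => (SignType.sign (p j) : ℝ)) := by
        have h4 : ∀ j, p j * (SignType.sign (p j) : ℝ) = |p j| := fun j => by
          rw [mul_comm]
          exact sign_mul_self _
        simp only [dotProduct, h4]
        refine (pi_norm_le_iff_of_nonneg (Finset.sum_nonneg fun j _ => abs_nonneg _)).mpr fun j => ?_
        exact Finset.single_le_sum (f := fun j => |p j|) (fun j _ => abs_nonneg _)
          (Finset.mem_univ j)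
      simp only [dotProduct_add, dotProduct_smul, smul_eq_mul, LinearMap.add_apply,
        LinearMap.smul_apply] at h1 h2
      have h5 := mul_le_mul_of_nonneg_left h3 hε.le
      simp only [φ]
      linarith
    have hcont : Continuous φ :=
      (h.continuous_potential.comp (by fun_prop)).sub (by simp only [dotProduct]; fun_prop)
    have htend : Filter.Tendsto φ (Filter.cocompact _) Filter.atTop := by
      refine Filter.tendsto_atTop_mono hbound ?_
      exact Filter.tendsto_atTop_add_const_right _ _
        (tendsto_norm_cocompact_atTop.const_mul_atTop hε)
    obtain ⟨p, hp⟩ := hcont.exists_forall_le htend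
    have hmin : IsLocalMin φ p := Filter.Eventually.of_forall hp
    refine ⟨p, ?_⟩
    have hd : ∀ j, HasDerivAt (fun s : ℝ => φ (p + s • Pi.single j 1))
        (spatialGradient G (t, p) j - a j) 0 := by
      intro j
      have h1 : HasDerivAt (fun s : ℝ => p + s • Pi.single j (1 : ℝ)) (Pi.single j 1) 0 := by
        simpa using ((hasDerivAt_id (0 : ℝ)).smul_const (Pi.single j (1 : ℝ))).const_add p
      have h1' : HasDerivAt (fun s : ℝ => (t, p + s • Pi.single j (1 : ℝ))) (0, Pi.single j 1) 0 :=
        (hasDerivAt_const _ _).prodMk h1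
      have h2 : HasFDerivAt H (pair (G (t, p))) (t, p + (0 : ℝ) • Pi.single j (1 : ℝ)) := by
        rw [zero_smul, add_zero]
        exact h.hasFDerivAt_potential _
      have h3 := h2.comp_hasDerivAt (0 : ℝ) h1'
      have h4 := HasDerivAt.fun_sum (u := Finset.univ) fun i _ =>
        (hasDerivAt_pi.mp h1 i).mul_const (a i)
      have h5 := h3.sub h4
      have h6 : spatialGradient G (t, p) j - a j = pair (G (t, p)) (0, Pi.single j 1)
          - ∑ i, (Pi.single j (1 : ℝ) : Fin m → ℝ) i * a i := by
        simp [pair_apply, Pi.single_apply, spatialGradient]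
      rw [h6]
      exact h5
    ext j
    have hmin' : IsLocalMin (fun s : ℝ => φ (p + s • Pi.single j 1)) 0 :=
      Filter.Eventually.of_forall fun s => by simpa using hp _
    have := hmin'.hasDerivAt_eq_zero (hd j)
    exact sub_eq_zero.mp this

end IsSmoothPotential

end GradientMap

section LegendreTransform

open Matrix Topology

/-- Second-order Taylor formula with integral remainder for the symmetric second difference. -/
theorem symm_second_difference_eq_integral {u v w : ℝ → ℝ} (hu : ∀ t, HasDerivAt u (v t) t)
    (hv : ∀ t, HasDerivAt v (w t) t) (hw : Continuous w) :
    ∫ r in (-1 : ℝ)..1, (1 - |r|) * w r = u 1 + u (-1) - 2 * u 0 := by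
  have hc : Continuous fun r => (1 - |r|) * w r := by fun_prop
  rw [← intervalIntegral.integral_add_adjacent_intervals (hc.intervalIntegrable (-1) 0)
    (hc.intervalIntegrable 0 1)]
  have h1 : ∫ r in (-1 : ℝ)..0, (1 - |r|) * w r = ((1 + 0) * v 0 - u 0) - ((1 + -1) * v (-1) - u (-1)) := by
    rw [← intervalIntegral.integral_eq_sub_of_hasDerivAt (f := fun r => (1 + r) * v r - u r)
      (f' := fun r => (1 + r) * w r) ?_ (Continuous.intervalIntegrable (by fun_prop) _ _)]
    · refine intervalIntegral.integral_congr fun r hr => ?_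
      rw [Set.uIcc_of_le (by norm_num)] at hr
      simp only [abs_of_nonpos hr.2]
      ring
    · intro r _
      have := (((hasDerivAt_id r).const_add 1).mul (hv r)).sub (hu r)
      refine this.congr_deriv ?_
      simp only [id_eq]
      ring
  have h2 : ∫ r in (0 : ℝ)..1, (1 - |r|) * w r = ((1 - 1) * v 1 + u 1) - ((1 - 0) * v 0 + u 0) := by
    rw [← intervalIntegral.integral_eq_sub_of_hasDerivAt (f := fun r => (1 - r) * v r + u r)
      (f' := fun r => (1 - r) * w r) ?_ (Continuous.intervalIntegrable (by fun_prop) _ _)]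
    · refine intervalIntegral.integral_congr fun r hr => ?_
      rw [Set.uIcc_of_le (by norm_num)] at hr
      simp only [abs_of_nonneg hr.1]
    · intro r _
      have := (((hasDerivAt_id r).const_sub 1).mul (hv r)).add (hu r)
      refine this.congr_deriv ?_
      simp only [id_eq]
      ring
  rw [h1, h2]
  ring

theorem mul_det_toBlocks₂₂ {m : ℕ} (N : Matrix (Unit ⊕ Fin m) (Unit ⊕ Fin m) ℝ)
    (hN : N.toBlocks₂₂.det ≠ 0) (q : Fin m → ℝ) (hq : ∀ j, pair (N (Sum.inr j)) (1, q) = 0) :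
    pair (N (Sum.inl ())) (1, q) * N.toBlocks₂₂.det = N.det := by
  have := N.toBlocks₂₂.invertibleOfIsUnitDet (isUnit_iff_ne_zero.mpr hN)
  conv_rhs => rw [← fromBlocks_toBlocks N]
  rw [det_fromBlocks₂₂, det_unique (n := Unit), mul_comm]
  congr 1
  have h1 : N.toBlocks₂₁ = -(N.toBlocks₂₂ * Matrix.of fun j (_ : Unit) => q j) := by
    ext j k
    have := hq j
    simp only [pair_apply, mul_one] at this
    simp only [toBlocks₂₁, toBlocks₂₂, Matrix.neg_apply, Matrix.mul_apply, Matrix.of_apply]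
    linarith
  rw [h1, Matrix.mul_neg, Matrix.mul_assoc, Matrix.invOf_mul_cancel_left]
  simp [pair_apply, toBlocks₁₁, toBlocks₁₂, Matrix.mul_apply]

variable {l m : ℕ} {K : ConvexBody ((Fin l → ℝ) × (Fin m → ℝ))} {α β : (Fin l → ℝ) →ₗ[ℝ] ℝ}
  {δ : ℝ} {H : ℝ × (Fin m → ℝ) → ℝ} {G : ℝ × (Fin m → ℝ) → Unit ⊕ Fin m → ℝ}
  {N : ℝ × (Fin m → ℝ) → Matrix (Unit ⊕ Fin m) (Unit ⊕ Fin m) ℝ}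

namespace IsSmoothPotential

variable (h : IsSmoothPotential (K : Set ((Fin l → ℝ) × (Fin m → ℝ))) α β δ H G N)
include h

/-- The partial inverse of the gradient map in the variables of `ℝ^m`. -/
theorem exists_inverse_gradient :
    ∃ Ψ : ℝ × (Fin m → ℝ) → ℝ × (Fin m → ℝ),
      ContinuousOn Ψ (Set.univ ×ˢ interior (Prod.snd '' (K : Set ((Fin l → ℝ) × (Fin m → ℝ))))) ∧
      (∀ t p, Ψ (t, spatialGradient G (t, p)) = (t, p)) ∧
      ∀ t, ∀ a ∈ interior (Prod.snd '' (K : Set ((Fin l → ℝ) × (Fin m → ℝ)))),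
        ∃ q, HasDerivAt (fun t => Ψ (t, a)) (1, q) t ∧
          ∀ j, pair (N (Ψ (t, a)) (Sum.inr j)) (1, q) = 0 := by
  let Θ : ℝ × (Fin m → ℝ) → ℝ × (Fin m → ℝ) := fun y => (y.1, spatialGradient G y)
  let Θ' : ℝ × (Fin m → ℝ) → (ℝ × (Fin m → ℝ)) →L[ℝ] (ℝ × (Fin m → ℝ)) := fun y =>
    (ContinuousLinearMap.fst ℝ ℝ (Fin m → ℝ)).prod
      (ContinuousLinearMap.pi fun j => pair (N y (Sum.inr j)))
  have hΘ : ∀ y, HasStrictFDerivAt Θ (Θ' y) y := fun y =>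
    hasStrictFDerivAt_fst.prodMk (h.hasStrictFDerivAt_spatialGradient y)
  have hinj' : ∀ y, Function.Injective (Θ' y : (ℝ × (Fin m → ℝ)) →ₗ[ℝ] (ℝ × (Fin m → ℝ))) := by
    intro y
    rw [← LinearMap.ker_eq_bot, LinearMap.ker_eq_bot']
    rintro ⟨s, q⟩ hsq
    obtain ⟨hs, hq⟩ := Prod.mk.inj hsq
    obtain rfl : s = 0 := hs
    have : (N y).toBlocks₂₂ *ᵥ q = 0 := by
      ext j
      have := congrFun hq j
      simpa [pair_apply, toBlocks₂₂, mulVec, dotProduct] using this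
    rw [Matrix.eq_zero_of_mulVec_eq_zero (h.det_toBlocks₂₂_pos y).ne' this]
    rfl
  let e : (y : ℝ × (Fin m → ℝ)) → ((ℝ × (Fin m → ℝ)) ≃L[ℝ] (ℝ × (Fin m → ℝ))) := fun y =>
    (LinearEquiv.ofInjectiveEndo _ (hinj' y)).toContinuousLinearEquiv
  have he : ∀ y, HasStrictFDerivAt Θ (e y : (ℝ × (Fin m → ℝ)) →L[ℝ] (ℝ × (Fin m → ℝ))) y :=
    fun y => (hΘ y).congr_fderiv (ContinuousLinearMap.ext fun q => rfl)
  have hopen : IsOpenMap Θ := isOpenMap_of_hasStrictFDerivAt_equiv he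
  have hcont : Continuous Θ := continuous_iff_continuousAt.mpr fun y => (hΘ y).continuousAt
  have hinj : Function.Injective Θ := by
    rintro ⟨t, p⟩ ⟨t', p'⟩ hy
    obtain ⟨ht, hp⟩ := Prod.mk.inj hy
    obtain rfl : t = t' := ht
    rw [h.injective_spatialGradient t hp]
  have hemb : IsOpenEmbedding Θ := .of_continuous_injective_isOpenMap hcont hinj hopen
  have hrange : ∀ t, ∀ a ∈ interior (Prod.snd '' (K : Set ((Fin l → ℝ) × (Fin m → ℝ)))),
      (t, a) ∈ Set.range Θ := by
    intro t a ha
    rw [← h.range_spatialGradient t] at ha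
    obtain ⟨p, rfl⟩ := ha
    exact ⟨(t, p), rfl⟩
  let E := hemb.toOpenPartialHomeomorph Θ
  have htarget : E.target = Set.range Θ := by simp [E]
  refine ⟨E.symm, ?_, fun t p => hemb.toOpenPartialHomeomorph_left_inv Θ (x := (t, p)),
    fun t a ha => ?_⟩
  · refine E.continuousOn_symm.mono ?_
    rintro ⟨t, a⟩ ⟨-, ha⟩
    rw [htarget]
    exact hrange t a ha
  · have hmem : (t, a) ∈ E.target := by
      rw [htarget]
      exact hrange t a ha
    have hd := E.hasFDerivAt_symm hmem (he (E.symm (t, a))).hasFDerivAt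
    have hline : HasDerivAt (fun t : ℝ => (t, a)) (1, 0) t :=
      (hasDerivAt_id t).prodMk (hasDerivAt_const t a)
    have hd' := hd.comp_hasDerivAt t hline
    have happ : Θ' (E.symm (t, a)) ((e (E.symm (t, a))).symm (1, 0)) = (1, 0) :=
      (e (E.symm (t, a))).apply_symm_apply (1, 0)
    obtain ⟨h1, h2⟩ := Prod.mk.inj happ
    have h3 : (e (E.symm (t, a))).symm (1, 0)
        = (1, ((e (E.symm (t, a))).symm (1, 0)).2) := Prod.ext h1 rfl
    refine ⟨((e (E.symm (t, a))).symm (1, 0)).2, ?_, fun j => ?_⟩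
    · rw [← h3]
      exact hd'
    · rw [← h3]
      exact congrFun h2 j

/-- The Legendre transform `U` of the potential in the variables of `ℝ^m`, together with its second
derivative `W` in the remaining variable. -/
theorem exists_legendre :
    ∃ U W : ℝ × (Fin m → ℝ) → ℝ,
      ContinuousOn U (Set.univ ×ˢ interior (Prod.snd '' (K : Set ((Fin l → ℝ) × (Fin m → ℝ))))) ∧
      ContinuousOn W (Set.univ ×ˢ interior (Prod.snd '' (K : Set ((Fin l → ℝ) × (Fin m → ℝ))))) ∧
      (∀ t p, U (t, spatialGradient G (t, p)) = H (t, p) - p ⬝ᵥ spatialGradient G (t, p)) ∧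
      (∀ t p, (N (t, p)).toBlocks₂₂.det * W (t, spatialGradient G (t, p)) = (N (t, p)).det) ∧
      (∀ y, 0 ≤ W y) ∧
      ∀ a ∈ interior (Prod.snd '' (K : Set ((Fin l → ℝ) × (Fin m → ℝ)))), ∃ V : ℝ → ℝ, ∀ t,
        HasDerivAt (fun t => U (t, a)) (V t) t ∧ HasDerivAt V (W (t, a)) t := by
  obtain ⟨Ψ, hΨ, hinv, hder⟩ := h.exists_inverse_gradient
  have hdetc : Continuous fun y => (N y).toBlocks₂₂.det := by
    refine Continuous.matrix_det ?_
    exact continuous_matrix fun i j => h.continuous_hessian.matrix_elem _ _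
  have hright : ∀ t, ∀ a ∈ interior (Prod.snd '' (K : Set ((Fin l → ℝ) × (Fin m → ℝ)))),
      spatialGradient G (Ψ (t, a)) = a := by
    intro t a ha
    rw [← h.range_spatialGradient t] at ha
    obtain ⟨p, rfl⟩ := ha
    simp only [hinv]
  have hW : Continuous fun y => (N y).det / (N y).toBlocks₂₂.det :=
    h.continuous_hessian.matrix_det.div hdetc fun y => (h.det_toBlocks₂₂_pos y).ne'
  refine ⟨fun y => H (Ψ y) - (Ψ y).2 ⬝ᵥ y.2, fun y => (N (Ψ y)).det / (N (Ψ y)).toBlocks₂₂.det,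
    ?_, hW.comp_continuousOn hΨ, fun t p => by simp only [hinv], fun t p => ?_, fun y => ?_,
    fun a ha => ⟨fun t => G (Ψ (t, a)) (Sum.inl ()), fun t => ⟨?_, ?_⟩⟩⟩
  · have h1 := continuous_snd.comp_continuousOn hΨ
    refine (h.continuous_potential.comp_continuousOn hΨ).sub ?_
    simp only [dotProduct]
    exact continuousOn_finsetSum _ fun j _ =>
      ((continuous_apply j).comp_continuousOn h1).mul (by fun_prop)
  · simp only [hinv]
    exact mul_div_cancel₀ _ (h.det_toBlocks₂₂_pos _).ne'
  · exact div_nonneg (h.posSemidef _).det_nonneg (h.det_toBlocks₂₂_pos _).le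
  · obtain ⟨q, hq, -⟩ := hder t a ha
    have h1 := (h.hasFDerivAt_potential (Ψ (t, a))).comp_hasDerivAt t hq
    have h2 := HasDerivAt.fun_sum (u := Finset.univ) fun j _ =>
      (hasDerivAt_pi.mp hq.snd j).mul_const (a j)
    have h3 : G (Ψ (t, a)) (Sum.inl ()) = pair (G (Ψ (t, a))) (1, q) - ∑ j, q j * a j := by
      have : ∀ j, a j = G (Ψ (t, a)) (Sum.inr j) := fun j => (congrFun (hright t a ha) j).symm
      simp only [pair_apply, mul_one, this, mul_comm (q _)]
      ring
    exact (h1.sub h2).congr_deriv h3.symm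
  · obtain ⟨q, hq, hq'⟩ := hder t a ha
    have h1 := (h.hasStrictFDerivAt_gradient (Ψ (t, a)) (Sum.inl ())).hasFDerivAt.comp_hasDerivAt
      t hq
    have h2 := mul_det_toBlocks₂₂ (N (Ψ (t, a))) (h.det_toBlocks₂₂_pos _).ne' q hq'
    simp only
    rw [← h2, mul_div_cancel_right₀ _ (h.det_toBlocks₂₂_pos _).ne']
    exact h1

end IsSmoothPotential

end LegendreTransform

section ChangeOfVariables

open Matrix Topology

variable {l m : ℕ} {K : ConvexBody ((Fin l → ℝ) × (Fin m → ℝ))} {α β : (Fin l → ℝ) →ₗ[ℝ] ℝ}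
  {δ : ℝ} {H : ℝ × (Fin m → ℝ) → ℝ} {G : ℝ × (Fin m → ℝ) → Unit ⊕ Fin m → ℝ}
  {N : ℝ × (Fin m → ℝ) → Matrix (Unit ⊕ Fin m) (Unit ⊕ Fin m) ℝ}

theorem isCompact_image_snd (K : ConvexBody ((Fin l → ℝ) × (Fin m → ℝ))) :
    IsCompact (Prod.snd '' (K : Set ((Fin l → ℝ) × (Fin m → ℝ)))) :=
  K.isCompact.image continuous_snd

theorem interior_image_snd_ae_eq (K : ConvexBody ((Fin l → ℝ) × (Fin m → ℝ))) :
    interior (Prod.snd '' (K : Set ((Fin l → ℝ) × (Fin m → ℝ))))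
      =ᵐ[volume] Prod.snd '' (K : Set ((Fin l → ℝ) × (Fin m → ℝ))) :=
  interior_ae_eq_of_null_frontier
    ((K.convex.linear_image (LinearMap.snd ℝ (Fin l → ℝ) (Fin m → ℝ))).addHaar_frontier volume)

theorem volume_interior_image_snd_lt_top (K : ConvexBody ((Fin l → ℝ) × (Fin m → ℝ))) :
    volume (interior (Prod.snd '' (K : Set ((Fin l → ℝ) × (Fin m → ℝ))))) < ⊤ :=
  (measure_mono interior_subset).trans_lt (isCompact_image_snd K).measure_lt_top

namespace IsSmoothPotential

variable (h : IsSmoothPotential (K : Set ((Fin l → ℝ) × (Fin m → ℝ))) α β δ H G N)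
include h

theorem integral_gradient_eq (t : ℝ) (f : (Fin m → ℝ) → ℝ) :
    ∫ p, (N (t, p)).toBlocks₂₂.det * f (spatialGradient G (t, p))
      = ∫ a in interior (Prod.snd '' (K : Set ((Fin l → ℝ) × (Fin m → ℝ)))), f a := by
  rw [← h.range_spatialGradient t, ← Set.image_univ,
    integral_image_eq_integral_abs_det_fderiv_smul volume MeasurableSet.univ
      (fun p _ => (h.hasStrictFDerivAt_spatialGradient_slice t p).hasFDerivAt.hasFDerivWithinAt)
      (h.injective_spatialGradient t).injOn, setIntegral_univ]
  refine integral_congr_ae (Filter.Eventually.of_forall fun p => ?_)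
  simp only [LinearMap.det_toContinuousLinearMap, LinearMap.det_toLin', smul_eq_mul]
  rw [abs_of_pos (h.det_toBlocks₂₂_pos _)]

theorem integrable_gradient_iff (t : ℝ) (f : (Fin m → ℝ) → ℝ) :
    Integrable (fun p => (N (t, p)).toBlocks₂₂.det * f (spatialGradient G (t, p))) ↔
      IntegrableOn f (interior (Prod.snd '' (K : Set ((Fin l → ℝ) × (Fin m → ℝ))))) := by
  rw [← h.range_spatialGradient t, ← Set.image_univ,
    integrableOn_image_iff_integrableOn_abs_det_fderiv_smul volume MeasurableSet.univ
      (fun p _ => (h.hasStrictFDerivAt_spatialGradient_slice t p).hasFDerivAt.hasFDerivWithinAt)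
      (h.injective_spatialGradient t).injOn, integrableOn_univ]
  refine integrable_congr (Filter.Eventually.of_forall fun p => ?_)
  simp only [LinearMap.det_toContinuousLinearMap, LinearMap.det_toLin', smul_eq_mul]
  rw [abs_of_pos (h.det_toBlocks₂₂_pos _)]

/-- The Legendre transform of the potential approximates the support function of the fibers. -/
theorem abs_legendre_sub_fiberSup_le {u : (Fin m → ℝ) → ℝ} {t : ℝ}
    (hu : ∀ p, u (spatialGradient G (t, p)) = H (t, p) - p ⬝ᵥ spatialGradient G (t, p))
    {a : Fin m → ℝ} (ha : a ∈ interior (Prod.snd '' (K : Set ((Fin l → ℝ) × (Fin m → ℝ))))) :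
    |u a - fiberSup (K : Set ((Fin l → ℝ) × (Fin m → ℝ))) (α + t • β) a| ≤ δ := by
  have haK := interior_subset ha
  rw [← h.range_spatialGradient t] at ha
  obtain ⟨p, rfl⟩ := ha
  simp only at haK ⊢
  rw [hu]
  obtain ⟨x, hx, hx'⟩ := exists_eq_fiberSup K.isCompact (α + t • β) haK
  obtain ⟨y, hy, hy'⟩ := h.exists_potential_le t p
  have h1 := h.le_potential _ hx t p
  have h2 := le_fiberSup K.isCompact (α + t • β) hy
  simp only [LinearMap.add_apply, LinearMap.smul_apply, smul_eq_mul] at hx' h2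
  change H (t, p) - p ⬝ᵥ spatialGradient G (t, p) - δ ≤ _ at hy'
  change _ ≤ fiberSup _ _ (spatialGradient G (t, p)) at h2
  rw [abs_le]
  constructor <;> simp only at h1 <;> linarith

theorem integrableOn_legendre {u : (Fin m → ℝ) → ℝ} {t : ℝ}
    (hu : ∀ p, u (spatialGradient G (t, p)) = H (t, p) - p ⬝ᵥ spatialGradient G (t, p))
    (huc : ContinuousOn u (interior (Prod.snd '' (K : Set ((Fin l → ℝ) × (Fin m → ℝ)))))) :
    IntegrableOn u (interior (Prod.snd '' (K : Set ((Fin l → ℝ) × (Fin m → ℝ))))) := by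
  obtain ⟨R, -, hR⟩ := exists_bound_fiberSup K.isCompact (α + t • β)
  refine IntegrableOn.of_bound (volume_interior_image_snd_lt_top K)
    (huc.aestronglyMeasurable isOpen_interior.measurableSet) (δ + R) ?_
  refine (ae_restrict_iff' isOpen_interior.measurableSet).mpr
    (Filter.Eventually.of_forall fun a ha => ?_)
  have h1 := h.abs_legendre_sub_fiberSup_le hu ha
  have h2 := abs_fiberSup_le K.isCompact (α + t • β) hR (interior_subset ha)
  rw [Real.norm_eq_abs]
  rw [abs_le] at h1 h2 ⊢
  constructor <;> linarith

theorem abs_minkowskiIntegralSupport_sub_le {u : (Fin m → ℝ) → ℝ} {t : ℝ}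
    (hu : ∀ p, u (spatialGradient G (t, p)) = H (t, p) - p ⬝ᵥ spatialGradient G (t, p))
    (huc : ContinuousOn u (interior (Prod.snd '' (K : Set ((Fin l → ℝ) × (Fin m → ℝ)))))) :
    |minkowskiIntegralSupport l m K (α + t • β)
      - ∫ a in interior (Prod.snd '' (K : Set ((Fin l → ℝ) × (Fin m → ℝ)))), u a|
      ≤ δ * volume.real (Prod.snd '' (K : Set ((Fin l → ℝ) × (Fin m → ℝ)))) := by
  have h1 : minkowskiIntegralSupport l m K (α + t • β)
      = ∫ a in interior (Prod.snd '' (K : Set ((Fin l → ℝ) × (Fin m → ℝ)))),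
        fiberSup (K : Set ((Fin l → ℝ) × (Fin m → ℝ))) (α + t • β) a :=
    (setIntegral_congr_set (interior_image_snd_ae_eq K)).symm
  rw [h1, ← integral_sub ((integrableOn_fiberSup K.isCompact _).mono_set interior_subset)
    (h.integrableOn_legendre hu huc), ← Real.norm_eq_abs,
    ← measureReal_congr (interior_image_snd_ae_eq K)]
  refine norm_setIntegral_le_of_norm_le_const (volume_interior_image_snd_lt_top K) fun a ha => ?_
  rw [Real.norm_eq_abs, abs_sub_comm]
  exact h.abs_legendre_sub_fiberSup_le hu ha

theorem integrable_potential (t : ℝ) :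
    Integrable fun p => (H (t, p) - p ⬝ᵥ spatialGradient G (t, p)) * (N (t, p)).toBlocks₂₂.det := by
  obtain ⟨U, W, hU, -, hUG, -⟩ := h.exists_legendre
  have hUt : ContinuousOn (fun a => U (t, a))
      (interior (Prod.snd '' (K : Set ((Fin l → ℝ) × (Fin m → ℝ))))) :=
    hU.comp (by fun_prop) fun a ha => ⟨Set.mem_univ _, ha⟩
  have := (h.integrable_gradient_iff t _).mpr (h.integrableOn_legendre (hUG t) hUt)
  simpa only [hUG, mul_comm] using this

theorem abs_minkowskiIntegralSupport_sub_integral_potential_le (t : ℝ) :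
    |minkowskiIntegralSupport l m K (α + t • β)
      - ∫ p, (H (t, p) - p ⬝ᵥ spatialGradient G (t, p)) * (N (t, p)).toBlocks₂₂.det|
      ≤ δ * volume.real (Prod.snd '' (K : Set ((Fin l → ℝ) × (Fin m → ℝ)))) := by
  obtain ⟨U, W, hU, -, hUG, -⟩ := h.exists_legendre
  have hUt : ContinuousOn (fun a => U (t, a))
      (interior (Prod.snd '' (K : Set ((Fin l → ℝ) × (Fin m → ℝ))))) :=
    hU.comp (by fun_prop) fun a ha => ⟨Set.mem_univ _, ha⟩
  have := h.abs_minkowskiIntegralSupport_sub_le (hUG t) hUt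
  rw [← h.integral_gradient_eq t] at this
  simpa only [hUG, mul_comm] using this

/-- The second difference of the Minkowski integral is approximated by an integral of Hessian
determinants. -/
theorem second_difference_minkowskiIntegralSupport :
    (∀ᵐ r ∂(volume.restrict (Set.Ioc (-1 : ℝ) 1)),
      Integrable fun p => (1 - |r|) * (N (r, p)).det) ∧
    IntegrableOn (fun r => ∫ p, (1 - |r|) * (N (r, p)).det) (Set.Ioc (-1 : ℝ) 1) ∧
    |minkowskiIntegralSupport l m K (α + (1 : ℝ) • β)
      + minkowskiIntegralSupport l m K (α + (-1 : ℝ) • β)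
      - 2 * minkowskiIntegralSupport l m K (α + (0 : ℝ) • β)
      - ∫ r in Set.Ioc (-1 : ℝ) 1, ∫ p, (1 - |r|) * (N (r, p)).det|
      ≤ 4 * (δ * volume.real (Prod.snd '' (K : Set ((Fin l → ℝ) × (Fin m → ℝ))))) := by
  obtain ⟨U, W, hU, hW, hUG, hWG, hW0, hder⟩ := h.exists_legendre
  set O := interior (Prod.snd '' (K : Set ((Fin l → ℝ) × (Fin m → ℝ)))) with hO
  have hOm : MeasurableSet O := isOpen_interior.measurableSet
  have hUt : ∀ t, ContinuousOn (fun a => U (t, a)) O := fun t =>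
    hU.comp (by fun_prop) fun a ha => ⟨Set.mem_univ _, ha⟩
  have hUi : ∀ t, IntegrableOn (fun a => U (t, a)) O := fun t =>
    h.integrableOn_legendre (hUG t) (hUt t)
  let f : ℝ × (Fin m → ℝ) → ℝ := fun y => (1 - |y.1|) * W y
  have hf : AEStronglyMeasurable f ((volume.restrict (Set.Ioc (-1 : ℝ) 1)).prod
      (volume.restrict O)) := by
    rw [Measure.prod_restrict]
    refine ContinuousOn.aestronglyMeasurable ?_ (measurableSet_Ioc.prod hOm)
    exact ContinuousOn.mul (by fun_prop) (hW.mono (Set.prod_mono_left (Set.subset_univ _)))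
  have hWa : ∀ a ∈ O, Continuous fun r => W (r, a) := fun a ha =>
    hW.comp_continuous (by fun_prop) fun r => ⟨Set.mem_univ _, ha⟩
  have hintegral : ∀ a ∈ O, ∫ r in Set.Ioc (-1 : ℝ) 1, f (r, a) = U (1, a) + U (-1, a) - 2 * U (0, a) := by
    intro a ha
    obtain ⟨V, hV⟩ := hder a ha
    rw [← intervalIntegral.integral_of_le (by norm_num)]
    exact symm_second_difference_eq_integral (fun t => (hV t).1) (fun t => (hV t).2) (hWa a ha)
  have hsum : IntegrableOn (fun a => U (1, a) + U (-1, a) - 2 * U (0, a)) O :=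
    ((hUi 1).add (hUi (-1))).sub ((hUi 0).const_mul 2)
  have hfi : Integrable f ((volume.restrict (Set.Ioc (-1 : ℝ) 1)).prod (volume.restrict O)) := by
    rw [integrable_prod_iff' hf]
    constructor
    · refine (ae_restrict_iff' hOm).mpr (Filter.Eventually.of_forall fun a ha => ?_)
      have hc : Continuous fun r => (1 - |r|) * W (r, a) :=
        Continuous.mul (by fun_prop) (hWa a ha)
      exact hc.integrableOn_Icc.mono_set Set.Ioc_subset_Icc_self
    · refine hsum.congr ((ae_restrict_iff' hOm).mpr (Filter.Eventually.of_forall fun a ha => ?_))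
      refine (hintegral a ha).symm.trans ?_
      refine setIntegral_congr_fun measurableSet_Ioc fun r hr => ?_
      exact (Real.norm_of_nonneg (mul_nonneg (sub_nonneg.mpr (abs_le.mpr ⟨hr.1.le, hr.2⟩))
        (hW0 _))).symm
  have hchange : ∀ r, ∫ a in O, f (r, a) = ∫ p, (1 - |r|) * (N (r, p)).det := by
    intro r
    rw [← h.integral_gradient_eq r]
    refine integral_congr_ae (Filter.Eventually.of_forall fun p => ?_)
    simp only [f]
    rw [← hWG]
    ring
  refine ⟨?_, ?_, ?_⟩
  · filter_upwards [hfi.prod_right_ae] with r hr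
    refine ((h.integrable_gradient_iff r _).mpr hr).congr (Filter.Eventually.of_forall fun p => ?_)
    simp only [f]
    rw [← hWG]
    ring
  · simpa only [IntegrableOn, hchange] using hfi.integral_prod_left
  · have hswap : ∫ r in Set.Ioc (-1 : ℝ) 1, ∫ p, (1 - |r|) * (N (r, p)).det
        = (∫ a in O, U (1, a)) + (∫ a in O, U (-1, a)) - 2 * ∫ a in O, U (0, a) := by
      simp only [← hchange]
      rw [integral_integral_swap (f := fun r a => f (r, a)) hfi, setIntegral_congr_fun hOm hintegral,
        integral_sub, integral_add (hUi 1) (hUi (-1)), integral_const_mul]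
      · exact (hUi 1).add (hUi (-1))
      · exact (hUi 0).const_mul 2
    rw [hswap]
    have h1 := h.abs_minkowskiIntegralSupport_sub_le (hUG 1) (hUt 1)
    have h2 := h.abs_minkowskiIntegralSupport_sub_le (hUG (-1)) (hUt (-1))
    have h3 := h.abs_minkowskiIntegralSupport_sub_le (hUG 0) (hUt 0)
    rw [abs_le] at h1 h2 h3 ⊢
    constructor <;> linarith

end IsSmoothPotential

end ChangeOfVariables

section PolarizationEstimates

open Matrix Topology Filter

variable {l m : ℕ} {ι : Type*}

theorem minkowskiIntegralSupport_zero (hm : 0 < m) (γ : (Fin l → ℝ) →ₗ[ℝ] ℝ) :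
    minkowskiIntegralSupport l m 0 γ = 0 := by
  have h0 : (0 : ℕ) • (0 : ConvexBody ((Fin l → ℝ) × (Fin m → ℝ))) = 0 :=
    zero_nsmul (0 : ConvexBody ((Fin l → ℝ) × (Fin m → ℝ)))
  rw [← h0, minkowskiIntegralSupport_nsmul hm, Nat.cast_zero, zero_pow m.succ_ne_zero, zero_mul]

theorem toBlocks₂₂_sum (S : Finset ι) (N : ι → Matrix (Unit ⊕ Fin m) (Unit ⊕ Fin m) ℝ) :
    (∑ i ∈ S, N i).toBlocks₂₂ = ∑ i ∈ S, (N i).toBlocks₂₂ := by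
  ext j k
  simp [toBlocks₂₂, Matrix.sum_apply]

theorem spatialGradient_sum (S : Finset ι) (G : ι → ℝ × (Fin m → ℝ) → Unit ⊕ Fin m → ℝ)
    (y : ℝ × (Fin m → ℝ)) :
    spatialGradient (∑ i ∈ S, G i) y = ∑ i ∈ S, spatialGradient (G i) y := by
  ext j
  simp [spatialGradient, Finset.sum_apply]

variable [Fintype ι] [DecidableEq ι]

theorem abs_alternating_sum_sub_le (u v w : Finset ι → ℝ) (h : ∀ S, |u S - v S| ≤ w S) :
    |∑ S : Finset ι, (-1 : ℝ) ^ (Sᶜ).card * u S - ∑ S : Finset ι, (-1 : ℝ) ^ (Sᶜ).card * v S|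
      ≤ ∑ S, w S := by
  rw [← Finset.sum_sub_distrib]
  refine (Finset.abs_sum_le_sum_abs _ _).trans (Finset.sum_le_sum fun S _ => ?_)
  rw [← mul_sub, abs_mul, abs_pow, abs_neg, abs_one, one_pow, one_mul]
  exact h S

variable {K : ι → ConvexBody ((Fin l → ℝ) × (Fin m → ℝ))}
  {α β : (Fin l → ℝ) →ₗ[ℝ] ℝ} {δ : ι → ℝ} {H : ι → ℝ × (Fin m → ℝ) → ℝ}
  {G : ι → ℝ × (Fin m → ℝ) → Unit ⊕ Fin m → ℝ}
  {N : ι → ℝ × (Fin m → ℝ) → Matrix (Unit ⊕ Fin m) (Unit ⊕ Fin m) ℝ}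

namespace IsSmoothPotential

variable (h : ∀ i, IsSmoothPotential (K i : Set ((Fin l → ℝ) × (Fin m → ℝ))) α β (δ i) (H i) (G i)
  (N i))
include h

theorem abs_polarization_le (hm : 0 < m) (hι : m + 1 < Fintype.card ι) (t : ℝ) :
    |polarization (fun Δ => minkowskiIntegralSupport l m Δ (α + t • β)) K|
      ≤ ∑ S : Finset ι, (∑ i ∈ S, δ i) *
        volume.real (Prod.snd '' ((∑ i ∈ S, K i : ConvexBody _) :
          Set ((Fin l → ℝ) × (Fin m → ℝ)))) := by
  let P : (Fin m → ℝ) → ι → ℝ × Matrix (Fin m) (Fin m) ℝ := fun p i =>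
    (H i (t, p) - p ⬝ᵥ spatialGradient (G i) (t, p), (N i (t, p)).toBlocks₂₂)
  let φ : Finset ι → (Fin m → ℝ) → ℝ := fun S p => (∑ i ∈ S, P p i).1 * (∑ i ∈ S, P p i).2.det
  have : Nonempty (Fin m) := ⟨⟨0, hm⟩⟩
  have key : ∀ S, Integrable (φ S) ∧
      |minkowskiIntegralSupport l m (∑ i ∈ S, K i) (α + t • β) - ∫ p, φ S p|
        ≤ (∑ i ∈ S, δ i) * volume.real (Prod.snd '' ((∑ i ∈ S, K i : ConvexBody _) :
          Set ((Fin l → ℝ) × (Fin m → ℝ)))) := by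
    intro S
    rcases S.eq_empty_or_nonempty with rfl | hS
    · have : φ ∅ = fun _ => 0 := by
        ext p
        simp [φ]
      rw [this]
      simp [minkowskiIntegralSupport_zero hm]
    · have hsum := IsSmoothPotential.sum h hS
      have hφ : φ S = fun p => ((∑ i ∈ S, H i) (t, p)
          - p ⬝ᵥ spatialGradient (∑ i ∈ S, G i) (t, p)) *
          ((∑ i ∈ S, N i) (t, p)).toBlocks₂₂.det := by
        ext p
        simp only [φ, P, Prod.fst_sum, Prod.snd_sum, Finset.sum_sub_distrib, Finset.sum_apply,
          toBlocks₂₂_sum, spatialGradient_sum, dotProduct_sum]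
      rw [hφ]
      exact ⟨hsum.integrable_potential t,
        hsum.abs_minkowskiIntegralSupport_sub_integral_potential_le t⟩
  have hzero : ∑ S : Finset ι, (-1 : ℝ) ^ (Sᶜ).card * ∫ p, φ S p = 0 := by
    simp only [← integral_const_mul]
    rw [← integral_finsetSum _ fun S _ => (key S).1.const_mul _]
    have : ∀ p, ∑ S : Finset ι, (-1 : ℝ) ^ (Sᶜ).card * φ S p = 0 := fun p =>
      polarization_mul_det_eq_zero (by simpa using hι) (P p)
    simp [this]
  have := abs_alternating_sum_sub_le _ _ _ fun S => (key S).2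
  rwa [hzero, sub_zero] at this

theorem neg_le_polarization_second_difference (hm : 0 < m) (e : Unit ⊕ Fin m ≃ ι) :
    -(4 * ∑ S : Finset ι, (∑ i ∈ S, δ i) *
        volume.real (Prod.snd '' ((∑ i ∈ S, K i : ConvexBody _) :
          Set ((Fin l → ℝ) × (Fin m → ℝ)))))
      ≤ polarization (fun Δ => minkowskiIntegralSupport l m Δ (α + (1 : ℝ) • β)
        + minkowskiIntegralSupport l m Δ (α + (-1 : ℝ) • β)
        - 2 * minkowskiIntegralSupport l m Δ (α + (0 : ℝ) • β)) K := by
  let φ : Finset ι → ℝ → (Fin m → ℝ) → ℝ := fun S r p =>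
    (1 - |r|) * (∑ i ∈ S, N i (r, p)).det
  have key : ∀ S,
      (∀ᵐ r ∂(volume.restrict (Set.Ioc (-1 : ℝ) 1)), Integrable (φ S r)) ∧
      IntegrableOn (fun r => ∫ p, φ S r p) (Set.Ioc (-1 : ℝ) 1) ∧
      |minkowskiIntegralSupport l m (∑ i ∈ S, K i) (α + (1 : ℝ) • β)
        + minkowskiIntegralSupport l m (∑ i ∈ S, K i) (α + (-1 : ℝ) • β)
        - 2 * minkowskiIntegralSupport l m (∑ i ∈ S, K i) (α + (0 : ℝ) • β)
        - ∫ r in Set.Ioc (-1 : ℝ) 1, ∫ p, φ S r p|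
        ≤ 4 * ((∑ i ∈ S, δ i) * volume.real (Prod.snd '' ((∑ i ∈ S, K i : ConvexBody _) :
          Set ((Fin l → ℝ) × (Fin m → ℝ))))) := by
    intro S
    rcases S.eq_empty_or_nonempty with rfl | hS
    · have : φ ∅ = fun _ _ => 0 := by
        ext r p
        simp [φ]
      rw [this]
      simp [minkowskiIntegralSupport_zero hm]
    · have hφ : φ S = fun r p => (1 - |r|) * ((∑ i ∈ S, N i) (r, p)).det := by
        ext r p
        simp only [φ, Finset.sum_apply]
      rw [hφ]
      exact (IsSmoothPotential.sum h hS).second_difference_minkowskiIntegralSupport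
  have hnonneg : 0 ≤ ∑ S : Finset ι, (-1 : ℝ) ^ (Sᶜ).card *
      ∫ r in Set.Ioc (-1 : ℝ) 1, ∫ p, φ S r p := by
    simp only [← integral_const_mul]
    rw [← integral_finsetSum _ fun S _ => ((key S).2.1.const_mul _).congr
      (Eventually.of_forall fun r => (integral_const_mul _ _).symm)]
    refine integral_nonneg_of_ae ?_
    filter_upwards [ae_all_iff.mpr fun S => (key S).1, ae_restrict_mem measurableSet_Ioc] with r hr hr'
    rw [← integral_finsetSum _ fun S _ => (hr S).const_mul _]
    refine integral_nonneg fun p => ?_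
    have h1 : ∑ S : Finset ι, (-1 : ℝ) ^ (Sᶜ).card * φ S r p
        = (1 - |r|) * polarization Matrix.det fun i => N i (r, p) := by
      simp only [polarization, φ, Finset.mul_sum]
      exact Finset.sum_congr rfl fun S _ => by ring
    simp only [Pi.zero_apply]
    rw [h1]
    exact mul_nonneg (sub_nonneg.mpr (abs_le.mpr ⟨hr'.1.le, hr'.2⟩))
      (polarization_det_nonneg e _ fun i => (h i).posSemidef _)
  have := abs_alternating_sum_sub_le _ _ _ fun S => (key S).2.2
  rw [← Finset.mul_sum] at this
  have := (abs_le.mp this).1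
  unfold polarization
  linarith

end IsSmoothPotential

end PolarizationEstimates

section Limits

open Topology Filter

variable {l m : ℕ} {ι : Type*}

theorem convexBody_sum_subset {V : Type*} [NormedAddCommGroup V] [NormedSpace ℝ V]
    {K L : ι → ConvexBody V} (h : ∀ i, (K i : Set V) ⊆ L i) (S : Finset ι) :
    ((∑ i ∈ S, K i : ConvexBody V) : Set V) ⊆ (∑ i ∈ S, L i : ConvexBody V) := by
  induction S using Finset.cons_induction with
  | empty => simp
  | cons i S hi ih =>
    rw [Finset.sum_cons, Finset.sum_cons, ConvexBody.coe_add, ConvexBody.coe_add]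
    exact Set.add_subset_add (h i) ih

theorem convexBody_sum_dist_le {V : Type*} [NormedAddCommGroup V] [NormedSpace ℝ V]
    {K L : ι → ConvexBody V} {ε : ℝ} (h : ∀ i, ∀ z ∈ L i, ∃ z' ∈ K i, dist z z' ≤ ε)
    (S : Finset ι) :
    ∀ z ∈ (∑ i ∈ S, L i : ConvexBody V), ∃ z' ∈ (∑ i ∈ S, K i : ConvexBody V),
      dist z z' ≤ S.card * ε := by
  induction S using Finset.cons_induction with
  | empty =>
    intro z hz
    exact ⟨z, hz, by simp⟩
  | cons i S hi ih =>
    intro z hz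
    rw [Finset.sum_cons, ← SetLike.mem_coe, ConvexBody.coe_add] at hz
    obtain ⟨x, hx, y, hy, rfl⟩ := hz
    obtain ⟨x', hx', hxx⟩ := h i x hx
    obtain ⟨y', hy', hyy⟩ := ih y hy
    refine ⟨x' + y', ?_, (dist_add_add_le _ _ _ _).trans ?_⟩
    · rw [Finset.sum_cons, ← SetLike.mem_coe, ConvexBody.coe_add]
      exact Set.add_mem_add hx' hy'
    · rw [Finset.card_cons]
      push_cast
      linarith

theorem tendsto_minkowskiIntegralSupport_sum {K : ι → ConvexBody ((Fin l → ℝ) × (Fin m → ℝ))}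
    {L : ℕ → ι → ConvexBody ((Fin l → ℝ) × (Fin m → ℝ))} {ε : ℕ → ℝ} (hε : Tendsto ε atTop (𝓝 0))
    (hKL : ∀ n i, (K i : Set ((Fin l → ℝ) × (Fin m → ℝ))) ⊆ L n i)
    (hLK : ∀ n i, ∀ z ∈ L n i, ∃ z' ∈ K i, dist z z' ≤ ε n) (S : Finset ι)
    (γ : (Fin l → ℝ) →ₗ[ℝ] ℝ) :
    Tendsto (fun n => minkowskiIntegralSupport l m (∑ i ∈ S, L n i) γ) atTop
      (𝓝 (minkowskiIntegralSupport l m (∑ i ∈ S, K i) γ)) :=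
  tendsto_integral_fiberSup (∑ i ∈ S, K i : ConvexBody _).isCompact γ
    (fun n => (∑ i ∈ S, L n i : ConvexBody _).isCompact)
    (fun n => convexBody_sum_subset (hKL n) S) (r := fun n => S.card * ε n)
    (by simpa using hε.const_mul (S.card : ℝ)) (fun n => convexBody_sum_dist_le (hLK n) S)

theorem tendsto_mul_volume_sum {K : ι → ConvexBody ((Fin l → ℝ) × (Fin m → ℝ))}
    {L : ℕ → ι → ConvexBody ((Fin l → ℝ) × (Fin m → ℝ))} {ε : ℕ → ℝ} (hε : Tendsto ε atTop (𝓝 0))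
    (hLK : ∀ n i, ∀ z ∈ L n i, ∃ z' ∈ K i, dist z z' ≤ ε n) (S : Finset ι) :
    Tendsto (fun n => (∑ _i ∈ S, ε n) * volume.real (Prod.snd '' ((∑ i ∈ S, L n i : ConvexBody _) :
      Set ((Fin l → ℝ) × (Fin m → ℝ))))) atTop (𝓝 0) := by
  have hr : Tendsto (fun n => S.card * ε n) atTop (𝓝 0) := by
    simpa using hε.const_mul (S.card : ℝ)
  obtain ⟨R, hR⟩ := hr.bddAbove_range
  let Z : Set ((Fin l → ℝ) × (Fin m → ℝ)) :=
    Metric.cthickening R ((∑ i ∈ S, K i : ConvexBody _) : Set ((Fin l → ℝ) × (Fin m → ℝ)))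
  have hZ : IsCompact (Prod.snd '' Z) :=
    ((∑ i ∈ S, K i : ConvexBody _).isCompact.cthickening).image continuous_snd
  have hle : ∀ n, volume.real (Prod.snd '' ((∑ i ∈ S, L n i : ConvexBody _) :
      Set ((Fin l → ℝ) × (Fin m → ℝ)))) ≤ volume.real (Prod.snd '' Z) := by
    intro n
    refine measureReal_mono (Set.image_mono fun z hz => ?_) hZ.measure_lt_top.ne
    obtain ⟨z', hz', hd⟩ := convexBody_sum_dist_le (hLK n) S z hz
    exact Metric.mem_cthickening_of_dist_le z z' R _ hz' (hd.trans (hR ⟨n, rfl⟩))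
  simp only [Finset.sum_const, nsmul_eq_mul]
  refine hr.zero_mul_isBoundedUnder_le (isBoundedUnder_of ⟨volume.real (Prod.snd '' Z), fun n => ?_⟩)
  simp only [Function.comp_apply, Real.norm_eq_abs, abs_of_nonneg measureReal_nonneg]
  exact hle n

theorem exists_isSmoothPotential_sequence (K : ι → ConvexBody ((Fin l → ℝ) × (Fin m → ℝ)))
    (α β : (Fin l → ℝ) →ₗ[ℝ] ℝ) :
    ∃ (ε : ℕ → ℝ) (L : ℕ → ι → ConvexBody ((Fin l → ℝ) × (Fin m → ℝ)))
      (H : ℕ → ι → ℝ × (Fin m → ℝ) → ℝ) (G : ℕ → ι → ℝ × (Fin m → ℝ) → Unit ⊕ Fin m → ℝ)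
      (N : ℕ → ι → ℝ × (Fin m → ℝ) → Matrix (Unit ⊕ Fin m) (Unit ⊕ Fin m) ℝ),
      Tendsto ε atTop (𝓝 0) ∧
      (∀ n i, (K i : Set ((Fin l → ℝ) × (Fin m → ℝ))) ⊆ L n i) ∧
      (∀ n i, ∀ z ∈ L n i, ∃ z' ∈ K i, dist z z' ≤ ε n) ∧
      ∀ n i, IsSmoothPotential (L n i : Set ((Fin l → ℝ) × (Fin m → ℝ))) α β (ε n) (H n i) (G n i)
        (N n i) := by
  have := fun (n : ℕ) (i : ι) => exists_isSmoothPotential_approximation (K i) α β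
    (Nat.one_div_pos_of_nat (α := ℝ) (n := n))
  choose L H G N h1 h2 h3 using this
  exact ⟨_, L, H, G, N, tendsto_one_div_add_atTop_nhds_zero_nat, h1, h2, h3⟩

variable [Fintype ι] [DecidableEq ι]

theorem polarization_minkowskiIntegralSupport_eq_zero (hm : 0 < m) (hι : m + 1 < Fintype.card ι)
    (γ : (Fin l → ℝ) →ₗ[ℝ] ℝ) (K : ι → ConvexBody ((Fin l → ℝ) × (Fin m → ℝ))) :
    polarization (fun Δ => minkowskiIntegralSupport l m Δ γ) K = 0 := by
  obtain ⟨ε, L, H, G, N, hε, hKL, hLK, h⟩ := exists_isSmoothPotential_sequence K γ 0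
  have h1 : Tendsto (fun n => polarization (fun Δ => minkowskiIntegralSupport l m Δ γ) (L n)) atTop
      (𝓝 (polarization (fun Δ => minkowskiIntegralSupport l m Δ γ) K)) :=
    tendsto_finsetSum _ fun S _ =>
      (tendsto_minkowskiIntegralSupport_sum hε hKL hLK S γ).const_mul _
  have h2 := tendsto_finsetSum Finset.univ fun S _ => tendsto_mul_volume_sum hε hLK S
  rw [Finset.sum_const_zero] at h2
  refine tendsto_nhds_unique h1 (squeeze_zero_norm (fun n => ?_) h2)
  simpa using IsSmoothPotential.abs_polarization_le (h n) hm hι 0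

theorem two_mul_polarization_minkowskiIntegralSupport_le (hm : 0 < m) (e : Unit ⊕ Fin m ≃ ι)
    (α β : (Fin l → ℝ) →ₗ[ℝ] ℝ) (K : ι → ConvexBody ((Fin l → ℝ) × (Fin m → ℝ))) :
    2 * polarization (fun Δ => minkowskiIntegralSupport l m Δ α) K
      ≤ polarization (fun Δ => minkowskiIntegralSupport l m Δ (α + β)) K
        + polarization (fun Δ => minkowskiIntegralSupport l m Δ (α - β)) K := by
  obtain ⟨ε, L, H, G, N, hε, hKL, hLK, h⟩ := exists_isSmoothPotential_sequence K α β
  have h1 : Tendsto (fun n => polarization (fun Δ =>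
      minkowskiIntegralSupport l m Δ (α + (1 : ℝ) • β)
        + minkowskiIntegralSupport l m Δ (α + (-1 : ℝ) • β)
        - 2 * minkowskiIntegralSupport l m Δ (α + (0 : ℝ) • β)) (L n)) atTop
      (𝓝 (polarization (fun Δ => minkowskiIntegralSupport l m Δ (α + (1 : ℝ) • β)
        + minkowskiIntegralSupport l m Δ (α + (-1 : ℝ) • β)
        - 2 * minkowskiIntegralSupport l m Δ (α + (0 : ℝ) • β)) K)) := by
    have hS := tendsto_minkowskiIntegralSupport_sum hε hKL hLK
    exact tendsto_finsetSum _ fun S _ =>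
      (((hS S _).add (hS S _)).sub ((hS S _).const_mul 2)).const_mul _
  have h2 := tendsto_finsetSum Finset.univ fun S _ => tendsto_mul_volume_sum hε hLK S
  rw [Finset.sum_const_zero] at h2
  have h3 := (h2.const_mul 4).neg
  rw [mul_zero, neg_zero] at h3
  have h4 := le_of_tendsto_of_tendsto' h3 h1 fun n =>
    IsSmoothPotential.neg_le_polarization_second_difference (h n) hm e
  have hneg : α + (-1 : ℝ) • β = α - β := by module
  rw [hneg, one_smul, zero_smul, add_zero] at h4
  simp only [polarization, mul_sub, mul_add, Finset.sum_sub_distrib, Finset.sum_add_distrib,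
    Finset.mul_sum] at h4 ⊢
  simp only [mul_left_comm (2 : ℝ)]
  linarith

end Limits

section MixedFiberBody

variable {l m : ℕ}

theorem exists_mixed_fiber_body (hm : 0 < m)
    (Δ : Fin (m + 1) → ConvexBody ((Fin l → ℝ) × (Fin m → ℝ))) :
    ∃ K : ConvexBody (Fin l → ℝ), ∀ γ : (Fin l → ℝ) →ₗ[ℝ] ℝ,
      (m + 1).factorial * sSup ((fun x => γ x) '' (K : Set (Fin l → ℝ)))
        = polarization (fun K => minkowskiIntegralSupport l m K γ) Δ := by
  have hfac : ((m + 1).factorial : ℝ) ≠ 0 := Nat.cast_ne_zero.mpr (Nat.factorial_ne_zero _)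
  let M : ((Fin l → ℝ) →ₗ[ℝ] ℝ) → ℝ := fun γ =>
    polarization (fun K => minkowskiIntegralSupport l m K γ) Δ
  have hsmul : ∀ c : ℝ, 0 < c → ∀ γ, M (c • γ) = c * M γ := by
    intro c hc γ
    simp only [M, polarization, minkowskiIntegralSupport_smul _ γ hc, Finset.mul_sum]
    exact Finset.sum_congr rfl fun S _ => mul_left_comm _ _ _
  obtain ⟨e⟩ : Nonempty (Unit ⊕ Fin m ≃ Fin (m + 1)) :=
    Fintype.card_eq.mp (by simp [add_comm])
  have hadd : ∀ γ γ', M (γ + γ') ≤ M γ + M γ' := by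
    intro γ γ'
    have h := two_mul_polarization_minkowskiIntegralSupport_le hm e ((1 / 2 : ℝ) • (γ + γ'))
      ((1 / 2 : ℝ) • (γ - γ')) Δ
    have h1 : (1 / 2 : ℝ) • (γ + γ') + (1 / 2 : ℝ) • (γ - γ') = γ := by module
    have h2 : (1 / 2 : ℝ) • (γ + γ') - (1 / 2 : ℝ) • (γ - γ') = γ' := by module
    rw [h1, h2] at h
    have h3 := hsmul (1 / 2) (by norm_num) (γ + γ')
    simp only [M] at h3 ⊢
    linarith
  obtain ⟨K, hK⟩ := exists_convexBody_of_sublinear (fun γ => ((m + 1).factorial : ℝ)⁻¹ * M γ)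
    (fun c hc γ => by rw [hsmul c hc]; ring)
    (fun γ γ' => by rw [← mul_add]; exact mul_le_mul_of_nonneg_left (hadd γ γ') (by positivity))
  exact ⟨K, fun γ => by rw [hK, mul_inv_cancel_left₀ hfac]⟩

theorem mixed_fiber_body_support_eq
    {MF : (Fin (m + 1) → ConvexBody ((Fin l → ℝ) × (Fin m → ℝ))) → ConvexBody (Fin l → ℝ)}
    (hsymm : ∀ (Δ : Fin (m + 1) → ConvexBody ((Fin l → ℝ) × (Fin m → ℝ)))
      (σ : Equiv.Perm (Fin (m + 1))), MF (Δ ∘ σ) = MF Δ)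
    (hadd : ∀ (Δ : Fin (m + 1) → ConvexBody ((Fin l → ℝ) × (Fin m → ℝ))) (i : Fin (m + 1))
      (K K' : ConvexBody ((Fin l → ℝ) × (Fin m → ℝ))),
      MF (Function.update Δ i (K + K'))
        = MF (Function.update Δ i K) + MF (Function.update Δ i K'))
    (hdiag : ∀ (Δ : ConvexBody ((Fin l → ℝ) × (Fin m → ℝ))) (γ : (Fin l → ℝ) →ₗ[ℝ] ℝ),
      sSup ((fun x => γ x) '' ((MF fun _ => Δ) : Set (Fin l → ℝ)))
        = minkowskiIntegralSupport l m Δ γ)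
    (Δ : Fin (m + 1) → ConvexBody ((Fin l → ℝ) × (Fin m → ℝ))) (γ : (Fin l → ℝ) →ₗ[ℝ] ℝ) :
    (m + 1).factorial * sSup ((fun x => γ x) '' (MF Δ : Set (Fin l → ℝ)))
      = polarization (fun K => minkowskiIntegralSupport l m K γ) Δ := by
  have h := polarization_of_multiadditive
    (fun Δ => sSup ((fun x => γ x) '' (MF Δ : Set (Fin l → ℝ))))
    (fun Δ σ => by rw [hsymm]) (fun Δ i K K' => by rw [hadd, support_add]) Δ
  rw [Fintype.card_fin] at h
  simp only [hdiag] at h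
  exact h.symm

end MixedFiberBody

/-- Existence and uniqueness of mixed fiber bodies: there is a unique symmetric,
Minkowski-multilinear map `MF` from `(m+1)`-tuples of convex bodies in `ℝ^l × ℝ^m` to convex
bodies in `ℝ^l` whose diagonal values are the Minkowski integrals (characterized by their
support functions). -/
theorem mixed_fiber_body_exists_unique (l m : ℕ) (hl : 0 < l) (hm : 0 < m) :
    ∃! MF : (Fin (m + 1) → ConvexBody ((Fin l → ℝ) × (Fin m → ℝ))) → ConvexBody (Fin l → ℝ),
      (∀ (Δ : Fin (m + 1) → ConvexBody ((Fin l → ℝ) × (Fin m → ℝ)))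
          (σ : Equiv.Perm (Fin (m + 1))), MF (Δ ∘ σ) = MF Δ) ∧
      (∀ (Δ : Fin (m + 1) → ConvexBody ((Fin l → ℝ) × (Fin m → ℝ))) (i : Fin (m + 1))
          (K K' : ConvexBody ((Fin l → ℝ) × (Fin m → ℝ))),
          MF (Function.update Δ i (K + K'))
            = MF (Function.update Δ i K) + MF (Function.update Δ i K')) ∧
      (∀ (Δ : ConvexBody ((Fin l → ℝ) × (Fin m → ℝ))) (γ : (Fin l → ℝ) →ₗ[ℝ] ℝ),
          sSup ((fun x => γ x) '' ((MF fun _ => Δ) : Set (Fin l → ℝ)))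
            = minkowskiIntegralSupport l m Δ γ) := by
  have hfac : ((m + 1).factorial : ℝ) ≠ 0 := Nat.cast_ne_zero.mpr (Nat.factorial_ne_zero _)
  choose MF hMF using fun Δ => exists_mixed_fiber_body (l := l) hm Δ
  refine ⟨MF, ⟨fun Δ σ => ?_, fun Δ i K K' => ?_, fun Δ γ => ?_⟩, ?_⟩
  · refine eq_of_support_eq fun γ => mul_left_cancel₀ hfac ?_
    rw [hMF, hMF, polarization_comp_equiv]
  · refine eq_of_support_eq fun γ => mul_left_cancel₀ hfac ?_
    rw [support_add, mul_add, hMF, hMF, hMF]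
    exact polarization_update_add _ (fun Δ =>
      polarization_minkowskiIntegralSupport_eq_zero hm (by simp) γ Δ) Δ i K K'
  · refine mul_left_cancel₀ hfac ?_
    rw [hMF]
    exact polarization_diagonal _ Δ m (Fintype.card_fin _) fun k =>
      minkowskiIntegralSupport_nsmul hm Δ γ k
  · rintro MF' ⟨hsymm, hadd, hdiag⟩
    funext Δ
    refine eq_of_support_eq fun γ => mul_left_cancel₀ hfac ?_
    rw [hMF, mixed_fiber_body_support_eq hsymm hadd hdiag]
end

section
/- For every collection of convex bodies Δ₀, …, Δ_m ⊂ ℝ^l × ℝ^m, the function γ ↦ MS(Γ_{Δ₀}(γ), …, Γ_{Δ_m}(γ)), defined on the space of linear functionals γ on ℝ^l, is convex and positively homogeneous (its value at tγ equals t times its value at γ for every real t ≥ 0). -/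
open MeasureTheory

/-- The shadow volume of a convex body `B ⊂ ℝ × ℝ^m`. -/
noncomputable def shadowVolume (m : ℕ) (B : Set (ℝ × (Fin m → ℝ))) : ℝ :=
  ∫ a in Prod.snd '' B, sSup {t : ℝ | (t, a) ∈ B}

/-- The linear map `(x, y) ↦ (γ(x), y)` from `ℝ^l × ℝ^m` to `ℝ × ℝ^m`. -/
noncomputable def gammaMap (l m : ℕ) (γ : (Fin l → ℝ) →ₗ[ℝ] ℝ) :
    ((Fin l → ℝ) × (Fin m → ℝ)) →ₗ[ℝ] (ℝ × (Fin m → ℝ)) :=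
  (γ.comp (LinearMap.fst ℝ (Fin l → ℝ) (Fin m → ℝ))).prod
    (LinearMap.snd ℝ (Fin l → ℝ) (Fin m → ℝ))

/-- `Γ_Δ(γ)`: the image of a convex body `Δ ⊂ ℝ^l × ℝ^m` under `(x, y) ↦ (γ(x), y)`. -/
noncomputable def gammaBody (l m : ℕ) (Δ : ConvexBody ((Fin l → ℝ) × (Fin m → ℝ)))
    (γ : (Fin l → ℝ) →ₗ[ℝ] ℝ) : ConvexBody (ℝ × (Fin m → ℝ)) where
  carrier := gammaMap l m γ '' (Δ : Set ((Fin l → ℝ) × (Fin m → ℝ)))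
  convex' := Δ.convex.linear_image (gammaMap l m γ)
  isCompact' := Δ.isCompact.image (gammaMap l m γ).continuous_of_finiteDimensional
  nonempty' := Δ.nonempty.image _

/-- Polarization: the alternating sum of the diagonal values of a multilinear map over partial sums
is the symmetrization of the map. -/
theorem MultilinearMap.sum_neg_one_pow_card_mul_map_sum_compl {R ι M : Type*} [CommSemiring R]
    [Module R ℝ] [Fintype ι] [DecidableEq ι] [AddCommMonoid M] [Module R M]
    (L : MultilinearMap R (fun _ : ι => M) ℝ) (x : ι → M) :
    ∑ J : Finset ι, (-1 : ℝ) ^ J.card * L (fun _ => ∑ i ∈ Jᶜ, x i) =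
      ∑ σ : Equiv.Perm ι, L (fun i => x (σ i)) := by
  have expand (J : Finset ι) : (-1 : ℝ) ^ J.card * L (fun _ => ∑ i ∈ Jᶜ, x i) =
      ∑ p : ι → ι, if J ⊆ (Finset.univ.image p)ᶜ then
        (-1 : ℝ) ^ J.card * L (fun i => x (p i)) else 0 := by
    rw [L.map_sum_finset (fun _ j => x j) (fun _ => Jᶜ), Finset.mul_sum, ← Finset.sum_filter]
    refine Finset.sum_congr ?_ fun _ _ => rfl
    ext p
    simp only [Fintype.mem_piFinset, Finset.mem_compl, Finset.mem_filter, Finset.mem_univ, true_and]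
    refine ⟨fun h j hj => ?_, fun h i hi => ?_⟩
    · simp only [Finset.mem_compl, Finset.mem_image, Finset.mem_univ, true_and, not_exists]
      rintro i rfl
      exact h i hj
    · simpa using h hi
  simp_rw [expand]
  rw [Finset.sum_comm]
  have inner (p : ι → ι) : (∑ J : Finset ι, if J ⊆ (Finset.univ.image p)ᶜ then
      (-1 : ℝ) ^ J.card * L (fun i => x (p i)) else 0) =
      if Function.Bijective p then L (fun i => x (p i)) else 0 := by
    rw [← Finset.sum_filter, ← Finset.sum_mul]
    have hfil : (Finset.univ.filter fun J : Finset ι => J ⊆ (Finset.univ.image p)ᶜ) =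
        ((Finset.univ.image p)ᶜ).powerset := by
      ext J
      simp
    have hsum := congrArg (Int.cast : ℤ → ℝ)
      (Finset.sum_powerset_neg_one_pow_card (x := (Finset.univ.image p)ᶜ))
    push_cast at hsum
    rw [hfil, hsum]
    have hiff : (Finset.univ.image p)ᶜ = ∅ ↔ Function.Bijective p := by
      rw [Finset.compl_eq_empty_iff, ← Finite.surjective_iff_bijective,
        Finset.eq_univ_iff_forall]
      simp [Function.Surjective]
    simp [hiff]
  simp_rw [inner]
  rw [← Finset.sum_filter]
  refine (Finset.sum_bij' (fun (σ : Equiv.Perm ι) _ => (σ : ι → ι))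
    (fun p hp => Equiv.ofBijective p (Finset.mem_filter.1 hp).2) ?_ ?_ ?_ ?_ ?_).symm
  · intro σ _
    simp
  · simp
  · intro σ _
    ext
    rfl
  · intro p _
    rfl
  · intros
    rfl

/-- The determinant as a multilinear function of matrices, the `r`-th argument contributing
its `r`-th row. -/
noncomputable def detOfRows (ι : Type*) [Fintype ι] [DecidableEq ι] :
    MultilinearMap ℝ (fun _ : ι => Matrix ι ι ℝ) ℝ :=
  (Matrix.detRowAlternating (R := ℝ) (n := ι)).toMultilinearMap.compLinearMap
    (fun r => LinearMap.proj r)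

theorem detOfRows_apply {ι : Type*} [Fintype ι] [DecidableEq ι] (A : ι → Matrix ι ι ℝ) :
    detOfRows ι A = Matrix.det (fun r => A r r) := rfl

theorem sum_perm_detOfRows_nonneg {ι : Type*} [Fintype ι] [DecidableEq ι]
    {A : ι → Matrix ι ι ℝ} (hA : ∀ i, (A i).PosSemidef) :
    0 ≤ ∑ σ : Equiv.Perm ι, detOfRows ι (fun r => A (σ r)) := by
  have hC (i : ι) : ∃ C : Matrix ι ι ℝ, ∀ r, A i r = ∑ k, C k r • C k := by
    obtain ⟨C, hC⟩ : ∃ C : Matrix ι ι ℝ, A i = C.conjTranspose * C := by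
      open scoped MatrixOrder in
      exact CStarAlgebra.nonneg_iff_eq_star_mul_self.mp (hA i).nonneg
    refine ⟨C, fun r => ?_⟩
    ext c
    simp [hC, Matrix.mul_apply, Finset.sum_apply]
  choose C hC using hC
  have expand (σ : Equiv.Perm ι) : detOfRows ι (fun r => A (σ r)) =
      ∑ k : ι → ι, (Equiv.Perm.sign σ : ℝ) * (∏ r, C (σ r) (k (σ r)) r) *
        Matrix.det (fun i => C i (k i)) := by
    rw [detOfRows_apply]
    have h1 : Matrix.det (fun r => A (σ r) r) = (Matrix.detRowAlternating (R := ℝ) (n := ι))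
        (fun r => ∑ k, C (σ r) k r • C (σ r) k) := by
      simp_rw [hC]; rfl
    rw [h1, ← AlternatingMap.coe_multilinearMap, MultilinearMap.map_sum]
    refine (Fintype.sum_equiv (σ.arrowCongr (Equiv.refl ι)).symm _ _ fun k => ?_).symm
    rw [MultilinearMap.map_smul_univ]
    have h2 := Matrix.det_permute σ (Matrix.of fun i => C i (k i))
    simp only [Equiv.arrowCongr_symm, Equiv.refl_symm, Equiv.arrowCongr_apply, Equiv.symm_symm,
      Equiv.coe_refl, Function.id_def, Function.comp_apply, smul_eq_mul]
    rw [mul_comm (Equiv.Perm.sign σ : ℝ), mul_assoc]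
    congr 1
    exact h2.symm
  simp_rw [expand]
  rw [Finset.sum_comm]
  refine Finset.sum_nonneg fun k _ => ?_
  rw [← Finset.sum_mul]
  have h3 : ∑ σ : Equiv.Perm ι, (Equiv.Perm.sign σ : ℝ) * ∏ r, C (σ r) (k (σ r)) r =
      Matrix.det (fun i => C i (k i)) :=
    (Matrix.det_apply' (Matrix.of fun i => C i (k i))).symm
  rw [h3]
  exact mul_self_nonneg _

open scoped Convolution in
/-- A convex Lipschitz function on a finite-dimensional space is uniformly approximated by
smooth convex functions. -/
theorem ConvexOn.exists_contDiff_convexOn_abs_sub_le {E : Type*} [NormedAddCommGroup E]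
    [NormedSpace ℝ E] [FiniteDimensional ℝ E] {h : E → ℝ} (hc : ConvexOn ℝ Set.univ h)
    {C : NNReal} (hL : LipschitzWith C h) {δ : ℝ} (hδ : 0 < δ) :
    ∃ u : E → ℝ, ContDiff ℝ 2 u ∧ ConvexOn ℝ Set.univ u ∧ ∀ z, |u z - h z| ≤ δ := by
  borelize E
  let μ : Measure E := Measure.addHaar
  have hr : 0 < δ / (C + 1) := by positivity
  let φ : ContDiffBump (0 : E) := ⟨δ / (C + 1) / 2, δ / (C + 1), by positivity, by linarith⟩
  let u : E → ℝ := φ.normed μ ⋆[ContinuousLinearMap.lsmul ℝ ℝ, μ] h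
  have hint (z : E) : Integrable (fun t => φ.normed μ t * h (z - t)) μ :=
    (φ.continuous_normed.mul (hL.continuous.comp (by fun_prop))).integrable_of_hasCompactSupport
      φ.hasCompactSupport_normed.mul_right
  have hu (z : E) : u z = ∫ t, φ.normed μ t * h (z - t) ∂μ := rfl
  refine ⟨u, ?_, ⟨convex_univ, fun x _ y _ a b ha hb hab => ?_⟩, fun z => ?_⟩
  · exact φ.hasCompactSupport_normed.contDiff_convolution_left _ φ.contDiff_normed
      hL.continuous.locallyIntegrable
  · simp only [hu, smul_eq_mul]
    rw [← integral_const_mul, ← integral_const_mul,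
      ← integral_add ((hint x).const_mul a) ((hint y).const_mul b)]
    refine integral_mono (hint _) (((hint x).const_mul a).add ((hint y).const_mul b)) fun t => ?_
    have hsub : a • x + b • y - t = a • (x - t) + b • (y - t) := by
      rw [smul_sub, smul_sub, sub_add_sub_comm, ← add_smul, hab, one_smul]
    have := mul_le_mul_of_nonneg_left
      (hc.2 (Set.mem_univ (x - t)) (Set.mem_univ (y - t)) ha hb hab) (φ.nonneg_normed (μ := μ) t)
    simp only [hsub, smul_eq_mul] at this ⊢
    linarith
  · rw [← Real.dist_eq]
    refine φ.dist_normed_convolution_le hL.continuous.aestronglyMeasurable fun y hy => ?_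
    calc dist (h y) (h z) ≤ C * dist y z := hL.dist_le_mul y z
      _ ≤ C * (δ / (C + 1)) := by gcongr; exact (Metric.mem_ball.1 hy).le
      _ ≤ (C + 1) * (δ / (C + 1)) := by gcongr; linarith
      _ = δ := by field_simp

/-- The standard bilinear pairing on `ℝ × ℝ^m`. -/
noncomputable def pairing {m : ℕ} (z p : ℝ × (Fin m → ℝ)) : ℝ := z.1 * p.1 + z.2 ⬝ᵥ p.2

theorem pairing_add_left {m : ℕ} (z z' p : ℝ × (Fin m → ℝ)) :
    pairing (z + z') p = pairing z p + pairing z' p := by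
  simp only [pairing, Prod.fst_add, Prod.snd_add, add_dotProduct]; ring

theorem pairing_sub_left {m : ℕ} (z z' p : ℝ × (Fin m → ℝ)) :
    pairing (z - z') p = pairing z p - pairing z' p := by
  simp only [pairing, Prod.fst_sub, Prod.snd_sub, sub_dotProduct]; ring

theorem pairing_smul_left {m : ℕ} (c : ℝ) (z p : ℝ × (Fin m → ℝ)) :
    pairing (c • z) p = c * pairing z p := by
  simp only [pairing, Prod.smul_fst, Prod.smul_snd, smul_dotProduct, smul_eq_mul]; ring

theorem pairing_add_right {m : ℕ} (z p p' : ℝ × (Fin m → ℝ)) :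
    pairing z (p + p') = pairing z p + pairing z p' := by
  simp only [pairing, Prod.fst_add, Prod.snd_add, dotProduct_add]; ring

/-- The vector representing a functional on `ℝ × ℝ^m` through the standard pairing. -/
noncomputable def dualCoord (m : ℕ) :
    ((ℝ × (Fin m → ℝ)) →L[ℝ] ℝ) →L[ℝ] ℝ × (Fin m → ℝ) :=
  (ContinuousLinearMap.apply ℝ ℝ ((1, 0) : ℝ × (Fin m → ℝ))).prod
    (ContinuousLinearMap.pi fun j =>
      ContinuousLinearMap.apply ℝ ℝ ((0, Pi.single j 1) : ℝ × (Fin m → ℝ)))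

theorem pairing_dualCoord {m : ℕ} (f : (ℝ × (Fin m → ℝ)) →L[ℝ] ℝ) (z : ℝ × (Fin m → ℝ)) :
    pairing z (dualCoord m f) = f z := by
  have hz : z = z.1 • ((1, 0) : ℝ × (Fin m → ℝ)) +
      ∑ j, z.2 j • ((0, Pi.single j 1) : ℝ × (Fin m → ℝ)) := by
    refine Prod.ext ?_ ?_
    · simp [Prod.fst_sum]
    · ext k
      simp [Prod.snd_sum, Finset.sum_apply, Pi.single_apply]
  conv_rhs => rw [hz]
  rw [map_add, map_sum]
  simp_rw [map_smul]
  simp [pairing, dualCoord, dotProduct]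

theorem pairing_right_injective {m : ℕ} {p q : ℝ × (Fin m → ℝ)}
    (h : ∀ z, pairing z p = pairing z q) : p = q := by
  refine Prod.ext ?_ ?_
  · simpa [pairing] using h (1, 0)
  · ext j
    simpa [pairing] using h (0, Pi.single j 1)

/-- A basis of `ℝ × ℝ^m` indexed by `Fin (m + 1)`. -/
noncomputable def prodBasis (m : ℕ) : Module.Basis (Fin (m + 1)) ℝ (ℝ × (Fin m → ℝ)) :=
  ((Module.Basis.singleton Unit ℝ).prod (Pi.basisFun ℝ (Fin m))).reindex
    (Fintype.equivFinOfCardEq (by simp [add_comm]))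

theorem prodBasis_repr_dualCoord {m : ℕ} (f : (ℝ × (Fin m → ℝ)) →L[ℝ] ℝ) (i : Fin (m + 1)) :
    (prodBasis m).repr (dualCoord m f) i = f (prodBasis m i) := by
  obtain ⟨k, rfl⟩ := (Fintype.equivFinOfCardEq
    (by simp [add_comm] : Fintype.card (Unit ⊕ Fin m) = m + 1)).surjective i
  rcases k with k | k <;> simp [prodBasis, dualCoord]

/-- The gradient of a function on `ℝ × ℝ^m`. -/
noncomputable def grad {m : ℕ} (u : ℝ × (Fin m → ℝ) → ℝ) (z : ℝ × (Fin m → ℝ)) :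
    ℝ × (Fin m → ℝ) := dualCoord m (fderiv ℝ u z)

theorem pairing_grad {m : ℕ} (u : ℝ × (Fin m → ℝ) → ℝ) (z v : ℝ × (Fin m → ℝ)) :
    pairing v (grad u z) = fderiv ℝ u z v :=
  pairing_dualCoord _ _

/-- The Hessian matrix of a function on `ℝ × ℝ^m`. -/
noncomputable def hess {m : ℕ} (u : ℝ × (Fin m → ℝ) → ℝ) (z : ℝ × (Fin m → ℝ)) :
    Matrix (Fin (m + 1)) (Fin (m + 1)) ℝ :=
  fun i j => fderiv ℝ (fderiv ℝ u) z (prodBasis m j) (prodBasis m i)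

section Smooth

variable {m : ℕ} {u : ℝ × (Fin m → ℝ) → ℝ}

theorem hasFDerivAt_grad (hu : ContDiff ℝ 2 u) (z : ℝ × (Fin m → ℝ)) :
    HasFDerivAt (grad u) (dualCoord m ∘L fderiv ℝ (fderiv ℝ u) z) z := by
  have h1 : ContDiff ℝ 1 (fderiv ℝ u) := hu.fderiv_right (by norm_num)
  exact (dualCoord m).hasFDerivAt.comp z (h1.differentiable (by norm_num) z).hasFDerivAt

theorem continuous_grad (hu : ContDiff ℝ 2 u) : Continuous (grad u) :=
  continuous_iff_continuousAt.2 fun z => (hasFDerivAt_grad hu z).continuousAt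

theorem continuous_det_hess (hu : ContDiff ℝ 2 u) : Continuous fun z => (hess u z).det := by
  have h1 : Continuous (fderiv ℝ (fderiv ℝ u)) :=
    (hu.fderiv_right (m := 1) (by norm_num)).continuous_fderiv (by norm_num)
  refine Continuous.matrix_det (continuous_matrix fun i j => ?_)
  exact (h1.clm_apply continuous_const).clm_apply continuous_const

theorem det_fderiv_grad (u : ℝ × (Fin m → ℝ) → ℝ) (z : ℝ × (Fin m → ℝ)) :
    (dualCoord m ∘L fderiv ℝ (fderiv ℝ u) z).det = (hess u z).det := by
  rw [ContinuousLinearMap.det, ← LinearMap.det_toMatrix (prodBasis m)]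
  congr 1
  ext i j
  rw [LinearMap.toMatrix_apply]
  exact prodBasis_repr_dualCoord _ _

/-- Along a line, a differentiable convex function lies above its tangents. -/
theorem ConvexOn.add_fderiv_le {E : Type*} [NormedAddCommGroup E] [NormedSpace ℝ E] {u : E → ℝ}
    (hc : ConvexOn ℝ Set.univ u) {z : E} (hu : DifferentiableAt ℝ u z) (z' : E) :
    u z + fderiv ℝ u z (z' - z) ≤ u z' := by
  have hconv : ConvexOn ℝ Set.univ (fun t : ℝ => u (z + t • (z' - z))) := by
    have := hc.comp_affineMap (AffineMap.lineMap z z' : ℝ →ᵃ[ℝ] E)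
    refine (this.subset (Set.subset_univ _) convex_univ).congr fun t _ => ?_
    simp [AffineMap.lineMap_apply, add_comm]
  have hder : HasDerivAt (fun t : ℝ => u (z + t • (z' - z))) (fderiv ℝ u z (z' - z)) 0 := by
    have hline : HasDerivAt (fun t : ℝ => z + t • (z' - z)) (z' - z) 0 := by
      simpa using ((hasDerivAt_id (0 : ℝ)).smul_const (z' - z)).const_add z
    have hu' : HasFDerivAt u (fderiv ℝ u z) (z + (0 : ℝ) • (z' - z)) := by
      simpa using hu.hasFDerivAt
    exact hu'.comp_hasDerivAt 0 hline
  have := hconv.le_slope_of_hasDerivAt (Set.mem_univ 0) (Set.mem_univ 1) one_pos hder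
  simp only [slope_def_field, one_smul, add_sub_cancel, zero_smul, add_zero, sub_zero,
    div_one] at this
  linarith

theorem grad_eq_iff (hu : Differentiable ℝ u) (hc : ConvexOn ℝ Set.univ u)
    {z p : ℝ × (Fin m → ℝ)} : grad u z = p ↔ ∀ z', u z + pairing (z' - z) p ≤ u z' := by
  refine ⟨?_, fun h => pairing_right_injective fun v => ?_⟩
  · rintro rfl z'
    rw [pairing_grad]
    exact hc.add_fderiv_le (hu z) z'
  · rw [pairing_grad]
    have hline : HasDerivAt (fun t : ℝ => z + t • v) v 0 := by
      simpa using ((hasDerivAt_id (0 : ℝ)).smul_const v).const_add z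
    have hu' : HasFDerivAt u (fderiv ℝ u z) (z + (0 : ℝ) • v) := by
      simpa using (hu z).hasFDerivAt
    have hder : HasDerivAt (fun t : ℝ => u (z + t • v) - t * pairing v p)
        (fderiv ℝ u z v - pairing v p) 0 := by
      have h0 := (hu'.comp_hasDerivAt 0 hline).sub ((hasDerivAt_id (0 : ℝ)).mul_const (pairing v p))
      rwa [one_mul] at h0
    have hmin : IsLocalMin (fun t : ℝ => u (z + t • v) - t * pairing v p) 0 := by
      refine Filter.Eventually.of_forall fun t => ?_
      have := h (z + t • v)
      rw [add_sub_cancel_left, pairing_smul_left] at this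
      simp
      linarith
    linarith [hmin.hasDerivAt_eq_zero hder]

theorem det_hess_eq_zero_of_grad_eq (hu : ContDiff ℝ 2 u) (hc : ConvexOn ℝ Set.univ u)
    {z z' : ℝ × (Fin m → ℝ)} (hne : z ≠ z') (h : grad u z = grad u z') :
    (hess u z).det = 0 := by
  have hd : Differentiable ℝ u := hu.differentiable (by norm_num)
  have hz := (grad_eq_iff hd hc).1 h
  have hz' := (grad_eq_iff hd hc (z := z') (p := grad u z')).1 rfl
  set p := grad u z'
  have hseg : ∀ t ∈ Set.Icc (0 : ℝ) 1, grad u (z + t • (z' - z)) = p := by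
    intro t ht
    rw [grad_eq_iff hd hc]
    intro y
    have h1 := hc.2 (Set.mem_univ z) (Set.mem_univ z') (sub_nonneg.2 ht.2) ht.1 (by ring)
    have h2 : (1 - t) • z + t • z' = z + t • (z' - z) := by module
    rw [h2, smul_eq_mul, smul_eq_mul] at h1
    have h3 := hz y
    have h4 := hz' z
    have h5 : y - (z + t • (z' - z)) = (y - z) - t • (z' - z) := by module
    rw [h5, pairing_sub_left, pairing_smul_left]
    have h6 : pairing (z - z') p = - pairing (z' - z) p := by
      rw [pairing_sub_left, pairing_sub_left]; ring
    rw [h6] at h4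
    nlinarith [ht.1, ht.2, mul_le_mul_of_nonneg_left h4 ht.1]
  have hzero : (dualCoord m ∘L fderiv ℝ (fderiv ℝ u) z) (z' - z) = 0 := by
    have hline : HasDerivWithinAt (fun t : ℝ => z + t • (z' - z)) (z' - z) (Set.Icc 0 1) 0 := by
      simpa using (((hasDerivAt_id (0 : ℝ)).smul_const (z' - z)).const_add z).hasDerivWithinAt
    have hg : HasFDerivAt (grad u) (dualCoord m ∘L fderiv ℝ (fderiv ℝ u) z)
        (z + (0 : ℝ) • (z' - z)) := by
      simpa using hasFDerivAt_grad hu z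
    have h1 := hg.comp_hasDerivWithinAt 0 hline
    have h2 : HasDerivWithinAt (fun t : ℝ => grad u (z + t • (z' - z))) 0 (Set.Icc 0 1) 0 :=
      (hasDerivWithinAt_const (0 : ℝ) (Set.Icc 0 1) p).congr hseg (hseg 0 (by simp))
    exact ((uniqueDiffOn_Icc one_pos) 0 (by simp)).eq_deriv _ h1 h2
  rw [← det_fderiv_grad]
  by_contra hdet
  have hker := LinearMap.ker_eq_bot'.1 ((LinearMap.isUnit_iff_ker_eq_bot _).1
    ((LinearMap.isUnit_iff_isUnit_det _).2 (isUnit_iff_ne_zero.2 hdet))) _ hzero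
  exact hne (sub_eq_zero.1 hker).symm

theorem volume_grad_image (hu : ContDiff ℝ 2 u) (hc : ConvexOn ℝ Set.univ u)
    {A : Set (ℝ × (Fin m → ℝ))} (hA : MeasurableSet A) :
    volume (grad u '' A) = ∫⁻ z in A, ENNReal.ofReal |(hess u z).det| := by
  have : (volume : Measure (ℝ × (Fin m → ℝ))).IsAddHaarMeasure :=
    inferInstanceAs ((volume : Measure ℝ).prod (volume : Measure (Fin m → ℝ))).IsAddHaarMeasure
  set N : Set (ℝ × (Fin m → ℝ)) := {z | (hess u z).det = 0}
  have hN : MeasurableSet N := (isClosed_eq (continuous_det_hess hu) continuous_const).measurableSet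
  have hnull : volume (grad u '' (A ∩ N)) = 0 :=
    addHaar_image_eq_zero_of_det_fderivWithin_eq_zero volume
      (fun z _ => (hasFDerivAt_grad hu z).hasFDerivWithinAt)
      (fun z hz => (det_fderiv_grad u z).trans hz.2)
  have hmain : ∫⁻ z in A \ N, ENNReal.ofReal |(hess u z).det| = volume (grad u '' (A \ N)) := by
    rw [← lintegral_abs_det_fderiv_eq_addHaar_image volume (hA.diff hN)
      (fun z _ => (hasFDerivAt_grad hu z).hasFDerivWithinAt)]
    · simp_rw [det_fderiv_grad]
    · intro z hz z' _ h
      by_contra hne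
      exact hz.2 (det_hess_eq_zero_of_grad_eq hu hc hne h)
  have hzero : ∫⁻ z in A ∩ N, ENNReal.ofReal |(hess u z).det| = 0 := by
    rw [setLIntegral_congr_fun (hA.inter hN) (g := fun _ => 0)
      (fun z hz => by simp [show (hess u z).det = 0 from hz.2])]
    simp
  rw [← lintegral_inter_add_sdiff _ A hN, hzero, zero_add, hmain]
  refine le_antisymm ?_ (measure_mono (Set.image_mono Set.sdiff_subset))
  conv_lhs => rw [← Set.inter_union_sdiff A N, Set.image_union]
  exact (measure_union_le _ _).trans (by rw [hnull, zero_add])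

theorem hess_posSemidef (hu : ContDiff ℝ 2 u) (hc : ConvexOn ℝ Set.univ u)
    (z : ℝ × (Fin m → ℝ)) : (hess u z).PosSemidef := by
  have hd : Differentiable ℝ u := hu.differentiable (by norm_num)
  have hd2 : Differentiable ℝ (fderiv ℝ u) :=
    (hu.fderiv_right (m := 1) (by norm_num)).differentiable (by norm_num)
  have hnonneg (v : ℝ × (Fin m → ℝ)) : 0 ≤ fderiv ℝ (fderiv ℝ u) z v v := by
    have hder : HasDerivAt (fun t : ℝ => fderiv ℝ u (z + t • v) v)
        (fderiv ℝ (fderiv ℝ u) z v v) 0 := by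
      have hline : HasDerivAt (fun t : ℝ => z + t • v) v 0 := by
        simpa using ((hasDerivAt_id (0 : ℝ)).smul_const v).const_add z
      have hu' : HasFDerivAt (fderiv ℝ u) (fderiv ℝ (fderiv ℝ u) z) (z + (0 : ℝ) • v) := by
        simpa using (hd2 z).hasFDerivAt
      exact ((ContinuousLinearMap.apply ℝ ℝ v).hasFDerivAt).comp_hasDerivAt 0
        (hu'.comp_hasDerivAt 0 hline)
    have hmono : Monotone fun t : ℝ => fderiv ℝ u (z + t • v) v := by
      intro s t hst
      rcases hst.eq_or_lt with rfl | hlt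
      · exact le_rfl
      have h1 := hc.add_fderiv_le (hd (z + s • v)) (z + t • v)
      have h2 := hc.add_fderiv_le (hd (z + t • v)) (z + s • v)
      rw [show z + t • v - (z + s • v) = (t - s) • v by module, map_smul, smul_eq_mul] at h1
      rw [show z + s • v - (z + t • v) = -((t - s) • v) by module, map_neg, map_smul,
        smul_eq_mul] at h2
      have h3 : (t - s) * fderiv ℝ u (z + s • v) v ≤ (t - s) * fderiv ℝ u (z + t • v) v := by
        linarith
      exact le_of_mul_le_mul_left h3 (sub_pos.2 hlt)
    rw [← hder.deriv]
    exact hmono.deriv_nonneg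
  have hsymm : IsSymmSndFDerivAt ℝ u z := hu.contDiffAt.isSymmSndFDerivAt (by simp)
  refine Matrix.PosSemidef.of_dotProduct_mulVec_nonneg ?_ fun x => ?_
  · ext i j
    simpa [hess, Matrix.conjTranspose_apply] using hsymm.eq _ _
  · refine (hnonneg (∑ i, x i • prodBasis m i)).trans_eq ?_
    simp only [map_sum, map_smul, sum_apply, smul_apply,
      smul_eq_mul, dotProduct, Matrix.mulVec, hess, star_trivial, Finset.mul_sum]
    refine Finset.sum_congr rfl fun i _ => Finset.sum_congr rfl fun j _ => ?_
    rw [hsymm.eq]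
    ring

end Smooth

theorem pairing_comm {m : ℕ} (z p : ℝ × (Fin m → ℝ)) : pairing z p = pairing p z := by
  rw [pairing, pairing, mul_comm, dotProduct_comm]

theorem pairing_mk {m : ℕ} (s w : ℝ) (β a : Fin m → ℝ) :
    pairing (s, β) (w, a) = s * w + β ⬝ᵥ a := rfl

/-- `u` is within `C` of the function `z ↦ max_{q ∈ D} (q.1 + ⟨z, q.2⟩)`. -/
def IsSupportApprox {m : ℕ} (D : Set (ℝ × (ℝ × (Fin m → ℝ)))) (C : ℝ)
    (u : ℝ × (Fin m → ℝ) → ℝ) : Prop :=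
  ∀ z, (∀ q ∈ D, q.1 + pairing z q.2 ≤ u z + C) ∧ ∃ q ∈ D, u z ≤ q.1 + pairing z q.2 + C

/-- The projection to the last factor. -/
def baseOf {m : ℕ} (D : Set (ℝ × (ℝ × (Fin m → ℝ)))) : Set (Fin m → ℝ) :=
  (LinearMap.snd ℝ ℝ (Fin m → ℝ) ∘ₗ LinearMap.snd ℝ ℝ (ℝ × (Fin m → ℝ))) '' D

/-- The linear map `(x, w, a) ↦ (x + s w, a)`. -/
noncomputable def shear (m : ℕ) (s : ℝ) : (ℝ × (ℝ × (Fin m → ℝ))) →ₗ[ℝ] ℝ × (Fin m → ℝ) :=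
  (LinearMap.fst ℝ ℝ _ + s • (LinearMap.fst ℝ ℝ _ ∘ₗ LinearMap.snd ℝ ℝ _)).prod
    (LinearMap.snd ℝ ℝ (Fin m → ℝ) ∘ₗ LinearMap.snd ℝ ℝ (ℝ × (Fin m → ℝ)))

theorem shear_apply {m : ℕ} (s : ℝ) (q : ℝ × (ℝ × (Fin m → ℝ))) :
    shear m s q = (q.1 + s * q.2.1, q.2.2) := rfl

theorem snd_image_shear {m : ℕ} (s : ℝ) (D : Set (ℝ × (ℝ × (Fin m → ℝ)))) :
    Prod.snd '' (shear m s '' D) = baseOf D := by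
  rw [Set.image_image]; rfl

section Subgradient

variable {m : ℕ} {u : ℝ × (Fin m → ℝ) → ℝ}

/-- A lower bound on the increments of `u` along a ray bounds the directional derivative. -/
theorem le_pairing_grad (hu : Differentiable ℝ u) {z v : ℝ × (Fin m → ℝ)} {c δ : ℝ} (hδ : 0 < δ)
    (h : ∀ t, 0 < t → t ≤ δ → u z + t * c ≤ u (z + t • v)) : c ≤ pairing v (grad u z) := by
  have hline : HasDerivAt (fun t : ℝ => z + t • v) v 0 := by
    simpa using ((hasDerivAt_id (0 : ℝ)).smul_const v).const_add z
  have hu' : HasFDerivAt u (fderiv ℝ u z) (z + (0 : ℝ) • v) := by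
    simpa using (hu z).hasFDerivAt
  rw [pairing_grad]
  refine ge_of_tendsto (hu'.comp_hasDerivAt 0 hline).tendsto_slope_zero_right ?_
  filter_upwards [Ioc_mem_nhdsGT hδ] with t ht
  have := h t ht.1 ht.2
  simp only [Function.comp_apply, zero_add, zero_smul, add_zero, smul_eq_mul]
  rw [inv_mul_eq_div, le_div_iff₀ ht.1]
  linarith

theorem grad_snd_eq_of_forall_le (hu : Differentiable ℝ u) {s : ℝ} {β a : Fin m → ℝ}
    (h : ∀ β', u (s, β) - β ⬝ᵥ a ≤ u (s, β') - β' ⬝ᵥ a) : (grad u (s, β)).2 = a := by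
  have key (v : Fin m → ℝ) : v ⬝ᵥ a ≤ v ⬝ᵥ (grad u (s, β)).2 := by
    have := le_pairing_grad (v := (0, v)) (z := (s, β)) (c := v ⬝ᵥ a) hu one_pos fun t _ _ => by
      have := h (β + t • v)
      rw [add_dotProduct, smul_dotProduct, smul_eq_mul] at this
      simp only [Prod.smul_mk, smul_zero, Prod.mk_add_mk, add_zero]
      linarith
    simpa [pairing] using this
  ext j
  refine le_antisymm ?_ ?_
  · simpa using key (-Pi.single j 1)
  · simpa using key (Pi.single j 1)

theorem grad_eq_of_grad_eq_of_fst_eq (hu : Differentiable ℝ u) (hc : ConvexOn ℝ Set.univ u)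
    {s w w' : ℝ} {β β' a : Fin m → ℝ} (h : grad u (s, β) = (w, a))
    (h' : grad u (s, β') = (w', a)) : w = w' := by
  have h1 := (grad_eq_iff hu hc).1 h
  have h2 := (grad_eq_iff hu hc).1 h'
  have h3 := h2 (s, β)
  simp only [pairing_sub_left, pairing_mk] at h1 h3
  have h4 : grad u (s, β') = (w, a) := by
    rw [grad_eq_iff hu hc]
    intro z'
    have := h1 z'
    simp only [pairing_sub_left, pairing_mk]
    linarith
  exact congrArg Prod.fst (h4.symm.trans h')

theorem grad_fst_mono (hu : Differentiable ℝ u) (hc : ConvexOn ℝ Set.univ u)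
    {s s' w w' : ℝ} {β β' a : Fin m → ℝ} (h : grad u (s, β) = (w, a))
    (h' : grad u (s', β') = (w', a)) (hs : s ≤ s') : w ≤ w' := by
  rcases hs.eq_or_lt with rfl | hlt
  · exact (grad_eq_of_grad_eq_of_fst_eq hu hc h h').le
  have h1 := (grad_eq_iff hu hc).1 h (s', β')
  have h2 := (grad_eq_iff hu hc).1 h' (s, β)
  simp only [pairing_sub_left, pairing_mk] at h1 h2
  have h3 : (s' - s) * w ≤ (s' - s) * w' := by linarith
  exact le_of_mul_le_mul_left h3 (sub_pos.2 hlt)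

variable {D : Set (ℝ × (ℝ × (Fin m → ℝ)))} {C : ℝ}

theorem grad_mem_image_snd (hu : Differentiable ℝ u) (hc : ConvexOn ℝ Set.univ u)
    (hD : Convex ℝ D) (hDc : IsCompact D) (ha : IsSupportApprox D C u)
    (z : ℝ × (Fin m → ℝ)) : grad u z ∈ LinearMap.snd ℝ ℝ (ℝ × (Fin m → ℝ)) '' D := by
  by_contra hz
  obtain ⟨f, c, hfc, hcf⟩ := geometric_hahn_banach_closed_point (hD.linear_image _)
    (hDc.image (LinearMap.snd ℝ ℝ (ℝ × (Fin m → ℝ))).continuous_of_finiteDimensional).isClosed hz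
  have hf (p : ℝ × (Fin m → ℝ)) : pairing (dualCoord m f) p = f p := by
    rw [pairing_comm, pairing_dualCoord]
  obtain ⟨A, hA⟩ : ∃ A, ∀ q ∈ D, q.1 + pairing z q.2 ≤ A := by
    have hcont : Continuous fun q : ℝ × (ℝ × (Fin m → ℝ)) => q.1 + pairing z q.2 := by
      unfold pairing dotProduct
      fun_prop
    obtain ⟨A, hA⟩ := hDc.bddAbove_image hcont.continuousOn
    exact ⟨A, fun q hq => hA (Set.mem_image_of_mem _ hq)⟩
  have key (t : ℝ) (ht : 0 ≤ t) : t * (f (grad u z) - c) ≤ A + C - u z := by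
    obtain ⟨q, hq, hq'⟩ := (ha (z + t • dualCoord m f)).2
    have h1 := (grad_eq_iff hu hc (z := z)).1 rfl (z + t • dualCoord m f)
    rw [add_sub_cancel_left, pairing_smul_left, hf] at h1
    rw [pairing_add_left, pairing_smul_left, hf] at hq'
    have h2 := mul_le_mul_of_nonneg_left (hfc q.2 ⟨q, hq, rfl⟩).le ht
    have h3 := hA q hq
    linarith
  have hpos : 0 < f (grad u z) - c := sub_pos.2 hcf
  have h1 := key ((|A + C - u z| + 1) / (f (grad u z) - c)) (by positivity)
  rw [div_mul_cancel₀ _ hpos.ne'] at h1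
  linarith [le_abs_self (A + C - u z)]

theorem exists_isMin_on_strip (hu : Continuous u) (hDc : IsCompact D)
    (ha : IsSupportApprox D C u) {a : Fin m → ℝ} (hint : a ∈ interior (baseOf D)) (w : ℝ)
    {s₁ s₂ : ℝ} (hs : s₁ ≤ s₂) : ∃ s ∈ Set.Icc s₁ s₂, ∃ β, ∀ s' ∈ Set.Icc s₁ s₂, ∀ β',
      u (s, β) - pairing (s, β) (w, a) ≤ u (s', β') - pairing (s', β') (w, a) := by
  obtain ⟨r, hr, hball⟩ := Metric.nhds_basis_closedBall.mem_iff.1 (mem_interior_iff_mem_nhds.1 hint)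
  obtain ⟨R, hR⟩ := hDc.isBounded.exists_norm_le
  have hR0 : ∀ q ∈ D, |q.1| ≤ R ∧ |q.2.1| ≤ R := fun q hq =>
    ⟨(norm_fst_le q).trans (hR q hq), ((norm_fst_le q.2).trans (norm_snd_le q)).trans (hR q hq)⟩
  obtain ⟨M, hM⟩ : ∃ M, ∀ s ∈ Set.Icc s₁ s₂, ∀ β,
      r * ‖β‖ - M ≤ u (s, β) - pairing (s, β) (w, a) := by
    set S := max |s₁| |s₂|
    refine ⟨R + S * R + S * |w| + C, fun s hs β => ?_⟩
    have hsS : |s| ≤ S := abs_le_max_abs_abs hs.1 hs.2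
    have hmem : a + r • (fun j => (SignType.sign (β j) : ℝ)) ∈ baseOf D := by
      refine hball ?_
      rw [mem_closedBall_iff_norm, add_sub_cancel_left, norm_smul, Real.norm_of_nonneg hr.le]
      refine mul_le_of_le_one_right hr.le ((pi_norm_le_iff_of_nonneg zero_le_one).2 fun j => ?_)
      rcases lt_trichotomy (β j) 0 with h | h | h <;> simp [h]
    obtain ⟨q, hq, hqa⟩ := hmem
    have hqa' : q.2.2 = a + r • (fun j => (SignType.sign (β j) : ℝ)) := hqa
    have h1 := (ha (s, β)).1 q hq
    obtain ⟨h2, h3⟩ := hR0 q hq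
    have h4 : pairing (s, β) q.2 = s * q.2.1 + (β ⬝ᵥ a + r * ∑ j, |β j|) := by
      rw [pairing, hqa', dotProduct_add, dotProduct_smul, smul_eq_mul]
      simp [dotProduct, self_mul_sign]
    have h5 : ‖β‖ ≤ ∑ j, |β j| := by
      refine (pi_norm_le_iff_of_nonneg (Finset.sum_nonneg fun j _ => abs_nonneg _)).2 fun j => ?_
      exact Finset.single_le_sum (f := fun j => |β j|) (fun j _ => abs_nonneg _)
        (Finset.mem_univ j)
    have h6 : |s * q.2.1| ≤ S * R := by
      rw [abs_mul]
      exact mul_le_mul hsS h3 (abs_nonneg _) ((abs_nonneg _).trans hsS)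
    have h7 : |s * w| ≤ S * |w| := by
      rw [abs_mul]
      exact mul_le_mul_of_nonneg_right hsS (abs_nonneg _)
    have h8 := mul_le_mul_of_nonneg_left h5 hr.le
    rw [pairing_mk]
    linarith [neg_abs_le q.1, neg_abs_le (s * q.2.1), le_abs_self (s * w)]
  set val : ℝ × (Fin m → ℝ) → ℝ := fun z => u z - pairing z (w, a)
  have hval : Continuous val := by
    refine hu.sub ?_
    unfold pairing dotProduct
    fun_prop
  set ρ := max 0 ((val (s₁, 0) + M) / r)
  obtain ⟨z, hz, hmin⟩ := (isCompact_Icc.prod (isCompact_closedBall (0 : Fin m → ℝ) ρ)).exists_isMinOn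
    (s := Set.Icc s₁ s₂ ×ˢ Metric.closedBall 0 ρ)
    ⟨(s₁, 0), Set.left_mem_Icc.2 hs, by simp [ρ]⟩ hval.continuousOn
  refine ⟨z.1, hz.1, z.2, fun s' hs' β' => ?_⟩
  by_cases hβ : ‖β'‖ ≤ ρ
  · exact isMinOn_iff.1 hmin (s', β') ⟨hs', by simpa using hβ⟩
  · have h1 := isMinOn_iff.1 hmin (s₁, 0) ⟨Set.left_mem_Icc.2 hs, by simp [ρ]⟩
    have h2 := hM s' hs' β'
    have h3 : (val (s₁, 0) + M) / r ≤ ‖β'‖ := (le_max_right _ _).trans (not_le.1 hβ).le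
    rw [div_le_iff₀ hr] at h3
    have h4 : val z = u (z.1, z.2) - pairing (z.1, z.2) (w, a) := rfl
    linarith

theorem exists_grad_eq (hu : Differentiable ℝ u) (hDc : IsCompact D)
    (ha : IsSupportApprox D C u) {a : Fin m → ℝ} (hint : a ∈ interior (baseOf D)) (s : ℝ) :
    ∃ w β, grad u (s, β) = (w, a) := by
  obtain ⟨s', hs', β, hβ⟩ := exists_isMin_on_strip hu.continuous hDc ha hint 0 (le_refl s)
  obtain rfl : s' = s := by simpa using hs'
  refine ⟨(grad u (s', β)).1, β, Prod.ext rfl (grad_snd_eq_of_forall_le hu fun β' => ?_)⟩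
  simpa [pairing] using hβ s' (by simp) β'

theorem grad_strip_slice (hu : Differentiable ℝ u) (hc : ConvexOn ℝ Set.univ u)
    (hDc : IsCompact D) (ha : IsSupportApprox D C u) {a : Fin m → ℝ}
    (hint : a ∈ interior (baseOf D)) {s₁ s₂ w₁ w₂ : ℝ} {β₁ β₂ : Fin m → ℝ} (hs : s₁ ≤ s₂)
    (h₁ : grad u (s₁, β₁) = (w₁, a)) (h₂ : grad u (s₂, β₂) = (w₂, a)) :
    {w | (w, a) ∈ grad u '' (Set.Icc s₁ s₂ ×ˢ Set.univ)} = Set.Icc w₁ w₂ := by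
  ext w
  constructor
  · rintro ⟨⟨s, β⟩, ⟨hs', -⟩, h⟩
    exact ⟨grad_fst_mono hu hc h₁ h hs'.1, grad_fst_mono hu hc h h₂ hs'.2⟩
  · rintro ⟨hw₁, hw₂⟩
    obtain ⟨s, hs', β, hβ⟩ := exists_isMin_on_strip hu.continuous hDc ha hint w hs
    have hsnd : (grad u (s, β)).2 = a := grad_snd_eq_of_forall_le hu fun β' => by
      have := hβ s hs' β'
      rw [pairing_mk, pairing_mk] at this
      linarith
    set w' := (grad u (s, β)).1
    have hgrad : grad u (s, β) = (w', a) := Prod.ext rfl hsnd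
    have hle : w ≤ w' := by
      rcases hs'.2.eq_or_lt with rfl | hlt
      · exact hw₂.trans (grad_eq_of_grad_eq_of_fst_eq hu hc h₂ hgrad).le
      · have := le_pairing_grad (v := (1, 0)) (z := (s, β)) (c := w) hu (sub_pos.2 hlt)
          fun t ht0 ht => by
            have := hβ (s + t) ⟨by linarith [hs'.1], by linarith⟩ β
            rw [pairing_mk, pairing_mk] at this
            simp only [Prod.smul_mk, smul_eq_mul, mul_one, smul_zero, Prod.mk_add_mk, add_zero]
            linarith
        simpa [pairing] using this
    have hge : w' ≤ w := by
      rcases hs'.1.eq_or_lt with rfl | hlt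
      · exact (grad_eq_of_grad_eq_of_fst_eq hu hc hgrad h₁).le.trans hw₁
      · have := le_pairing_grad (v := (-1, 0)) (z := (s, β)) (c := -w) hu (sub_pos.2 hlt)
          fun t ht0 ht => by
            have := hβ (s - t) ⟨by linarith, by linarith [hs'.2]⟩ β
            rw [pairing_mk, pairing_mk] at this
            simp only [Prod.smul_mk, smul_eq_mul, mul_neg, mul_one, smul_zero, Prod.mk_add_mk,
              add_zero, ← sub_eq_add_neg]
            linarith
        simp only [pairing, zero_dotProduct, add_zero, neg_mul, one_mul, neg_le_neg_iff] at this
        exact this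
    exact ⟨(s, β), ⟨hs', Set.mem_univ _⟩, by rw [hgrad, le_antisymm hle hge]⟩

end Subgradient

section Shadow

variable {m : ℕ} {K : Set (ℝ × (Fin m → ℝ))}

theorem sSup_fiber_mem (hK : IsCompact K) {a : Fin m → ℝ} (ha : a ∈ Prod.snd '' K) :
    (sSup {t : ℝ | (t, a) ∈ K}, a) ∈ K := by
  have hcl : IsClosed {t : ℝ | (t, a) ∈ K} := hK.isClosed.preimage (by fun_prop)
  obtain ⟨⟨t, b⟩, ht, rfl⟩ := ha
  refine hcl.csSup_mem ⟨t, ht⟩ ((hK.image continuous_fst).bddAbove.mono ?_)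
  exact fun x hx => ⟨_, hx, rfl⟩

theorem le_sSup_fiber (hK : IsCompact K) {a : Fin m → ℝ} {t : ℝ} (ht : (t, a) ∈ K) :
    t ≤ sSup {t : ℝ | (t, a) ∈ K} := by
  refine le_csSup ((hK.image continuous_fst).bddAbove.mono ?_) ht
  exact fun x hx => ⟨_, hx, rfl⟩

theorem concaveOn_sSup_fiber (hK : IsCompact K) (hKc : Convex ℝ K) :
    ConcaveOn ℝ (Prod.snd '' K) fun a => sSup {t : ℝ | (t, a) ∈ K} :=
  ⟨hKc.linear_image (LinearMap.snd ℝ ℝ (Fin m → ℝ)), fun _ ha _ hb _ _ hs ht hst =>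
    le_sSup_fiber hK (hKc (sSup_fiber_mem hK ha) (sSup_fiber_mem hK hb) hs ht hst)⟩

theorem setIntegral_interior_eq_of_convex {B : Set (Fin m → ℝ)} (hB : Convex ℝ B)
    (f : (Fin m → ℝ) → ℝ) : ∫ a in interior B, f a = ∫ a in B, f a := by
  refine setIntegral_congr_set ?_
  exact interior_ae_eq_of_null_frontier (hB.addHaar_frontier volume)

theorem shadowVolume_eq_setIntegral_interior (hKc : Convex ℝ K) :
    shadowVolume m K = ∫ a in interior (Prod.snd '' K), sSup {t : ℝ | (t, a) ∈ K} :=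
  (setIntegral_interior_eq_of_convex (hKc.linear_image (LinearMap.snd ℝ ℝ (Fin m → ℝ))) _).symm

theorem integrableOn_interior_sSup_fiber (hK : IsCompact K) (hKc : Convex ℝ K) :
    IntegrableOn (fun a => sSup {t : ℝ | (t, a) ∈ K}) (interior (Prod.snd '' K)) := by
  obtain ⟨R, hR⟩ := hK.isBounded.exists_norm_le
  have hcont := (concaveOn_sSup_fiber hK hKc).continuousOn_interior
  have : IsFiniteMeasure (volume.restrict (interior (Prod.snd '' K))) := isFiniteMeasure_restrict.2
    ((measure_mono interior_subset).trans_lt (hK.image continuous_snd).measure_lt_top).ne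
  refine Integrable.of_bound (hcont.aestronglyMeasurable isOpen_interior.measurableSet) R ?_
  filter_upwards [ae_restrict_mem isOpen_interior.measurableSet] with a ha
  exact (norm_fst_le _).trans (hR _ (sSup_fiber_mem hK (interior_subset ha)))

end Shadow

/-- The Legendre-type transform of `u` in the second variable. -/
noncomputable def partialConj {m : ℕ} (u : ℝ × (Fin m → ℝ) → ℝ) (s : ℝ) (a : Fin m → ℝ) : ℝ :=
  ⨅ β, (u (s, β) - β ⬝ᵥ a)

section PartialConj

variable {m : ℕ} {u : ℝ × (Fin m → ℝ) → ℝ} {s w : ℝ} {β a : Fin m → ℝ}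

theorem sub_dotProduct_add_le_of_grad_eq (hu : Differentiable ℝ u) (hc : ConvexOn ℝ Set.univ u)
    (h : grad u (s, β) = (w, a)) (s' : ℝ) (β' : Fin m → ℝ) :
    u (s, β) - β ⬝ᵥ a + w * (s' - s) ≤ u (s', β') - β' ⬝ᵥ a := by
  have := (grad_eq_iff hu hc).1 h (s', β')
  rw [pairing_sub_left, pairing_mk, pairing_mk] at this
  linarith

theorem partialConj_eq (hu : Differentiable ℝ u) (hc : ConvexOn ℝ Set.univ u)
    (h : grad u (s, β) = (w, a)) : partialConj u s a = u (s, β) - β ⬝ᵥ a := by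
  refine IsLeast.csInf_eq ⟨⟨β, rfl⟩, ?_⟩
  rintro _ ⟨β', rfl⟩
  simpa using sub_dotProduct_add_le_of_grad_eq hu hc h s β'

theorem partialConj_add_le (hu : Differentiable ℝ u) (hc : ConvexOn ℝ Set.univ u)
    (h : grad u (s, β) = (w, a)) (s' : ℝ) :
    partialConj u s a + w * (s' - s) ≤ partialConj u s' a := by
  rw [partialConj_eq hu hc h]
  exact le_ciInf fun β' => sub_dotProduct_add_le_of_grad_eq hu hc h s' β'

theorem partialConj_le (hu : Differentiable ℝ u) (hc : ConvexOn ℝ Set.univ u)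
    (h : grad u (s, β) = (w, a)) (s' : ℝ) (β' : Fin m → ℝ) :
    partialConj u s' a ≤ u (s', β') - β' ⬝ᵥ a := by
  refine ciInf_le ⟨u (s, β) - β ⬝ᵥ a + w * (s' - s), ?_⟩ β'
  rintro _ ⟨β', rfl⟩
  exact sub_dotProduct_add_le_of_grad_eq hu hc h s' β'

theorem hasDerivAt_partialConj (hu : Differentiable ℝ u) (hc : ConvexOn ℝ Set.univ u)
    (h : grad u (s, β) = (w, a)) : HasDerivAt (fun s' => partialConj u s' a) w s := by
  have hupper : HasDerivAt (fun s' => u (s', β) - β ⬝ᵥ a) w s := by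
    have hline : HasDerivAt (fun s' : ℝ => (s', β)) ((1 : ℝ), (0 : Fin m → ℝ)) s :=
      (hasDerivAt_id s).prodMk (hasDerivAt_const s β)
    have := ((hu (s, β)).hasFDerivAt.comp_hasDerivAt s hline).sub_const (β ⬝ᵥ a)
    rw [← pairing_grad, h] at this
    simpa [pairing] using this
  rw [hasDerivAt_iff_isLittleO] at hupper ⊢
  refine (Asymptotics.IsBigO.of_bound' (Filter.Eventually.of_forall fun s' => ?_)).trans_isLittleO
    hupper
  have h1 := partialConj_add_le hu hc h s'
  have h2 := partialConj_le hu hc h s' β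
  rw [partialConj_eq hu hc h] at h1 ⊢
  rw [smul_eq_mul, mul_comm, Real.norm_of_nonneg (by linarith), Real.norm_of_nonneg (by linarith)]
  linarith

variable {D : Set (ℝ × (ℝ × (Fin m → ℝ)))} {C : ℝ}

theorem concaveOn_partialConj (hu : Differentiable ℝ u) (hc : ConvexOn ℝ Set.univ u)
    (hD : Convex ℝ D) (hDc : IsCompact D) (ha : IsSupportApprox D C u) (s : ℝ) :
    ConcaveOn ℝ (interior (baseOf D)) (partialConj u s) := by
  have hconv : Convex ℝ (interior (baseOf D)) := (hD.linear_image _).interior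
  refine ⟨hconv, fun a₁ h₁ a₂ h₂ t₁ t₂ ht₁ ht₂ ht => ?_⟩
  obtain ⟨w, β, h⟩ := exists_grad_eq hu hDc ha (hconv h₁ h₂ ht₁ ht₂ ht) s
  obtain ⟨w₁, β₁, h₁⟩ := exists_grad_eq hu hDc ha h₁ s
  obtain ⟨w₂, β₂, h₂⟩ := exists_grad_eq hu hDc ha h₂ s
  rw [partialConj_eq hu hc h]
  have e₁ := mul_le_mul_of_nonneg_left (partialConj_le hu hc h₁ s β) ht₁
  have e₂ := mul_le_mul_of_nonneg_left (partialConj_le hu hc h₂ s β) ht₂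
  simp only [smul_eq_mul, dotProduct_add, dotProduct_smul]
  have e₃ : u (s, β) = t₁ * u (s, β) + t₂ * u (s, β) := by rw [← add_mul, ht, one_mul]
  linarith

theorem abs_partialConj_sub_le (hu : Differentiable ℝ u) (hc : ConvexOn ℝ Set.univ u)
    (hD : Convex ℝ D) (hDc : IsCompact D) (ha : IsSupportApprox D C u)
    (hint : a ∈ interior (baseOf D)) (s : ℝ) :
    |partialConj u s a - sSup {t : ℝ | (t, a) ∈ shear m s '' D}| ≤ C := by
  obtain ⟨w, β, h⟩ := exists_grad_eq hu hDc ha hint s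
  have hK : IsCompact (shear m s '' D) := hDc.image (shear m s).continuous_of_finiteDimensional
  have hmem := sSup_fiber_mem hK (a := a) (by
    rw [snd_image_shear]
    exact interior_subset hint)
  set φ := sSup {t : ℝ | (t, a) ∈ shear m s '' D}
  rw [abs_sub_le_iff]
  constructor
  · refine le_of_forall_pos_le_add fun ε hε => ?_
    have hnot : (φ + ε, a) ∉ shear m s '' D := fun hin => by linarith [le_sSup_fiber hK hin]
    obtain ⟨f, c, hfc, hcf⟩ := geometric_hahn_banach_closed_point (hD.linear_image (shear m s))
      hK.isClosed hnot
    have hf (p : ℝ × (Fin m → ℝ)) : f p = (dualCoord m f).1 * p.1 + (dualCoord m f).2 ⬝ᵥ p.2 := by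
      rw [← pairing_dualCoord, pairing_comm, pairing]
    set f₁ := (dualCoord m f).1
    set b := (dualCoord m f).2
    have hpos : 0 < f₁ := by
      have := hfc _ hmem
      rw [hf] at this hcf
      simp only at this hcf
      by_contra! hneg
      nlinarith
    obtain ⟨q, hq, hq'⟩ := (ha (s, f₁⁻¹ • b)).2
    have h1 := (hfc _ (Set.mem_image_of_mem _ hq)).trans hcf
    rw [hf, hf, shear_apply] at h1
    simp only at h1
    have h2 := partialConj_le hu hc h s (f₁⁻¹ • b)
    rw [pairing, smul_dotProduct, smul_eq_mul] at hq'
    rw [smul_dotProduct, smul_eq_mul] at h2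
    have h3 := mul_lt_mul_of_pos_left h1 (inv_pos.2 hpos)
    rw [mul_add f₁⁻¹, mul_add f₁⁻¹, inv_mul_cancel_left₀ hpos.ne',
      inv_mul_cancel_left₀ hpos.ne'] at h3
    linarith
  · obtain ⟨q, hq, hqa⟩ := hmem
    have h1 := (ha (s, β)).1 q hq
    rw [shear_apply, Prod.mk.injEq] at hqa
    rw [partialConj_eq hu hc h, ← hqa.1]
    rw [pairing, hqa.2] at h1
    linarith

theorem volume_interior_baseOf_lt_top (hDc : IsCompact D) :
    volume (interior (baseOf D)) < ⊤ :=
  (measure_mono interior_subset).trans_lt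
    (hDc.image (LinearMap.continuous_of_finiteDimensional
      (LinearMap.snd ℝ ℝ (Fin m → ℝ) ∘ₗ LinearMap.snd ℝ ℝ (ℝ × (Fin m → ℝ))))).measure_lt_top

theorem integrableOn_partialConj (hu : Differentiable ℝ u) (hc : ConvexOn ℝ Set.univ u)
    (hD : Convex ℝ D) (hDc : IsCompact D) (ha : IsSupportApprox D C u) (s : ℝ) :
    IntegrableOn (partialConj u s) (interior (baseOf D)) := by
  have hK : IsCompact (shear m s '' D) := hDc.image (shear m s).continuous_of_finiteDimensional
  have hint := integrableOn_interior_sSup_fiber hK (hD.linear_image (shear m s))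
  rw [snd_image_shear] at hint
  have hcont := (concaveOn_partialConj hu hc hD hDc ha s).continuousOn isOpen_interior
  have hfin : IsFiniteMeasure (volume.restrict (interior (baseOf D))) := isFiniteMeasure_restrict.2
    (volume_interior_baseOf_lt_top hDc).ne
  refine (Integrable.of_bound (f := fun a => partialConj u s a -
    sSup {t : ℝ | (t, a) ∈ shear m s '' D}) ((hcont.aestronglyMeasurable
      isOpen_interior.measurableSet).sub hint.aestronglyMeasurable) C ?_).add hint |>.congr ?_
  · filter_upwards [ae_restrict_mem isOpen_interior.measurableSet] with a h
    exact abs_partialConj_sub_le hu hc hD hDc ha h s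
  · exact Filter.Eventually.of_forall fun a => by simp

theorem abs_setIntegral_partialConj_sub_shadowVolume_le (hu : Differentiable ℝ u)
    (hc : ConvexOn ℝ Set.univ u) (hD : Convex ℝ D) (hDc : IsCompact D)
    (ha : IsSupportApprox D C u) (s : ℝ) :
    |(∫ a in interior (baseOf D), partialConj u s a) - shadowVolume m (shear m s '' D)| ≤
      C * volume.real (interior (baseOf D)) := by
  have hK : IsCompact (shear m s '' D) := hDc.image (shear m s).continuous_of_finiteDimensional
  have hint := integrableOn_interior_sSup_fiber hK (hD.linear_image (shear m s))
  rw [shadowVolume_eq_setIntegral_interior (hD.linear_image (shear m s))]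
  rw [snd_image_shear] at hint ⊢
  rw [← integral_sub (integrableOn_partialConj hu hc hD hDc ha s) hint]
  rw [← Real.norm_eq_abs]
  refine norm_setIntegral_le_of_norm_le_const (volume_interior_baseOf_lt_top hDc) fun a h => ?_
  exact abs_partialConj_sub_le hu hc hD hDc ha h s

end PartialConj

section Strip

variable {m : ℕ} {u : ℝ × (Fin m → ℝ) → ℝ} {D : Set (ℝ × (ℝ × (Fin m → ℝ)))} {C : ℝ}

theorem exists_hasDerivAt_partialConj (hu : Differentiable ℝ u) (hc : ConvexOn ℝ Set.univ u)
    (hDc : IsCompact D) (ha : IsSupportApprox D C u) {a : Fin m → ℝ}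
    (hint : a ∈ interior (baseOf D)) (s : ℝ) : ∃ β,
      grad u (s, β) = (deriv (fun s' => partialConj u s' a) s, a) ∧
        HasDerivAt (fun s' => partialConj u s' a) (deriv (fun s' => partialConj u s' a) s) s := by
  obtain ⟨w, β, h⟩ := exists_grad_eq hu hDc ha hint s
  have hd := hasDerivAt_partialConj hu hc h
  rw [hd.deriv]
  exact ⟨β, h, hd⟩

theorem hasDerivAt_setIntegral_partialConj (hu : Differentiable ℝ u)
    (hc : ConvexOn ℝ Set.univ u) (hD : Convex ℝ D) (hDc : IsCompact D)
    (ha : IsSupportApprox D C u) (s : ℝ) :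
    IntegrableOn (fun a => deriv (fun s' => partialConj u s' a) s) (interior (baseOf D)) ∧
    HasDerivAt (fun s' => ∫ a in interior (baseOf D), partialConj u s' a)
      (∫ a in interior (baseOf D), deriv (fun s' => partialConj u s' a) s) s := by
  obtain ⟨R, hR⟩ := hDc.isBounded.exists_norm_le
  have hU : MeasurableSet (interior (baseOf D)) := isOpen_interior.measurableSet
  have hint (s' : ℝ) := integrableOn_partialConj hu hc hD hDc ha s'
  refine hasDerivAt_integral_of_dominated_loc_of_deriv_le (s := Set.univ)
    (F' := fun s a => deriv (fun s' => partialConj u s' a) s) (bound := fun _ => R) Filter.univ_mem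
    (Filter.Eventually.of_forall fun s' => (hint s').aestronglyMeasurable) (hint s) ?_ ?_ ?_ ?_
  · refine aestronglyMeasurable_of_tendsto_ae (u := Filter.atTop)
      (f := fun (n : ℕ) a => ((n : ℝ) + 1) * (partialConj u (s + ((n : ℝ) + 1)⁻¹) a - partialConj u s a))
      (fun n => ((hint _).sub (hint _)).aestronglyMeasurable.const_mul _) ?_
    filter_upwards [ae_restrict_mem hU] with a h
    obtain ⟨β, -, hd⟩ := exists_hasDerivAt_partialConj hu hc hDc ha h s
    have hlim : Filter.Tendsto (fun n : ℕ => ((n : ℝ) + 1)⁻¹) Filter.atTop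
        (nhdsWithin 0 (Set.Ioi 0)) := by
      refine tendsto_nhdsWithin_iff.2 ⟨?_, Filter.Eventually.of_forall fun n => ?_⟩
      · simpa using tendsto_one_div_add_atTop_nhds_zero_nat (𝕜 := ℝ)
      · exact inv_pos.2 (by positivity : (0 : ℝ) < n + 1)
    refine (hd.tendsto_slope_zero_right.comp hlim).congr fun n => ?_
    simp
  · filter_upwards [ae_restrict_mem hU] with a h s' _
    obtain ⟨β, hg, -⟩ := exists_hasDerivAt_partialConj hu hc hDc ha h s'
    obtain ⟨q, hq, hq'⟩ := grad_mem_image_snd hu hc hD hDc ha (s', β)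
    rw [hg] at hq'
    have : q.2.1 = deriv (fun s' => partialConj u s' a) s' := congrArg Prod.fst hq'
    rw [← this]
    exact ((norm_fst_le q.2).trans (norm_snd_le q)).trans (hR q hq)
  · have : IsFiniteMeasure (volume.restrict (interior (baseOf D))) := isFiniteMeasure_restrict.2
      (volume_interior_baseOf_lt_top hDc).ne
    exact integrable_const R
  · filter_upwards [ae_restrict_mem hU] with a h s' _
    exact (exists_hasDerivAt_partialConj hu hc hDc ha h s').choose_spec.2

theorem measurableSet_grad_image_strip (hu : ContDiff ℝ 2 u) (s₁ s₂ : ℝ) :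
    MeasurableSet (grad u '' (Set.Icc s₁ s₂ ×ˢ Set.univ)) := by
  have h : IsSigmaCompact (Set.Icc s₁ s₂ ×ˢ (Set.univ : Set (Fin m → ℝ))) :=
    isSigmaCompact_univ.of_isClosed_subset (isClosed_Icc.prod isClosed_univ) (Set.subset_univ _)
  obtain ⟨K, hK, hK'⟩ := h.image (continuous_grad hu)
  rw [← hK']
  exact MeasurableSet.iUnion fun n => (hK n).isClosed.measurableSet

theorem volume_grad_image_strip (hu : ContDiff ℝ 2 u)
    (hc : ConvexOn ℝ Set.univ u) (hD : Convex ℝ D) (hDc : IsCompact D)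
    (ha : IsSupportApprox D C u) {s₁ s₂ : ℝ} (hs : s₁ ≤ s₂) :
    volume (grad u '' (Set.Icc s₁ s₂ ×ˢ Set.univ)) =
      ∫⁻ a in interior (baseOf D), ENNReal.ofReal (deriv (fun s' => partialConj u s' a) s₂ -
        deriv (fun s' => partialConj u s' a) s₁) := by
  have hd : Differentiable ℝ u := hu.differentiable (by norm_num)
  rw [Measure.volume_eq_prod, Measure.prod_apply_symm (measurableSet_grad_image_strip hu s₁ s₂),
    ← lintegral_indicator isOpen_interior.measurableSet]
  refine lintegral_congr_ae ?_
  have hfr : ∀ᵐ a : Fin m → ℝ, a ∉ frontier (baseOf D) :=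
    measure_eq_zero_iff_ae_notMem.1 ((hD.linear_image _).addHaar_frontier volume)
  filter_upwards [hfr] with a hfr
  by_cases hint : a ∈ interior (baseOf D)
  · rw [Set.indicator_of_mem hint]
    obtain ⟨β₁, h₁, -⟩ := exists_hasDerivAt_partialConj hd hc hDc ha hint s₁
    obtain ⟨β₂, h₂, -⟩ := exists_hasDerivAt_partialConj hd hc hDc ha hint s₂
    rw [← Real.volume_Icc, ← grad_strip_slice hd hc hDc ha hint hs h₁ h₂]
    rfl
  · rw [Set.indicator_of_notMem hint]
    refine (congrArg volume (Set.eq_empty_of_forall_notMem fun w hw => ?_)).trans measure_empty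
    obtain ⟨z, -, hz⟩ := hw
    obtain ⟨q, hq, hq'⟩ := grad_mem_image_snd hd hc hD hDc ha z
    refine hfr ⟨subset_closure ⟨q, hq, ?_⟩, hint⟩
    rw [hz] at hq'
    exact congrArg Prod.snd hq'

/-- The increments of the derivative of the approximate shadow volume are the integrals of the
Hessian determinant over vertical strips. -/
theorem setIntegral_det_hess_strip (hu : ContDiff ℝ 2 u)
    (hc : ConvexOn ℝ Set.univ u) (hD : Convex ℝ D) (hDc : IsCompact D)
    (ha : IsSupportApprox D C u) {s₁ s₂ : ℝ} (hs : s₁ ≤ s₂) :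
    IntegrableOn (fun z => (hess u z).det) (Set.Icc s₁ s₂ ×ˢ Set.univ) ∧
    (∫ a in interior (baseOf D), deriv (fun s' => partialConj u s' a) s₂) -
      (∫ a in interior (baseOf D), deriv (fun s' => partialConj u s' a) s₁) =
        ∫ z in Set.Icc s₁ s₂ ×ˢ Set.univ, (hess u z).det := by
  have hd : Differentiable ℝ u := hu.differentiable (by norm_num)
  have hdet (z) : 0 ≤ (hess u z).det := (hess_posSemidef hu hc z).det_nonneg
  have hi (s : ℝ) := (hasDerivAt_setIntegral_partialConj hd hc hD hDc ha s).1
  have hvol := volume_grad_image hu hc (A := Set.Icc s₁ s₂ ×ˢ Set.univ)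
    (measurableSet_Icc.prod MeasurableSet.univ)
  simp_rw [abs_of_nonneg (hdet _)] at hvol
  have hfin : volume (grad u '' (Set.Icc s₁ s₂ ×ˢ Set.univ)) < ⊤ := by
    refine (measure_mono ?_).trans_lt (hDc.image (LinearMap.snd ℝ ℝ
      (ℝ × (Fin m → ℝ))).continuous_of_finiteDimensional).measure_lt_top
    rintro _ ⟨z, -, rfl⟩
    exact grad_mem_image_snd hd hc hD hDc ha z
  have hmeas := (continuous_det_hess hu).aestronglyMeasurable
    (μ := volume.restrict (Set.Icc s₁ s₂ ×ˢ Set.univ))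
  refine ⟨⟨hmeas, ?_⟩, ?_⟩
  · rw [hasFiniteIntegral_iff_ofReal (Filter.Eventually.of_forall hdet), ← hvol]
    exact hfin
  · rw [← integral_sub (hi s₂) (hi s₁), integral_eq_lintegral_of_nonneg_ae
      (Filter.Eventually.of_forall hdet) hmeas, ← hvol,
      volume_grad_image_strip hu hc hD hDc ha hs, integral_eq_lintegral_of_nonneg_ae]
    · filter_upwards [ae_restrict_mem isOpen_interior.measurableSet] with a hint
      obtain ⟨β₁, h₁, -⟩ := exists_hasDerivAt_partialConj hd hc hDc ha hint s₁
      obtain ⟨β₂, h₂, -⟩ := exists_hasDerivAt_partialConj hd hc hDc ha hint s₂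
      exact sub_nonneg.2 (grad_fst_mono hd hc h₁ h₂ hs)
    · exact ((hi s₂).sub (hi s₁)).aestronglyMeasurable

end Strip

section Approximation

variable {m : ℕ}

theorem abs_pairing_le (z p : ℝ × (Fin m → ℝ)) : |pairing z p| ≤ (m + 1) * (‖z‖ * ‖p‖) := by
  have h1 : |z.1 * p.1| ≤ ‖z‖ * ‖p‖ := by
    rw [abs_mul]
    exact mul_le_mul (norm_fst_le z) (norm_fst_le p) (abs_nonneg _) (norm_nonneg _)
  have h2 : |z.2 ⬝ᵥ p.2| ≤ m * (‖z‖ * ‖p‖) := by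
    refine (Finset.abs_sum_le_sum_abs _ _).trans ?_
    refine (Finset.sum_le_card_nsmul _ _ (‖z‖ * ‖p‖) fun j _ => ?_).trans_eq (by simp)
    rw [abs_mul]
    exact mul_le_mul ((norm_le_pi_norm z.2 j).trans (norm_snd_le z))
      ((norm_le_pi_norm p.2 j).trans (norm_snd_le p)) (abs_nonneg _) (norm_nonneg _)
  have h3 := abs_add_le (z.1 * p.1) (z.2 ⬝ᵥ p.2)
  rw [pairing]
  linarith

theorem exists_isSupportApprox {D : Set (ℝ × (ℝ × (Fin m → ℝ)))} (hDc : IsCompact D)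
    (hne : D.Nonempty) {δ : ℝ} (hδ : 0 < δ) : ∃ u : ℝ × (Fin m → ℝ) → ℝ,
      ContDiff ℝ 2 u ∧ ConvexOn ℝ Set.univ u ∧ IsSupportApprox D δ u := by
  have hmax (z : ℝ × (Fin m → ℝ)) : ∃ q ∈ D, ∀ q' ∈ D, q'.1 + pairing z q'.2 ≤ q.1 + pairing z q.2 := by
    refine hDc.exists_isMaxOn hne (f := fun q => q.1 + pairing z q.2) (Continuous.continuousOn ?_)
    unfold pairing dotProduct
    fun_prop
  choose q hq hmax using hmax
  obtain ⟨R, hR0, hR⟩ := hDc.isBounded.exists_pos_norm_le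
  set h : ℝ × (Fin m → ℝ) → ℝ := fun z => (q z).1 + pairing z (q z).2
  have hc : ConvexOn ℝ Set.univ h := by
    refine ⟨convex_univ, fun z₁ _ z₂ _ t₁ t₂ ht₁ ht₂ ht => ?_⟩
    set p := q (t₁ • z₁ + t₂ • z₂)
    have e₁ := mul_le_mul_of_nonneg_left (hmax z₁ p (hq _)) ht₁
    have e₂ := mul_le_mul_of_nonneg_left (hmax z₂ p (hq _)) ht₂
    change p.1 + pairing (t₁ • z₁ + t₂ • z₂) p.2 ≤ t₁ * h z₁ + t₂ * h z₂
    rw [pairing_add_left, pairing_smul_left, pairing_smul_left]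
    have e₃ : p.1 = t₁ * p.1 + t₂ * p.1 := by rw [← add_mul, ht, one_mul]
    linarith
  have hL : LipschitzWith (Real.toNNReal ((m + 1) * R)) h := by
    refine LipschitzWith.of_le_add_mul' _ fun z z' => ?_
    have e₁ := hmax z' (q z) (hq _)
    have e₂ := (le_abs_self _).trans (abs_pairing_le (z - z') (q z).2)
    have e₃ : ‖z - z'‖ * ‖(q z).2‖ ≤ ‖z - z'‖ * R :=
      mul_le_mul_of_nonneg_left ((norm_snd_le _).trans (hR _ (hq z))) (norm_nonneg _)
    have e₄ := mul_le_mul_of_nonneg_left e₃ (by positivity : (0 : ℝ) ≤ m + 1)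
    rw [pairing_sub_left] at e₂
    rw [dist_eq_norm]
    simp only [h]
    linarith
  obtain ⟨u, hu, huc, hud⟩ := hc.exists_contDiff_convexOn_abs_sub_le hL hδ
  refine ⟨u, hu, huc, fun z => ⟨fun p hp => ?_, q z, hq z, ?_⟩⟩
  · linarith [hmax z p hp, (abs_sub_le_iff.1 (hud z)).2]
  · linarith [(abs_sub_le_iff.1 (hud z)).1]

open scoped Pointwise in
theorem IsSupportApprox.add {D D' : Set (ℝ × (ℝ × (Fin m → ℝ)))} {C C' : ℝ}
    {u u' : ℝ × (Fin m → ℝ) → ℝ} (h : IsSupportApprox D C u) (h' : IsSupportApprox D' C' u') :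
    IsSupportApprox (D + D') (C + C') (fun z => u z + u' z) := by
  intro z
  refine ⟨?_, ?_⟩
  · rintro _ ⟨q, hq, q', hq', rfl⟩
    have e := (h z).1 q hq
    have e' := (h' z).1 q' hq'
    simp only [Prod.fst_add, Prod.snd_add, pairing_add_right]
    linarith
  · obtain ⟨q, hq, e⟩ := (h z).2
    obtain ⟨q', hq', e'⟩ := (h' z).2
    refine ⟨q + q', Set.add_mem_add hq hq', ?_⟩
    simp only [Prod.fst_add, Prod.snd_add, pairing_add_right]
    linarith

theorem IsSupportApprox.sum {ι : Type*} {D : ι → ConvexBody (ℝ × (ℝ × (Fin m → ℝ)))} {C : ℝ}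
    {u : ι → ℝ × (Fin m → ℝ) → ℝ} (h : ∀ i, IsSupportApprox (D i : Set _) C (u i))
    (t : Finset ι) : IsSupportApprox ((∑ i ∈ t, D i : ConvexBody _) : Set _) (t.card * C)
      (fun z => ∑ i ∈ t, u i z) := by
  classical
  induction t using Finset.induction_on with
  | empty => intro z; simp [pairing]
  | insert i t hi ih =>
    have := (h i).add ih
    simp only [Finset.sum_insert hi, ConvexBody.coe_add]
    rwa [Finset.card_insert_of_notMem hi, Nat.cast_add, Nat.cast_one, add_mul, one_mul, add_comm]

theorem hess_sum {ι : Type*} {u : ι → ℝ × (Fin m → ℝ) → ℝ} (hu : ∀ i, ContDiff ℝ 2 (u i))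
    (t : Finset ι) (z : ℝ × (Fin m → ℝ)) :
    hess (fun z => ∑ i ∈ t, u i z) z = ∑ i ∈ t, hess (u i) z := by
  have h1 : fderiv ℝ (fun z => ∑ i ∈ t, u i z) = fun z => ∑ i ∈ t, fderiv ℝ (u i) z :=
    funext fun z => fderiv_fun_sum fun i _ => (hu i).differentiable (by norm_num) z
  have h2 (i : ι) : Differentiable ℝ (fderiv ℝ (u i)) :=
    ((hu i).fderiv_right (m := 1) (by norm_num)).differentiable (by norm_num)
  ext j k
  rw [hess, h1, fderiv_fun_sum fun i _ => h2 i z]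
  simp [Matrix.sum_apply, hess]

end Approximation

/-- A function that is uniformly approximated by convex functions is convex. -/
theorem ConvexOn.of_forall_abs_sub_le {E : Type*} [AddCommGroup E] [Module ℝ E] {s : Set E}
    (hs : Convex ℝ s) {F : E → ℝ} {M : ℝ}
    (h : ∀ δ > 0, ∃ G, ConvexOn ℝ s G ∧ ∀ x ∈ s, |G x - F x| ≤ δ * M) : ConvexOn ℝ s F := by
  refine ⟨hs, fun x hx y hy a b ha hb hab => ?_⟩
  have hlim : Filter.Tendsto (fun δ : ℝ => a • F x + b • F y + 2 * (δ * M))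
      (nhdsWithin 0 (Set.Ioi 0)) (nhds (a • F x + b • F y)) := by
    refine tendsto_nhdsWithin_of_tendsto_nhds (Continuous.tendsto' (by fun_prop) _ _ (by simp))
  refine ge_of_tendsto hlim ?_
  filter_upwards [self_mem_nhdsWithin] with δ hδ
  obtain ⟨G, hG, hGF⟩ := h δ hδ
  have e₁ := (abs_sub_le_iff.1 (hGF _ (hs hx hy ha hb hab))).2
  have e₂ := mul_le_mul_of_nonneg_left (abs_sub_le_iff.1 (hGF x hx)).1 ha
  have e₃ := mul_le_mul_of_nonneg_left (abs_sub_le_iff.1 (hGF y hy)).1 hb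
  have e₄ := hG.2 hx hy ha hb hab
  have e₅ : δ * M = a * (δ * M) + b * (δ * M) := by rw [← add_mul, hab, one_mul]
  simp only [smul_eq_mul] at *
  linarith

theorem convexOn_sum_neg_one_pow_shadowVolume {m : ℕ}
    (D : Fin (m + 1) → ConvexBody (ℝ × (ℝ × (Fin m → ℝ)))) :
    ConvexOn ℝ Set.univ fun s => ∑ J : Finset (Fin (m + 1)), (-1 : ℝ) ^ J.card *
      shadowVolume m (shear m s '' ((∑ i ∈ Jᶜ, D i : ConvexBody _) : Set _)) := by
  refine ConvexOn.of_forall_abs_sub_le convex_univ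
    (M := ∑ J : Finset (Fin (m + 1)), Jᶜ.card * volume.real
      (interior (baseOf ((∑ i ∈ Jᶜ, D i : ConvexBody _) : Set (ℝ × (ℝ × (Fin m → ℝ))))))) fun δ hδ => ?_
  choose u hu huc hua using fun i => exists_isSupportApprox (D i).isCompact (D i).nonempty hδ
  set E : Finset (Fin (m + 1)) → ConvexBody (ℝ × (ℝ × (Fin m → ℝ))) := fun J => ∑ i ∈ Jᶜ, D i
  set U : Finset (Fin (m + 1)) → ℝ × (Fin m → ℝ) → ℝ := fun J z => ∑ i ∈ Jᶜ, u i z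
  have hU (J) : ContDiff ℝ 2 (U J) := ContDiff.sum fun i _ => hu i
  have hUc (J) : ConvexOn ℝ Set.univ (U J) := by
    refine ⟨convex_univ, fun x _ y _ a b ha hb hab => ?_⟩
    simp only [U, Finset.smul_sum, ← Finset.sum_add_distrib]
    exact Finset.sum_le_sum fun i _ => (huc i).2 trivial trivial ha hb hab
  have hUa (J) : IsSupportApprox (E J : Set _) (Jᶜ.card * δ) (U J) := IsSupportApprox.sum hua Jᶜ
  have hUd (J) : Differentiable ℝ (U J) := (hU J).differentiable (by norm_num)
  have hder (s : ℝ) := HasDerivAt.fun_sum (u := Finset.univ) fun J _ =>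
    (hasDerivAt_setIntegral_partialConj (hUd J) (hUc J) (E J).convex (E J).isCompact
      (hUa J) s).2.const_mul ((-1 : ℝ) ^ J.card)
  refine ⟨_, Monotone.convexOn_univ_of_deriv (fun s => (hder s).differentiableAt) ?_, ?_⟩
  · intro s₁ s₂ hs
    rw [(hder s₁).deriv, (hder s₂).deriv, ← sub_nonneg, ← Finset.sum_sub_distrib]
    have hstrip (J) := setIntegral_det_hess_strip (hU J) (hUc J) (E J).convex (E J).isCompact
      (hUa J) hs
    simp_rw [← mul_sub, (hstrip _).2, ← integral_const_mul]
    rw [← integral_finsetSum _ fun J _ => (hstrip J).1.const_mul _]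
    refine integral_nonneg fun z => ?_
    have hpol := (detOfRows (Fin (m + 1))).sum_neg_one_pow_card_mul_map_sum_compl
      (fun i => hess (u i) z)
    have hnn := sum_perm_detOfRows_nonneg fun i => hess_posSemidef (hu i) (huc i) z
    rw [← hpol] at hnn
    refine hnn.trans_eq (Finset.sum_congr rfl fun J _ => ?_)
    rw [hess_sum hu]
    rfl
  · intro s _
    rw [← Finset.sum_sub_distrib, Finset.mul_sum]
    refine (Finset.abs_sum_le_sum_abs _ _).trans (Finset.sum_le_sum fun J _ => ?_)
    rw [← mul_sub, abs_mul, abs_pow, abs_neg, abs_one, one_pow, one_mul]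
    refine (abs_setIntegral_partialConj_sub_shadowVolume_le (hUd J) (hUc J) (E J).convex
      (E J).isCompact (hUa J) s).trans_eq (by ring)

/-- The image of a convex body under a linear map, as a homomorphism for Minkowski addition. -/
noncomputable def ConvexBody.linearImage {V W : Type*} [NormedAddCommGroup V] [NormedSpace ℝ V]
    [FiniteDimensional ℝ V] [NormedAddCommGroup W] [NormedSpace ℝ W] (f : V →ₗ[ℝ] W) :
    ConvexBody V →+ ConvexBody W where
  toFun K :=
    { carrier := f '' K
      convex' := K.convex.linear_image f
      isCompact' := K.isCompact.image f.continuous_of_finiteDimensional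
      nonempty' := K.nonempty.image f }
  map_zero' := ConvexBody.ext (by simp [Set.singleton_zero])
  map_add' K L := ConvexBody.ext (by simp [Set.image_add])

/-- A symmetric function of tuples which is additive in each argument is determined by its
diagonal. -/
theorem factorial_mul_eq_sum_of_symm_of_add {M : Type*} [AddCommMonoid M] {n : ℕ}
    (L : (Fin n → M) → ℝ) (hsymm : ∀ (x : Fin n → M) (σ : Equiv.Perm (Fin n)), L (x ∘ σ) = L x)
    (hadd : ∀ (x : Fin n → M) (i : Fin n) (a b : M),
      L (Function.update x i (a + b)) = L (Function.update x i a) + L (Function.update x i b))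
    (x : Fin n → M) :
    n.factorial * L x = ∑ J : Finset (Fin n), (-1 : ℝ) ^ J.card * L (fun _ => ∑ i ∈ Jᶜ, x i) := by
  let Λ : MultilinearMap ℕ (fun _ : Fin n => M) ℝ :=
    { toFun := L
      map_update_add' := fun {inst} x i a b => by
        obtain rfl : inst = instDecidableEqFin n := Subsingleton.elim _ _
        exact hadd x i a b
      map_update_smul' := fun {inst} x i c a => by
        obtain rfl : inst = instDecidableEqFin n := Subsingleton.elim _ _
        exact map_nsmul (AddMonoidHom.mk' (fun a => L (Function.update x i a)) (hadd x i)) c a }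
  have h := Λ.sum_neg_one_pow_card_mul_map_sum_compl x
  refine Eq.trans ?_ h.symm
  have hσ (σ : Equiv.Perm (Fin n)) : Λ (fun i => x (σ i)) = L x := hsymm x σ
  simp [hσ, Fintype.card_perm]

open scoped Pointwise in
theorem shadowVolume_image_smul_fst {m : ℕ} {t : ℝ} (ht : 0 ≤ t) (B : Set (ℝ × (Fin m → ℝ))) :
    shadowVolume m ((fun p => (t * p.1, p.2)) '' B) = t * shadowVolume m B := by
  have hfib (a : Fin m → ℝ) :
      {τ : ℝ | (τ, a) ∈ (fun p : ℝ × (Fin m → ℝ) => (t * p.1, p.2)) '' B} =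
        t • {τ : ℝ | (τ, a) ∈ B} := by
    ext τ
    simp [Set.mem_smul_set]
  rw [shadowVolume, shadowVolume, Set.image_image, ← integral_const_mul]
  simp_rw [hfib, Real.sSup_smul_of_nonneg ht, smul_eq_mul]

/-- A function which is convex along every line is convex. -/
theorem convexOn_univ_of_forall_line {E : Type*} [AddCommGroup E] [Module ℝ E] {f : E → ℝ}
    (h : ∀ x v, ConvexOn ℝ Set.univ fun s : ℝ => f (x + s • v)) : ConvexOn ℝ Set.univ f := by
  refine ⟨convex_univ, fun x _ y _ a b ha hb hab => ?_⟩
  have := (h x (y - x)).2 (Set.mem_univ 0) (Set.mem_univ 1) ha hb hab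
  have hxy : a • x + b • y = x + b • (y - x) := by
    rw [← eq_sub_iff_add_eq] at hab
    rw [hab]
    module
  rw [hxy]
  simpa using this

section GammaBody

variable {l m : ℕ}

/-- The linear map `(x, y) ↦ (γ(x), (η(x), y))`. -/
noncomputable def gammaPencil (m : ℕ) (γ η : (Fin l → ℝ) →ₗ[ℝ] ℝ) :
    ((Fin l → ℝ) × (Fin m → ℝ)) →ₗ[ℝ] ℝ × (ℝ × (Fin m → ℝ)) :=
  (γ.comp (LinearMap.fst ℝ (Fin l → ℝ) (Fin m → ℝ))).prod (gammaMap l m η)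

theorem coe_gammaBody_add_smul (K : ConvexBody ((Fin l → ℝ) × (Fin m → ℝ)))
    (γ η : (Fin l → ℝ) →ₗ[ℝ] ℝ) (s : ℝ) : (gammaBody l m K (γ + s • η) : Set (ℝ × (Fin m → ℝ))) =
      shear m s '' (ConvexBody.linearImage (gammaPencil m γ η) K :
        Set (ℝ × (ℝ × (Fin m → ℝ)))) :=
  (Set.image_image (shear m s) (gammaPencil m γ η)
    (K : Set ((Fin l → ℝ) × (Fin m → ℝ)))).symm

theorem coe_gammaBody_smul (K : ConvexBody ((Fin l → ℝ) × (Fin m → ℝ)))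
    (γ : (Fin l → ℝ) →ₗ[ℝ] ℝ) (t : ℝ) : (gammaBody l m K (t • γ) : Set (ℝ × (Fin m → ℝ))) =
      (fun p => (t * p.1, p.2)) '' (gammaBody l m K γ : Set (ℝ × (Fin m → ℝ))) :=
  (Set.image_image (fun p : ℝ × (Fin m → ℝ) => (t * p.1, p.2)) (gammaMap l m γ)
    (K : Set ((Fin l → ℝ) × (Fin m → ℝ)))).symm

theorem sum_gammaBody {ι : Type*} (Δ : ι → ConvexBody ((Fin l → ℝ) × (Fin m → ℝ)))
    (γ : (Fin l → ℝ) →ₗ[ℝ] ℝ) (t : Finset ι) :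
    ∑ i ∈ t, gammaBody l m (Δ i) γ = gammaBody l m (∑ i ∈ t, Δ i) γ :=
  (map_sum (ConvexBody.linearImage (gammaMap l m γ)) Δ t).symm

end GammaBody

/-- Convexity and positive homogeneity of the mixed shadow volume of the bodies
`Γ_{Δ_i}(γ)`, as a function of the linear functional `γ`. -/
theorem mixedShadowVolume_gamma_convex (l m : ℕ)
    (MS : (Fin (m + 1) → ConvexBody (ℝ × (Fin m → ℝ))) → ℝ)
    (MS_symm : ∀ (Δ : Fin (m + 1) → ConvexBody (ℝ × (Fin m → ℝ)))
      (σ : Equiv.Perm (Fin (m + 1))), MS (Δ ∘ σ) = MS Δ)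
    (MS_add : ∀ (Δ : Fin (m + 1) → ConvexBody (ℝ × (Fin m → ℝ))) (i : Fin (m + 1))
      (K K' : ConvexBody (ℝ × (Fin m → ℝ))),
      MS (Function.update Δ i (K + K'))
        = MS (Function.update Δ i K) + MS (Function.update Δ i K'))
    (MS_diag : ∀ B : ConvexBody (ℝ × (Fin m → ℝ)),
      MS (fun _ => B) = shadowVolume m (B : Set (ℝ × (Fin m → ℝ))))
    (Δ : Fin (m + 1) → ConvexBody ((Fin l → ℝ) × (Fin m → ℝ))) :
    ConvexOn ℝ Set.univ (fun γ : (Fin l → ℝ) →ₗ[ℝ] ℝ =>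
        MS (fun i => gammaBody l m (Δ i) γ)) ∧
      (∀ (γ : (Fin l → ℝ) →ₗ[ℝ] ℝ) (t : ℝ), 0 ≤ t →
        MS (fun i => gammaBody l m (Δ i) (t • γ)) = t * MS (fun i => gammaBody l m (Δ i) γ)) := by
  have polar (γ : (Fin l → ℝ) →ₗ[ℝ] ℝ) :
      ((m + 1).factorial : ℝ) * MS (fun i => gammaBody l m (Δ i) γ) =
        ∑ J : Finset (Fin (m + 1)), (-1 : ℝ) ^ J.card *
          shadowVolume m (gammaBody l m (∑ i ∈ Jᶜ, Δ i) γ : Set _) := by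
    rw [factorial_mul_eq_sum_of_symm_of_add MS MS_symm MS_add]
    simp_rw [MS_diag, sum_gammaBody]
  have hpos : (0 : ℝ) < (m + 1).factorial := by positivity
  refine ⟨convexOn_univ_of_forall_line fun γ η => ?_, fun γ t ht => ?_⟩
  · have h := convexOn_sum_neg_one_pow_shadowVolume
      fun i => ConvexBody.linearImage (gammaPencil m γ η) (Δ i)
    simp_rw [← map_sum, ← coe_gammaBody_add_smul, ← polar] at h
    refine (h.smul (inv_pos.2 hpos).le).congr fun s _ => ?_
    simp [hpos.ne']
  · refine mul_left_cancel₀ hpos.ne' ?_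
    rw [polar, mul_left_comm, polar, Finset.mul_sum]
    refine Finset.sum_congr rfl fun J _ => ?_
    rw [coe_gammaBody_smul, shadowVolume_image_smul_fst ht]
    ring
end
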